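/- Nondegeneracy (linear growth from the boundary) for inward minimizers: Let n ≥ 2, R > 0, 0 < v < v_max < |B_R(0)|. There exist η₀ > 0 and, for each η ≤ η₀, constants δ_m, 𝔗_m, c_m > 0 depending only on n, R, v, v_max, η, and for each 𝔗 < 𝔗_m a constant τ_m > 0 (depending additionally on 𝔗), such that for every admissible nonlinearity 𝔥 and every τ < τ_m the following holds: if Ω ∈ 𝓗 is an inward minimizer of ℱ_τ with ℰ(Ω) ≤ ℰ_min + δ_m, then Ω has a unique normalized first eigenfunction u_Ω, and for every y in the closure of Ω and every r ∈ (0,1), sup_{B_r(y)} ( u_Ω + √𝔗·w_Ω ) ≥ c_m·r, where w_Ω is the torsion function of Ω. -/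

import Mathlib

open MeasureTheory Metric Set Filter Bornology
open scoped ENNReal NNReal Topology

noncomputable section

abbrev Euc (n : ℕ) := EuclideanSpace ℝ (Fin n)

/-- A smooth test function compactly supported in `Ω`. -/
def IsTestFun {n : ℕ} (Ω : Set (Euc n)) (φ : Euc n → ℝ) : Prop :=
  ContDiff ℝ (⊤ : ℕ∞) φ ∧ HasCompactSupport φ ∧ tsupport φ ⊆ Ω

/-- `u` belongs to `H¹₀(Ω)` with weak gradient `Du`: it is an `L²` limit of smooth
functions compactly supported in `Ω` whose gradients converge to `Du` in `L²`. -/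
def MemH10 {n : ℕ} (Ω : Set (Euc n)) (u : Euc n → ℝ) (Du : Euc n → Euc n) : Prop :=
  MemLp u 2 volume ∧ MemLp Du 2 volume ∧
  ∃ φ : ℕ → Euc n → ℝ, (∀ k, IsTestFun Ω (φ k)) ∧
    Tendsto (fun k => ∫ x, (φ k x - u x) ^ 2) atTop (𝓝 0) ∧
    Tendsto (fun k => ∫ x, ‖gradient (φ k) x - Du x‖ ^ 2) atTop (𝓝 0)

/-- First Dirichlet eigenvalue: infimum of the Rayleigh quotient over `H¹₀(Ω)`. -/
def lam1 {n : ℕ} (Ω : Set (Euc n)) : ℝ :=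
  sInf {r | ∃ u Du, MemH10 Ω u Du ∧ (∫ x, u x ^ 2) ≠ 0 ∧
    r = (∫ x, ‖Du x‖ ^ 2) / (∫ x, u x ^ 2)}

/-- Torsional rigidity: `tor Ω = inf { ∫ (½|∇w|² − w) : w ∈ H¹₀(Ω) }`. -/
def tor {n : ℕ} (Ω : Set (Euc n)) : ℝ :=
  sInf {r | ∃ w Dw, MemH10 Ω w Dw ∧ r = ∫ x, ((1 / 2) * ‖Dw x‖ ^ 2 - w x)}

/-- Normalized first eigenfunction of `Ω`, extended by zero outside `Ω`. -/
def IsEigenfun {n : ℕ} (Ω : Set (Euc n)) (u : Euc n → ℝ) : Prop :=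
  (∀ᵐ x ∂volume, 0 ≤ u x) ∧ (∀ x ∉ Ω, u x = 0) ∧ (∫ x, u x ^ 2) = 1 ∧
  ∃ Du, MemH10 Ω u Du ∧ (∫ x, ‖Du x‖ ^ 2) = lam1 Ω

/-- The torsion function of `Ω` (the minimizer of the torsion energy),
extended by zero outside `Ω`. -/
def IsTorsionFun {n : ℕ} (Ω : Set (Euc n)) (w : Euc n → ℝ) : Prop :=
  (∀ x ∉ Ω, w x = 0) ∧
  ∃ Dw, MemH10 Ω w Dw ∧ (∫ x, ((1 / 2) * ‖Dw x‖ ^ 2 - w x)) = tor Ω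

/-- The volume penalization `f_{v,η}`. -/
def fpen (v η t : ℝ) : ℝ := if t ≤ v then η * (t - v) else (t - v) / η

/-- The base energy `ℰ(Ω) = λ₁(Ω) + 𝔗·tor(Ω) + f_{v,η}(|Ω|)`. -/
def baseE {n : ℕ} (v η 𝔗 : ℝ) (Ω : Set (Euc n)) : ℝ :=
  lam1 Ω + 𝔗 * tor Ω + fpen v η (volume Ω).toReal

/-- The admissible class `𝓗 = { Ω ⊆ B_R(0) open nonempty : |Ω| ≤ v_max }`. -/
def Hclass (n : ℕ) (R vmax : ℝ) : Set (Set (Euc n)) :=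
  {Ω | IsOpen Ω ∧ Ω.Nonempty ∧ Ω ⊆ ball (0 : Euc n) R ∧ (volume Ω).toReal ≤ vmax}

/-- `ℰ_min = inf { ℰ(Ω) : Ω ∈ 𝓗 }`. -/
def Emin (n : ℕ) (R vmax v η 𝔗 : ℝ) : ℝ :=
  sInf (baseE v η 𝔗 '' Hclass n R vmax)

/-- `u` is the (a.e.-) unique normalized first eigenfunction of `Ω`. -/
def UniqueEigen {n : ℕ} (Ω : Set (Euc n)) (u : Euc n → ℝ) : Prop :=
  IsEigenfun Ω u ∧ ∀ u' : Euc n → ℝ, IsEigenfun Ω u' → u' =ᵐ[volume] u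

/-- An admissible nonlinearity with threshold `τ₀`: `𝔥 : 𝓗 → [0,1]` which is Lipschitz
with respect to the symmetric difference plus the `L¹` eigenfunction distance, on sets
of nearly minimal base energy possessing a unique normalized first eigenfunction. -/
def Admissible (n : ℕ) (R vmax v η 𝔗 τ₀ : ℝ) (h : Set (Euc n) → ℝ) : Prop :=
  (∀ Ω ∈ Hclass n R vmax, h Ω ∈ Icc (0 : ℝ) 1) ∧
  ∀ Ω ∈ Hclass n R vmax, ∀ Ω' ∈ Hclass n R vmax,
    baseE v η 𝔗 Ω ≤ Emin n R vmax v η 𝔗 + τ₀ →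
    baseE v η 𝔗 Ω' ≤ Emin n R vmax v η 𝔗 + τ₀ →
    ∀ u u' : Euc n → ℝ, UniqueEigen Ω u → UniqueEigen Ω' u' →
      |h Ω - h Ω'| ≤ (volume (symmDiff Ω Ω')).toReal + ∫ x, |u x - u' x|

/-- The main energy `ℱ_τ(Ω) = ℰ(Ω) + τ·𝔥(Ω)`. -/
def mainE {n : ℕ} (v η 𝔗 τ : ℝ) (h : Set (Euc n) → ℝ) (Ω : Set (Euc n)) : ℝ :=
  baseE v η 𝔗 Ω + τ * h Ω

abbrev LL (n : ℕ) := Lp ℝ 2 (volume : Measure (Euc n))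
abbrev LV (n : ℕ) := Lp (Euc n) 2 (volume : Measure (Euc n))
abbrev HH (n : ℕ) := LL n × LV n

section basics
variable {n : ℕ}

theorem inner_LL (f g : LL n) : inner ℝ f g = ∫ x, f x * g x := by
  rw [L2.inner_def]; congr 1; ext x; simp [mul_comm]

theorem inner_LV (f g : LV n) : inner ℝ f g = ∫ x, inner ℝ (f x) (g x) := L2.inner_def f g

theorem normsq_L2 {E : Type*} [NormedAddCommGroup E] [InnerProductSpace ℝ E]
    (f : Lp E 2 (volume : Measure (Euc n))) : ‖f‖ ^ 2 = ∫ x, ‖f x‖ ^ 2 := by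
  rw [← real_inner_self_eq_norm_sq, L2.inner_def]; simp

theorem normsq_LL (f : LL n) : ‖f‖ ^ 2 = ∫ x, f x ^ 2 := by
  rw [normsq_L2]; simp

theorem integrable_sq_L2 {E : Type*} [NormedAddCommGroup E]
    (f : Lp E 2 (volume : Measure (Euc n))) : Integrable (fun x => ‖f x‖ ^ 2) := by
  have := (Lp.memLp f).norm
  exact this.integrable_sq

theorem integrable_mul_LL (f g : LL n) : Integrable (fun x => f x * g x) := by
  have := L2.integrable_inner (𝕜 := ℝ) f g
  simpa [mul_comm] using this

theorem L2_dct {E : Type*} [NormedAddCommGroup E] [InnerProductSpace ℝ E]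
    (F : ℕ → Lp E 2 (volume : Measure (Euc n))) (F0 : Lp E 2 (volume : Measure (Euc n)))
    (G : Euc n → ℝ) (hG : MemLp G 2 volume)
    (hb : ∀ k, ∀ᵐ x, ‖F k x - F0 x‖ ≤ G x)
    (hl : ∀ᵐ x, Tendsto (fun k => F k x) atTop (𝓝 (F0 x))) : Tendsto F atTop (𝓝 F0) := by
  rw [tendsto_iff_norm_sub_tendsto_zero]
  have h2 : Tendsto (fun k => ‖F k - F0‖ ^ 2) atTop (𝓝 0) := by
    have e : ∀ k, ‖F k - F0‖ ^ 2 = ∫ x, ‖F k x - F0 x‖ ^ 2 := by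
      intro k
      rw [normsq_L2]
      apply integral_congr_ae
      filter_upwards [Lp.coeFn_sub (F k) F0] with x hx
      rw [hx]; rfl
    simp_rw [e]
    have := tendsto_integral_of_dominated_convergence (μ := (volume : Measure (Euc n)))
      (F := fun k x => ‖F k x - F0 x‖ ^ 2) (f := fun _ => (0:ℝ)) (fun x => G x ^ 2)
      (fun k => (((Lp.aestronglyMeasurable (F k)).sub (Lp.aestronglyMeasurable F0)).norm.pow 2))
      hG.integrable_sq ?_ ?_
    · simpa using this
    · intro k
      filter_upwards [hb k] with x hx
      rw [Real.norm_of_nonneg (by positivity)]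
      gcongr
    · filter_upwards [hl] with x hx
      have h1 : Tendsto (fun k => F k x - F0 x) atTop (𝓝 0) := by
        simpa using hx.sub_const (F0 x)
      simpa using h1.norm.pow 2
  have := h2.sqrt
  simpa [Real.sqrt_sq] using this

theorem tendsto_L2_iff {E : Type*} [NormedAddCommGroup E] [InnerProductSpace ℝ E]
    (F : ℕ → Lp E 2 (volume : Measure (Euc n))) (F0 : Lp E 2 (volume : Measure (Euc n))) :
    Tendsto F atTop (𝓝 F0) ↔ Tendsto (fun k => ∫ x, ‖F k x - F0 x‖ ^ 2) atTop (𝓝 0) := by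
  have e : ∀ k, ∫ x, ‖F k x - F0 x‖ ^ 2 = ‖F k - F0‖ ^ 2 := by
    intro k
    rw [normsq_L2]
    apply integral_congr_ae
    filter_upwards [Lp.coeFn_sub (F k) F0] with x hx
    rw [hx]; rfl
  simp_rw [e]
  rw [tendsto_iff_norm_sub_tendsto_zero]
  constructor
  · intro h; simpa using h.pow 2
  · intro h; simpa [Real.sqrt_sq] using h.sqrt

/-- subsequence a.e. convergence -/
theorem L2_subseq {E : Type*} [NormedAddCommGroup E]
    (F : ℕ → Lp E 2 (volume : Measure (Euc n))) (F0 : Lp E 2 (volume : Measure (Euc n)))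
    (h : Tendsto F atTop (𝓝 F0)) : ∃ ns : ℕ → ℕ, StrictMono ns ∧
      ∀ᵐ x, Tendsto (fun k => F (ns k) x) atTop (𝓝 (F0 x)) := by
  have := tendstoInMeasure_of_tendsto_Lp h
  exact this.exists_seq_tendsto_ae

/-! gradient -/
theorem continuous_gradient {f : Euc n → ℝ} (hf : ContDiff ℝ (⊤ : ℕ∞) f) :
    Continuous (gradient f) := by
  have h1 : Continuous (fderiv ℝ f) := hf.continuous_fderiv (by simp)
  exact (InnerProductSpace.toDual ℝ (Euc n)).symm.continuous.comp h1

theorem hasCompactSupport_gradient {f : Euc n → ℝ} (hf : HasCompactSupport f) :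
    HasCompactSupport (gradient f) := by
  have := hf.fderiv (𝕜 := ℝ)
  exact this.comp_left (g := (InnerProductSpace.toDual ℝ (Euc n)).symm) (by simp)

theorem gradient_add' {f g : Euc n → ℝ} {x : Euc n} (hf : DifferentiableAt ℝ f x)
    (hg : DifferentiableAt ℝ g x) : gradient (fun y => f y + g y) x = gradient f x + gradient g x := by
  unfold gradient; rw [show (fun y => f y + g y) = f + g from rfl, fderiv_add hf hg, map_add]

theorem gradient_mul' {f g : Euc n → ℝ} {x : Euc n} (hf : DifferentiableAt ℝ f x)
    (hg : DifferentiableAt ℝ g x) :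
    gradient (fun y => f y * g y) x = f x • gradient g x + g x • gradient f x := by
  unfold gradient
  rw [show (fun y => f y * g y) = f * g from rfl, fderiv_mul hf hg, map_add, map_smulₛₗ, map_smulₛₗ]
  simp

theorem gradient_comp' {f : Euc n → ℝ} {θ : ℝ → ℝ} {x : Euc n} (hf : DifferentiableAt ℝ f x)
    (hg : DifferentiableAt ℝ θ (f x)) :
    gradient (fun y => θ (f y)) x = deriv θ (f x) • gradient f x := by
  unfold gradient
  have : fderiv ℝ (fun y => θ (f y)) x = deriv θ (f x) • fderiv ℝ f x :=
    (hg.hasDerivAt.comp_hasFDerivAt x hf.hasFDerivAt).fderiv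
  rw [this, map_smulₛₗ]; simp

theorem IsTestFun.memLp {Ω : Set (Euc n)} {φ : Euc n → ℝ} (h : IsTestFun Ω φ) :
    MemLp φ 2 volume := h.1.continuous.memLp_of_hasCompactSupport h.2.1

theorem IsTestFun.memLp_grad {Ω : Set (Euc n)} {φ : Euc n → ℝ} (h : IsTestFun Ω φ) :
    MemLp (gradient φ) 2 volume :=
  (continuous_gradient h.1).memLp_of_hasCompactSupport (hasCompactSupport_gradient h.2.1)

def tp {Ω : Set (Euc n)} {φ : Euc n → ℝ} (h : IsTestFun Ω φ) : HH n :=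
  (h.memLp.toLp φ, h.memLp_grad.toLp (gradient φ))

def TT (Ω : Set (Euc n)) : Set (HH n) := {p | ∃ φ, IsTestFun Ω φ ∧ p.1 =ᵐ[volume] φ ∧
  p.2 =ᵐ[volume] gradient φ}

theorem IsTestFun.diff {Ω : Set (Euc n)} {φ : Euc n → ℝ} (h : IsTestFun Ω φ) :
    Differentiable ℝ φ := h.1.differentiable (by simp)

theorem tp_mem {Ω : Set (Euc n)} {φ : Euc n → ℝ} (h : IsTestFun Ω φ) : tp h ∈ TT Ω :=
  ⟨φ, h, h.memLp.coeFn_toLp, h.memLp_grad.coeFn_toLp⟩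

def TS (Ω : Set (Euc n)) : Submodule ℝ (HH n) where
  carrier := TT Ω
  zero_mem' := by
    refine ⟨fun _ => 0, ⟨contDiff_const, HasCompactSupport.zero, by
      simp [tsupport]⟩, Lp.coeFn_zero _ _ _, ?_⟩
    refine (Lp.coeFn_zero (Euc n) 2 volume).trans (Eventually.of_forall fun x => ?_)
    simp [gradient]
  add_mem' := by
    rintro p q ⟨f, hf, h1, h2⟩ ⟨g, hg, h3, h4⟩
    refine ⟨fun x => f x + g x, ⟨hf.1.add hg.1, hf.2.1.add hg.2.1, ?_⟩, ?_, ?_⟩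
    · exact (tsupport_add f g).trans (union_subset hf.2.2 hg.2.2)
    · filter_upwards [Lp.coeFn_add p.1 q.1, h1, h3] with x a b c
      rw [Prod.fst_add, a, Pi.add_apply, b, c]
    · filter_upwards [Lp.coeFn_add p.2 q.2, h2, h4] with x a b c
      rw [Prod.snd_add, a, Pi.add_apply, b, c, gradient_add' (hf.diff x) (hg.diff x)]
  smul_mem' := by
    rintro c p ⟨f, hf, h1, h2⟩
    refine ⟨fun x => c * f x, ⟨contDiff_const.mul hf.1, hf.2.1.mul_left, ?_⟩, ?_, ?_⟩
    · exact (closure_mono (Function.support_mul_subset_right _ _)).trans hf.2.2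
    · filter_upwards [Lp.coeFn_smul c p.1, h1] with x a b
      rw [Prod.smul_fst, a, Pi.smul_apply, b, smul_eq_mul]
    · filter_upwards [Lp.coeFn_smul c p.2, h2] with x a b
      rw [Prod.smul_snd, a, Pi.smul_apply, b,
        gradient_mul' (differentiableAt_const c) (hf.diff x)]
      simp [gradient]

def VV (Ω : Set (Euc n)) : Submodule ℝ (HH n) := (TS Ω).topologicalClosure

theorem VV_closed (Ω : Set (Euc n)) : IsClosed (VV Ω : Set (HH n)) :=
  Submodule.isClosed_topologicalClosure _

theorem VV_eq (Ω : Set (Euc n)) : (VV Ω : Set (HH n)) = closure (TT Ω) := rfl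

theorem mem_VV {Ω : Set (Euc n)} {p : HH n} : p ∈ VV Ω ↔ p ∈ closure (TT Ω) := Iff.rfl

theorem TT_mono {Ω Ω' : Set (Euc n)} (h : Ω' ⊆ Ω) : TT Ω' ⊆ TT Ω := by
  rintro p ⟨f, hf, h1⟩
  exact ⟨f, ⟨hf.1, hf.2.1, hf.2.2.trans h⟩, h1⟩

theorem VV_mono {Ω Ω' : Set (Euc n)} (h : Ω' ⊆ Ω) {p : HH n} (hp : p ∈ VV Ω') : p ∈ VV Ω :=
  closure_mono (TT_mono h) hp

theorem memH10_of {Ω : Set (Euc n)} {p : HH n} (hp : p ∈ VV Ω) {u : Euc n → ℝ} {Du : Euc n → Euc n}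
    (hu : p.1 =ᵐ[volume] u) (hD : p.2 =ᵐ[volume] Du) : MemH10 Ω u Du := by
  refine ⟨(memLp_congr_ae hu).1 (Lp.memLp _), (memLp_congr_ae hD).1 (Lp.memLp _), ?_⟩
  obtain ⟨q, hq, hl⟩ := mem_closure_iff_seq_limit.1 (mem_VV.1 hp)
  choose φ hφ h1 h2 using hq
  refine ⟨φ, hφ, ?_, ?_⟩
  · have := (tendsto_L2_iff _ _).1 ((continuous_fst.tendsto p).comp hl)
    refine this.congr fun k => integral_congr_ae ?_
    filter_upwards [hu, h1 k] with x a b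
    simp [a, b]
  · have := (tendsto_L2_iff _ _).1 ((continuous_snd.tendsto p).comp hl)
    refine this.congr fun k => integral_congr_ae ?_
    filter_upwards [hD, h2 k] with x a b
    simp [a, b]

theorem of_memH10 {Ω : Set (Euc n)} {u : Euc n → ℝ} {Du : Euc n → Euc n} (h : MemH10 Ω u Du) :
    ∃ p ∈ VV Ω, p.1 =ᵐ[volume] u ∧ p.2 =ᵐ[volume] Du := by
  obtain ⟨h1, h2, φ, hφ, l1, l2⟩ := h
  refine ⟨(h1.toLp u, h2.toLp Du), ?_, h1.coeFn_toLp, h2.coeFn_toLp⟩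
  refine mem_VV.2 (mem_closure_iff_seq_limit.2 ⟨fun k => tp (hφ k), fun k => tp_mem _, ?_⟩)
  refine Tendsto.prodMk_nhds ?_ ?_
  · refine (tendsto_L2_iff _ _).2 (l1.congr fun k => integral_congr_ae ?_)
    filter_upwards [h1.coeFn_toLp, (hφ k).memLp.coeFn_toLp] with x a b
    simp [a, b]
  · refine (tendsto_L2_iff _ _).2 (l2.congr fun k => integral_congr_ae ?_)
    filter_upwards [h2.coeFn_toLp, (hφ k).memLp_grad.coeFn_toLp] with x a b
    simp [a, b]

theorem VV_ae_zero {Ω : Set (Euc n)} {p : HH n} (hp : p ∈ VV Ω) :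
    ∀ᵐ x, x ∉ Ω → p.1 x = 0 := by
  obtain ⟨q, hq, hl⟩ := mem_closure_iff_seq_limit.1 (mem_VV.1 hp)
  choose φ hφ h1 h2 using hq
  obtain ⟨ns, -, hns⟩ := L2_subseq _ _ ((continuous_fst.tendsto p).comp hl)
  filter_upwards [hns, ae_all_iff.2 h1] with x a b hx
  refine tendsto_nhds_unique a (tendsto_const_nhds.congr fun k => ?_)
  simp only [Function.comp]
  rw [b]
  exact (image_eq_zero_of_notMem_tsupport (fun h => hx ((hφ _).2.2 h))).symm

end basics

section trunc
variable {n : ℕ}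

open Classical in
def mkL {E : Type*} [NormedAddCommGroup E] (f : Euc n → E) : Lp E 2 (volume : Measure (Euc n)) :=
  if h : MemLp f 2 volume then h.toLp f else 0

theorem mkL_ae {E : Type*} [NormedAddCommGroup E] {f : Euc n → E} (h : MemLp f 2 volume) :
    mkL f =ᵐ[volume] f := by
  unfold mkL; rw [dif_pos h]; exact h.coeFn_toLp

def SmB (θ : ℝ → ℝ) (C : ℝ) : Prop :=
  ContDiff ℝ (⊤ : ℕ∞) θ ∧ θ 0 = 0 ∧ ∀ s, |deriv θ s| ≤ C

theorem SmB.diff {θ : ℝ → ℝ} {C : ℝ} (h : SmB θ C) : Differentiable ℝ θ :=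
  h.1.differentiable (by simp)

theorem SmB.lip {θ : ℝ → ℝ} {C : ℝ} (h : SmB θ C) (a b : ℝ) : |θ a - θ b| ≤ C * |a - b| := by
  have := Convex.norm_image_sub_le_of_norm_deriv_le (f := θ) (C := C) (s := univ) (x := b) (y := a)
    (fun x _ => h.diff x) (fun x _ => by simpa using h.2.2 x) convex_univ (mem_univ _) (mem_univ _)
  simpa using this

theorem SmB.cderiv {θ : ℝ → ℝ} {C : ℝ} (h : SmB θ C) : Continuous (deriv θ) :=
  h.1.continuous_deriv (by simp)

def Th (θ : ℝ → ℝ) (p : HH n) : HH n :=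
  (mkL fun x => θ (p.1 x), mkL fun x => deriv θ (p.1 x) • p.2 x)

theorem Th_fst {θ : ℝ → ℝ} {C : ℝ} (h : SmB θ C) (p : HH n) :
    (Th θ p).1 =ᵐ[volume] fun x => θ (p.1 x) := by
  apply mkL_ae
  refine (Lp.memLp p.1).of_le_mul (c := C)
    (h.1.continuous.comp_aestronglyMeasurable (Lp.aestronglyMeasurable _)) ?_
  refine Eventually.of_forall fun x => ?_
  have := h.lip (p.1 x) 0
  simpa [h.2.1] using this

theorem memLp_bmul {a : Euc n → ℝ} {C : ℝ} (ha : AEStronglyMeasurable a volume)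
    (hb : ∀ x, |a x| ≤ C) (F : LV n) : MemLp (fun x => a x • F x) 2 volume := by
  refine (Lp.memLp F).of_le_mul (c := C) (ha.smul (Lp.aestronglyMeasurable _)) ?_
  refine Eventually.of_forall fun x => ?_
  rw [norm_smul]
  exact mul_le_mul_of_nonneg_right (hb x) (norm_nonneg _)

theorem Th_snd {θ : ℝ → ℝ} {C : ℝ} (h : SmB θ C) (p : HH n) :
    (Th θ p).2 =ᵐ[volume] fun x => deriv θ (p.1 x) • p.2 x := by
  apply mkL_ae
  exact memLp_bmul (h.cderiv.comp_aestronglyMeasurable (Lp.aestronglyMeasurable _))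
    (fun x => h.2.2 _) _

theorem Th_cont {θ : ℝ → ℝ} {C : ℝ} (h : SmB θ C) : Continuous (Th (n := n) θ) := by
  rw [continuous_iff_seqContinuous]
  intro q0 p hq0
  apply tendsto_of_subseq_tendsto
  intro ns hns
  have hq : Tendsto (fun k => q0 (ns k)) atTop (𝓝 p) := hq0.comp hns
  obtain ⟨ms, hms, hae⟩ := L2_subseq _ _ ((continuous_fst.tendsto p).comp hq)
  refine ⟨ms, ?_⟩
  set q : ℕ → HH n := fun k => q0 (ns (ms k)) with hqd
  have hqp : Tendsto q atTop (𝓝 p) := hq.comp hms.tendsto_atTop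
  have hq1 := (tendsto_iff_norm_sub_tendsto_zero.1 ((continuous_fst.tendsto p).comp hqp))
  have hq2 := (tendsto_iff_norm_sub_tendsto_zero.1 ((continuous_snd.tendsto p).comp hqp))
  have hC : 0 ≤ C := (abs_nonneg _).trans (h.2.2 0)
  show Tendsto (fun k => Th θ (q k)) atTop (𝓝 (Th θ p))
  refine (Prod.tendsto_iff _ _).2 ⟨?_, ?_⟩
  · rw [tendsto_iff_norm_sub_tendsto_zero]
    refine squeeze_zero (fun _ => norm_nonneg _) (fun k => ?_) (by simpa using hq1.const_mul C)
    refine Lp.norm_le_mul_norm_of_ae_le_mul ?_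
    filter_upwards [Th_fst h (q k), Th_fst h p, Lp.coeFn_sub (Th θ (q k)).1 (Th θ p).1,
      Lp.coeFn_sub (q k).1 p.1] with x a b c d
    rw [c, d, Pi.sub_apply, Pi.sub_apply, a, b]
    exact h.lip _ _
  · have hmem : ∀ k, MemLp (fun x => deriv θ ((q k).1 x) • p.2 x) 2 volume := fun k =>
      memLp_bmul (h.cderiv.comp_aestronglyMeasurable (Lp.aestronglyMeasurable _))
        (fun x => h.2.2 _) _
    set A : ℕ → LV n := fun k => (hmem k).toLp _ with hA
    have hA2 : Tendsto A atTop (𝓝 (Th θ p).2) := by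
      refine L2_dct _ _ (fun x => 2 * C * ‖p.2 x‖) ((Lp.memLp p.2).norm.const_mul _) ?_ ?_
      · intro k
        filter_upwards [(hmem k).coeFn_toLp, Th_snd h p] with x a b
        rw [hA]; simp only; rw [a, b, ← sub_smul, norm_smul]
        refine mul_le_mul_of_nonneg_right ?_ (norm_nonneg _)
        refine (norm_sub_le _ _).trans ?_
        have := h.2.2 ((q k).1 x); have := h.2.2 (p.1 x)
        simp only [Real.norm_eq_abs]; linarith
      · filter_upwards [ae_all_iff.2 fun k => (hmem k).coeFn_toLp, Th_snd h p, hae] with x a b c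
        simp_rw [hA]; simp_rw [a]; rw [b]
        exact ((h.cderiv.tendsto _).comp c).smul_const _
    have hdiff : Tendsto (fun k => (Th θ (q k)).2 - A k) atTop (𝓝 0) := by
      rw [tendsto_zero_iff_norm_tendsto_zero]
      refine squeeze_zero (fun _ => norm_nonneg _) (fun k => ?_) (by simpa using hq2.const_mul C)
      refine Lp.norm_le_mul_norm_of_ae_le_mul ?_
      filter_upwards [Th_snd h (q k), (hmem k).coeFn_toLp, Lp.coeFn_sub (Th θ (q k)).2 (A k),
        Lp.coeFn_sub (q k).2 p.2] with x a b c d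
      rw [c, d, Pi.sub_apply, Pi.sub_apply, a]
      rw [hA]; simp only; rw [b, ← smul_sub, norm_smul]
      exact mul_le_mul_of_nonneg_right (h.2.2 _) (norm_nonneg _)
    simpa using hdiff.add hA2

theorem Th_TT {θ : ℝ → ℝ} {C : ℝ} (h : SmB θ C) {Ω : Set (Euc n)} {p : HH n} {f : Euc n → ℝ}
    (hf : IsTestFun univ f) (hp1 : p.1 =ᵐ[volume] f) (hp2 : p.2 =ᵐ[volume] gradient f)
    (hs : tsupport (fun x => θ (f x)) ⊆ Ω) :
    IsTestFun Ω (fun x => θ (f x)) ∧ (Th θ p).1 =ᵐ[volume] (fun x => θ (f x)) ∧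
      (Th θ p).2 =ᵐ[volume] gradient (fun x => θ (f x)) := by
  refine ⟨⟨h.1.comp hf.1, hf.2.1.comp_left h.2.1, hs⟩, ?_, ?_⟩
  · filter_upwards [Th_fst h p, hp1] with x a b
    rw [a, b]
  · filter_upwards [Th_snd h p, hp1, hp2] with x a b c
    rw [a, b, c, gradient_comp' (hf.diff x) (h.diff _)]

theorem IsTestFun.mono {Ω Ω' : Set (Euc n)} {f : Euc n → ℝ} (hf : IsTestFun Ω f) (h : Ω ⊆ Ω') :
    IsTestFun Ω' f := ⟨hf.1, hf.2.1, hf.2.2.trans h⟩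

theorem tsupport_comp_sub {θ : ℝ → ℝ} (h0 : θ 0 = 0) (f : Euc n → ℝ) :
    tsupport (fun x => θ (f x)) ⊆ tsupport f := by
  apply closure_mono
  intro x hx hx'
  exact hx (by simp [hx', h0])

theorem Th_VV {θ : ℝ → ℝ} {C : ℝ} (h : SmB θ C) {Ω : Set (Euc n)} {p : HH n} (hp : p ∈ VV Ω) :
    Th θ p ∈ VV Ω := by
  refine map_mem_closure (Th_cont h) (mem_VV.1 hp) ?_
  rintro q ⟨f, hf, h1, h2⟩
  exact ⟨_, Th_TT h (hf.mono (subset_univ _)) h1 h2 ((tsupport_comp_sub h.2.1 f).trans hf.2.2)⟩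

/-! the concrete truncation -/
def chi (s : ℝ) : ℝ := s * Real.smoothTransition s

theorem chi_contDiff : ContDiff ℝ (⊤ : ℕ∞) chi := contDiff_id.mul Real.smoothTransition.contDiff

theorem chi_nonneg (s : ℝ) : 0 ≤ chi s := by
  unfold chi
  rcases le_or_gt s 0 with h | h
  · rw [Real.smoothTransition.zero_of_nonpos h]; simp
  · exact mul_nonneg h.le (Real.smoothTransition.nonneg _)

theorem chi_neg {s : ℝ} (h : s ≤ 0) : chi s = 0 := by
  unfold chi; rw [Real.smoothTransition.zero_of_nonpos h]; simp

theorem chi_one {s : ℝ} (h : 1 ≤ s) : chi s = s := by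
  unfold chi; rw [Real.smoothTransition.one_of_one_le h]; simp

theorem dchi_neg {s : ℝ} (h : s < 0) : deriv chi s = 0 := by
  have : chi =ᶠ[𝓝 s] fun _ => 0 := by
    filter_upwards [Iio_mem_nhds h] with x hx
    exact chi_neg (le_of_lt hx)
  rw [this.deriv_eq]; simp

theorem dchi_one {s : ℝ} (h : 1 < s) : deriv chi s = 1 := by
  have : chi =ᶠ[𝓝 s] fun x => x := by
    filter_upwards [Ioi_mem_nhds h] with x hx
    exact chi_one (le_of_lt hx)
  rw [this.deriv_eq]; simp

theorem chi_bound : ∃ C, ∀ s, |deriv chi s| ≤ C := by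
  have hc : Continuous (deriv chi) := chi_contDiff.continuous_deriv (by simp)
  obtain ⟨C, hC⟩ := isCompact_Icc.exists_bound_of_continuousOn (s := Icc (0:ℝ) 1) hc.continuousOn
  refine ⟨max C 1, fun s => ?_⟩
  rcases lt_or_ge s 0 with h | h
  · rw [dchi_neg h]; simp
  rcases le_or_gt s 1 with h' | h'
  · exact (hC s ⟨h, h'⟩).trans (le_max_left _ _)
  · rw [dchi_one h']; simp

def tht (k t : ℝ) (s : ℝ) : ℝ := t * chi ((s - k - t) / t)

theorem tht_deriv {k t : ℝ} (ht : 0 < t) (s : ℝ) : deriv (tht k t) s = deriv chi ((s - k - t) / t) := by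
  have h1 : HasDerivAt (fun s : ℝ => (s - k - t) / t) (1 / t) s :=
    (((hasDerivAt_id s).sub_const k).sub_const t).div_const t
  have h2 : HasDerivAt chi (deriv chi ((s - k - t) / t)) ((s - k - t) / t) :=
    (chi_contDiff.differentiable (by simp) _).hasDerivAt
  have h3 := ((h2.comp s h1).const_mul t).deriv
  have : tht k t = fun y => t * (chi ∘ fun s => (s - k - t) / t) y := rfl
  rw [this, h3]; field_simp

theorem tht_SmB : ∃ C, ∀ k t : ℝ, 0 ≤ k → 0 < t → SmB (tht k t) C := by
  obtain ⟨C, hC⟩ := chi_bound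
  refine ⟨C, fun k t hk ht => ⟨?_, ?_, ?_⟩⟩
  · unfold tht
    exact contDiff_const.mul (chi_contDiff.comp (((contDiff_id.sub contDiff_const).sub contDiff_const).div_const t))
  · unfold tht; rw [chi_neg]; simp
    apply div_nonpos_of_nonpos_of_nonneg _ ht.le; linarith
  · intro s; rw [tht_deriv ht]; exact hC _

theorem tht_zero {k t s : ℝ} (ht : 0 < t) (h : s ≤ k + t) : tht k t s = 0 := by
  unfold tht; rw [chi_neg]; simp
  apply div_nonpos_of_nonpos_of_nonneg _ ht.le; linarith

theorem tht_nonneg {k t s : ℝ} (ht : 0 < t) : 0 ≤ tht k t s := mul_nonneg ht.le (chi_nonneg _)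

theorem tht_lim (k s : ℝ) :
    Tendsto (fun j : ℕ => tht k (1 / ((j : ℝ) + 1)) s) atTop (𝓝 (max (s - k) 0)) ∧
    Tendsto (fun j : ℕ => deriv (tht k (1 / ((j : ℝ) + 1))) s) atTop (𝓝 (if k < s then 1 else 0)) := by
  have hpos : ∀ j : ℕ, (0:ℝ) < 1 / ((j : ℝ) + 1) := fun j => Nat.one_div_pos_of_nat
  have hlim := tendsto_one_div_add_atTop_nhds_zero_nat (𝕜 := ℝ)
  by_cases h : k < s
  · have hev : ∀ᶠ j : ℕ in atTop, 1 / ((j : ℝ) + 1) < (s - k) / 2 :=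
      hlim.eventually_lt_const (by linarith)
    have key : ∀ᶠ j : ℕ in atTop, 1 < (s - k - 1 / ((j : ℝ) + 1)) / (1 / ((j : ℝ) + 1)) := by
      filter_upwards [hev] with j hj
      rw [lt_div_iff₀ (hpos j)]; linarith
    rw [if_pos h, max_eq_left (by linarith)]
    constructor
    · have : Tendsto (fun j : ℕ => s - k - 1 / ((j : ℝ) + 1)) atTop (𝓝 (s - k)) := by
        simpa using hlim.const_sub (s - k)
      refine this.congr' ?_
      filter_upwards [key] with j hj
      unfold tht
      rw [chi_one hj.le, mul_div_cancel₀ _ (hpos j).ne']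
    · refine tendsto_const_nhds.congr' ?_
      filter_upwards [key] with j hj
      rw [tht_deriv (hpos j), dchi_one hj]
  · push Not at h
    rw [if_neg (not_lt.2 h), max_eq_right (by linarith)]
    constructor
    · refine tendsto_const_nhds.congr fun j => ?_
      rw [tht_zero (hpos j)]; linarith [hpos j]
    · refine tendsto_const_nhds.congr fun j => ?_
      rw [tht_deriv (hpos j), dchi_neg]
      apply div_neg_of_neg_of_pos _ (hpos j); linarith [hpos j]

/-- positive part `(p - k)⁺` -/
def PP (k : ℝ) (p : HH n) : HH n :=
  (mkL fun x => max (p.1 x - k) 0, mkL fun x => (if k < p.1 x then (1:ℝ) else 0) • p.2 x)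

theorem PP_fst {k : ℝ} (hk : 0 ≤ k) (p : HH n) :
    (PP k p).1 =ᵐ[volume] fun x => max (p.1 x - k) 0 := by
  apply mkL_ae
  refine (Lp.memLp p.1).mono (((Lp.aestronglyMeasurable p.1).sub
    aestronglyMeasurable_const).sup aestronglyMeasurable_const) ?_
  refine Eventually.of_forall fun x => ?_
  simp only [Real.norm_eq_abs]
  rw [abs_of_nonneg (le_max_right _ _)]
  exact max_le (by linarith [le_abs_self (p.1 x)]) (abs_nonneg _)

theorem PP_snd (k : ℝ) (p : HH n) :
    (PP k p).2 =ᵐ[volume] fun x => (if k < p.1 x then (1:ℝ) else 0) • p.2 x := by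
  apply mkL_ae
  refine memLp_bmul (C := 1) ?_ (fun x => by split_ifs <;> simp) _
  have hm : Measurable (p.1 : Euc n → ℝ) := (Lp.stronglyMeasurable p.1).measurable
  exact (Measurable.ite (measurableSet_lt measurable_const hm) measurable_const
    measurable_const).aestronglyMeasurable

theorem Th_lim {k : ℝ} (hk : 0 ≤ k) (p : HH n) :
    Tendsto (fun j : ℕ => Th (tht k (1 / ((j : ℝ) + 1))) p) atTop (𝓝 (PP k p)) := by
  obtain ⟨C, hC⟩ := tht_SmB
  have hpos : ∀ j : ℕ, (0:ℝ) < 1 / ((j : ℝ) + 1) := fun j => Nat.one_div_pos_of_nat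
  have hS : ∀ j : ℕ, SmB (tht k (1 / ((j : ℝ) + 1))) C := fun j => hC k _ hk (hpos j)
  refine (Prod.tendsto_iff _ _).2 ⟨?_, ?_⟩
  · refine L2_dct _ _ (fun x => (C + 1) * ‖p.1 x‖) ((Lp.memLp p.1).norm.const_mul _) ?_ ?_
    · intro j
      filter_upwards [Th_fst (hS j) p, PP_fst hk p] with x a b
      rw [a, b]
      refine (norm_sub_le _ _).trans ?_
      rw [add_mul, one_mul]
      gcongr
      · have := (hS j).lip (p.1 x) 0
        rw [(hS j).2.1, sub_zero, sub_zero] at this; exact this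
      · simp only [Real.norm_eq_abs]
        rw [abs_of_nonneg (le_max_right _ _)]
        exact max_le (by linarith [le_abs_self (p.1 x)]) (abs_nonneg _)
    · filter_upwards [ae_all_iff.2 fun j => Th_fst (hS j) p, PP_fst hk p] with x a b
      simp_rw [a]; rw [b]; exact (tht_lim k _).1
  · refine L2_dct _ _ (fun x => (C + 1) * ‖p.2 x‖) ((Lp.memLp p.2).norm.const_mul _) ?_ ?_
    · intro j
      filter_upwards [Th_snd (hS j) p, PP_snd k p] with x a b
      rw [a, b, ← sub_smul, norm_smul]
      gcongr
      refine (norm_sub_le _ _).trans ?_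
      gcongr
      · exact (hS j).2.2 _
      · split_ifs <;> simp
    · filter_upwards [ae_all_iff.2 fun j => Th_snd (hS j) p, PP_snd k p] with x a b
      simp_rw [a]; rw [b]; exact (tht_lim k _).2.smul_const _

theorem PP_VV {Ω : Set (Euc n)} {k : ℝ} (hk : 0 ≤ k) {p : HH n} (hp : p ∈ VV Ω) :
    PP k p ∈ VV Ω := by
  obtain ⟨C, hC⟩ := tht_SmB
  exact (VV_closed Ω).mem_of_tendsto (Th_lim hk p)
    (Eventually.of_forall fun j => Th_VV (hC k _ hk Nat.one_div_pos_of_nat) hp)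

theorem PP_sub_VV {Ω Ω' : Set (Euc n)} {a b : HH n} (ha : a ∈ VV Ω') (hb : b ∈ VV Ω) :
    PP 0 (a - PP 0 b) ∈ VV Ω' := by
  obtain ⟨C, hC⟩ := tht_SmB
  have hpos : ∀ j : ℕ, (0:ℝ) < 1 / ((j : ℝ) + 1) := fun j => Nat.one_div_pos_of_nat
  have step : ∀ t s : ℝ, 0 < t → 0 < s → Th (tht 0 t) (a - Th (tht 0 s) b) ∈ VV Ω' := by
    intro t s ht hs
    have ct := hC 0 t le_rfl ht
    have cs := hC 0 s le_rfl hs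
    refine map_mem_closure₂ (f := fun a b => Th (tht 0 t) (a - Th (tht 0 s) b)) ?_
      (mem_VV.1 ha) (mem_VV.1 hb) ?_
    · exact (Th_cont ct).comp (continuous_fst.sub ((Th_cont cs).comp continuous_snd))
    · rintro p ⟨f, hf, h1, h2⟩ q ⟨g, hg, h3, h4⟩
      obtain ⟨g1, g2, g3⟩ := Th_TT cs (Ω := univ) (hg.mono (subset_univ _)) h3 h4 (subset_univ _)
      set G := fun x => tht 0 s (g x) with hG
      have hfG : IsTestFun univ (fun x => f x + (-1) * G x) :=
        ⟨hf.1.add (contDiff_const.mul g1.1), hf.2.1.add g1.2.1.mul_left, subset_univ _⟩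
      refine ⟨_, Th_TT ct hfG ?_ ?_ ?_⟩
      · filter_upwards [Lp.coeFn_sub p.1 (Th (tht 0 s) q).1, h1, g2] with x a b c
        rw [Prod.fst_sub, a, Pi.sub_apply, b, c]; ring
      · filter_upwards [Lp.coeFn_sub p.2 (Th (tht 0 s) q).2, h2, g3] with x a b c
        rw [Prod.snd_sub, a, Pi.sub_apply, b, c, gradient_add' (hf.diff x)
          ((g1.diff x).const_mul _), gradient_mul' (differentiableAt_const _) (g1.diff x)]
        simp [gradient, sub_eq_add_neg]
      · refine (closure_mono ?_).trans hf.2.2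
        intro x hx hx'
        apply hx
        apply tht_zero ht
        have : 0 ≤ G x := tht_nonneg hs
        rw [hx']; linarith
  have step2 : ∀ t : ℝ, 0 < t → Th (tht 0 t) (a - PP 0 b) ∈ VV Ω' := by
    intro t ht
    have := ((Th_cont (n := n) (hC 0 t le_rfl ht)).tendsto (a - PP 0 b)).comp
      ((Th_lim le_rfl b).const_sub a)
    exact (VV_closed Ω').mem_of_tendsto this (Eventually.of_forall fun j => step t _ ht (hpos j))
  exact (VV_closed Ω').mem_of_tendsto (Th_lim le_rfl _)
    (Eventually.of_forall fun j => step2 _ (hpos j))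

end trunc

section FK
variable {n : ℕ}

theorem sq_int_le {f : ℝ → ℝ} (hf : Continuous f) :
    (∫ t in (0:ℝ)..1, f t) ^ 2 ≤ ∫ t in (0:ℝ)..1, f t ^ 2 := by
  set c := ∫ t in (0:ℝ)..1, f t with hc
  have h0 : 0 ≤ ∫ t in (0:ℝ)..1, (f t - c) ^ 2 :=
    intervalIntegral.integral_nonneg zero_le_one fun t _ => sq_nonneg _
  have e : ∫ t in (0:ℝ)..1, (f t - c) ^ 2 = (∫ t in (0:ℝ)..1, f t ^ 2) - 2 * c * c + c ^ 2 := by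
    have : ∀ t, (f t - c) ^ 2 = (f t ^ 2 - 2 * c * f t) + c ^ 2 := fun t => by ring
    simp_rw [this]
    rw [intervalIntegral.integral_add, intervalIntegral.integral_sub,
      intervalIntegral.integral_const_mul, intervalIntegral.integral_const, ← hc]
    · simp
    all_goals exact Continuous.intervalIntegrable (by fun_prop) _ _
  nlinarith

theorem test_incr {φ : Euc n → ℝ} (hφ : ContDiff ℝ (⊤ : ℕ∞) φ) (x h : Euc n) :
    (φ (x + h) - φ x) ^ 2 ≤ ∫ t in (0:ℝ)..1, ‖h‖ ^ 2 * ‖gradient φ (x + t • h)‖ ^ 2 := by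
  have hd : Differentiable ℝ φ := hφ.differentiable (by simp)
  have hcg := continuous_gradient hφ
  have hder : ∀ t : ℝ, HasDerivAt (fun t : ℝ => φ (x + t • h)) (inner ℝ (gradient φ (x + t • h)) h) t := by
    intro t
    have h1 : HasDerivAt (fun t : ℝ => x + t • h) h t := by
      simpa using ((hasDerivAt_id t).smul_const h).const_add x
    have h2 := ((hd (x + t • h)).hasGradientAt.hasFDerivAt).comp_hasDerivAt t h1
    have e : (InnerProductSpace.toDual ℝ (Euc n) (gradient φ (x + t • h))) h = inner ℝ (gradient φ (x + t • h)) h := InnerProductSpace.toDual_apply_apply ..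
    rw [e] at h2; exact h2
  have hc : Continuous fun t : ℝ => inner ℝ (gradient φ (x + t • h)) h := by fun_prop
  have := intervalIntegral.integral_eq_sub_of_hasDerivAt (a := 0) (b := 1) (fun t _ => hder t)
    (hc.intervalIntegrable _ _)
  simp only [one_smul, zero_smul, add_zero] at this
  rw [← this]
  refine (sq_int_le hc).trans ?_
  refine intervalIntegral.integral_mono_on zero_le_one
    (Continuous.intervalIntegrable (by fun_prop) _ _)
    (Continuous.intervalIntegrable (by fun_prop) _ _) fun t _ => ?_
  rw [← mul_pow, mul_comm]
  rw [sq_le_sq, abs_of_nonneg (a := ‖_‖ * ‖h‖) (by positivity)]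
  exact abs_real_inner_le_norm _ _

theorem test_transl {φ : Euc n → ℝ} (hφ : ContDiff ℝ (⊤ : ℕ∞) φ) (h : Euc n) :
    ∫⁻ x, ENNReal.ofReal ((φ (x + h) - φ x) ^ 2) ≤
      ENNReal.ofReal (‖h‖ ^ 2) * ∫⁻ x, ENNReal.ofReal (‖gradient φ x‖ ^ 2) := by
  have hcg := continuous_gradient hφ
  calc ∫⁻ x, ENNReal.ofReal ((φ (x + h) - φ x) ^ 2)
      ≤ ∫⁻ x, ∫⁻ t in Ioc (0:ℝ) 1, ENNReal.ofReal (‖h‖ ^ 2 * ‖gradient φ (x + t • h)‖ ^ 2) := by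
        refine lintegral_mono fun x => ?_
        refine (ENNReal.ofReal_le_ofReal (test_incr hφ x h)).trans ?_
        rw [intervalIntegral.integral_of_le zero_le_one]
        rw [ofReal_integral_eq_lintegral_ofReal]
        · exact (Continuous.integrableOn_Icc (by fun_prop)).mono_set Ioc_subset_Icc_self
        · exact Eventually.of_forall fun t => by positivity
    _ = ∫⁻ t in Ioc (0:ℝ) 1, ∫⁻ x, ENNReal.ofReal (‖h‖ ^ 2 * ‖gradient φ (x + t • h)‖ ^ 2) := by
        rw [lintegral_lintegral_swap]
        refine Continuous.aemeasurable ?_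
        exact ENNReal.continuous_ofReal.comp (continuous_const.mul
          (((hcg.comp (continuous_fst.add (continuous_snd.smul continuous_const))).norm).pow 2))
    _ = ∫⁻ t in Ioc (0:ℝ) 1, ∫⁻ x, ENNReal.ofReal (‖h‖ ^ 2 * ‖gradient φ x‖ ^ 2) := by
        refine lintegral_congr fun t => ?_
        exact lintegral_add_right_eq_self
          (fun x => ENNReal.ofReal (‖h‖ ^ 2 * ‖gradient φ x‖ ^ 2)) (t • h)
    _ = _ := by
        rw [lintegral_const]
        simp only [MeasurableSet.univ, Measure.restrict_apply, univ_inter, Real.volume_Ioc, sub_zero,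
          ENNReal.ofReal_one, mul_one]
        simp_rw [ENNReal.ofReal_mul (sq_nonneg ‖h‖)]
        rw [lintegral_const_mul]
        exact (hcg.measurable.norm.pow_const 2).ennreal_ofReal

theorem ofReal_normsq {E : Type*} [NormedAddCommGroup E] [InnerProductSpace ℝ E]
    (f : Lp E 2 (volume : Measure (Euc n))) :
    ENNReal.ofReal (‖f‖ ^ 2) = ∫⁻ x, ENNReal.ofReal (‖f x‖ ^ 2) := by
  rw [normsq_L2, ofReal_integral_eq_lintegral_ofReal (integrable_sq_L2 f)]
  exact Eventually.of_forall fun t => by positivity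

def TL (h : Euc n) : LL n →+ LL n :=
  Lp.compMeasurePreserving (fun x => x + h) (measurePreserving_add_right volume h)

theorem TL_ae (h : Euc n) (f : LL n) : TL h f =ᵐ[volume] fun x => f (x + h) :=
  Lp.coeFn_compMeasurePreserving f (measurePreserving_add_right volume h)

theorem TL_cont (h : Euc n) : Continuous (TL (n := n) h) :=
  (Lp.isometry_compMeasurePreserving (measurePreserving_add_right volume h)).continuous

theorem VV_transl {p : HH n} (hp : p ∈ VV (univ : Set (Euc n))) (h : Euc n) :
    ‖TL h p.1 - p.1‖ ≤ ‖h‖ * ‖p.2‖ := by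
  have hcl : IsClosed {p : HH n | ‖TL h p.1 - p.1‖ ≤ ‖h‖ * ‖p.2‖} := by
    refine isClosed_le ?_ (continuous_const.mul continuous_snd.norm)
    exact (((TL_cont h).comp continuous_fst).sub continuous_fst).norm
  refine closure_minimal ?_ hcl (mem_VV.1 hp)
  rintro q ⟨φ, hφ, h1, h2⟩
  show ‖TL h q.1 - q.1‖ ≤ ‖h‖ * ‖q.2‖
  rw [← abs_of_nonneg (norm_nonneg (_ - _)), ← abs_of_nonneg (a := ‖h‖ * ‖q.2‖) (by positivity),
    ← sq_le_sq, mul_pow, ← ENNReal.ofReal_le_ofReal_iff (by positivity),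
    ENNReal.ofReal_mul (by positivity), ofReal_normsq, ofReal_normsq]
  have e1 : ∫⁻ x, ENNReal.ofReal (‖(TL h q.1 - q.1 : LL n) x‖ ^ 2) =
      ∫⁻ x, ENNReal.ofReal ((φ (x + h) - φ x) ^ 2) := by
    refine lintegral_congr_ae ?_
    have h3 : ∀ᵐ x, q.1 (x + h) = φ (x + h) :=
      (measurePreserving_add_right volume h).quasiMeasurePreserving.ae h1
    filter_upwards [Lp.coeFn_sub (TL h q.1) q.1, TL_ae h q.1, h1, h3] with x a b c d
    rw [a, Pi.sub_apply, b, c, d]; simp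
  have e2 : ∫⁻ x, ENNReal.ofReal (‖q.2 x‖ ^ 2) = ∫⁻ x, ENNReal.ofReal (‖gradient φ x‖ ^ 2) := by
    refine lintegral_congr_ae ?_
    filter_upwards [h2] with x a
    rw [a]
  rw [e1, e2]
  exact test_transl hφ.1 h

theorem FKineq {p : HH n} (hp : p ∈ VV (univ : Set (Euc n))) {ρ : ℝ} (hρ : 0 < ρ)
    (hS : 2 * volume {x | p.1 x ≠ 0} ≤ volume (ball (0 : Euc n) ρ)) :
    ‖p.1‖ ^ 2 ≤ 2 * ρ ^ 2 * ‖p.2‖ ^ 2 := by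
  set u : Euc n → ℝ := ⇑p.1 with hu
  have hm : Measurable u := (Lp.stronglyMeasurable p.1).measurable
  set S := {x | u x ≠ 0} with hSd
  have hSm : MeasurableSet S := (measurableSet_eq_fun hm measurable_const).compl
  set B := ball (0 : Euc n) ρ with hB
  have hB0 : volume B ≠ 0 := (measure_ball_pos _ _ hρ).ne'
  have hBt : volume B ≠ ∞ := measure_ball_lt_top.ne
  set I := ∫⁻ x, ENNReal.ofReal (‖u x‖ ^ 2) with hI
  have key : volume B / 2 * I ≤ volume B * ENNReal.ofReal (ρ ^ 2 * ‖p.2‖ ^ 2) := by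
    calc volume B / 2 * I = ∫⁻ x, volume B / 2 * ENNReal.ofReal (‖u x‖ ^ 2) := by
          rw [hI, lintegral_const_mul]; exact (hm.norm.pow_const 2).ennreal_ofReal
      _ ≤ ∫⁻ x, ∫⁻ h in B, ENNReal.ofReal ((u (x + h) - u x) ^ 2) := by
          refine lintegral_mono fun x => ?_
          have hSx : MeasurableSet ((fun h => x + h) ⁻¹' S) := (measurable_const_add x) hSm
          have hvS : volume ((fun h => x + h) ⁻¹' S) = volume S :=
            measure_preimage_add _ _ _
          calc volume B / 2 * ENNReal.ofReal (‖u x‖ ^ 2)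
              ≤ ENNReal.ofReal (‖u x‖ ^ 2) * volume (B \ ((fun h => x + h) ⁻¹' S)) := by
                rw [mul_comm]
                gcongr
                refine le_trans ?_ le_measure_sdiff
                rw [hvS]
                have h1 : volume S ≤ volume B / 2 := by
                  rw [ENNReal.le_div_iff_mul_le (by simp) (by simp), mul_comm]; exact hS
                calc volume B / 2 = volume B - volume B / 2 := by
                      rw [ENNReal.sub_half hBt]
                  _ ≤ _ := tsub_le_tsub_left h1 _
            _ = ∫⁻ h in B \ ((fun h => x + h) ⁻¹' S), ENNReal.ofReal (‖u x‖ ^ 2) := by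
                rw [lintegral_const]; simp
            _ = ∫⁻ h in B \ ((fun h => x + h) ⁻¹' S), ENNReal.ofReal ((u (x + h) - u x) ^ 2) := by
                refine setLIntegral_congr_fun (measurableSet_ball.diff hSx) fun h hh => ?_
                have : u (x + h) = 0 := by
                  by_contra hne; exact hh.2 hne
                simp [this]
            _ ≤ _ := lintegral_mono_set sdiff_subset
      _ = ∫⁻ h in B, ∫⁻ x, ENNReal.ofReal ((u (x + h) - u x) ^ 2) := by
          rw [lintegral_lintegral_swap]
          refine Measurable.aemeasurable ?_
          exact ENNReal.measurable_ofReal.comp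
            (((hm.comp (measurable_fst.add measurable_snd)).sub (hm.comp measurable_fst)).pow_const 2)
      _ ≤ ∫⁻ h in B, ENNReal.ofReal (ρ ^ 2 * ‖p.2‖ ^ 2) := by
          refine setLIntegral_mono' measurableSet_ball fun h hh => ?_
          have hh' : ‖h‖ < ρ := by rw [hB, mem_ball_zero_iff] at hh; exact hh
          have e1 : ∫⁻ x, ENNReal.ofReal ((u (x + h) - u x) ^ 2) =
              ENNReal.ofReal (‖TL h p.1 - p.1‖ ^ 2) := by
            rw [ofReal_normsq]
            refine lintegral_congr_ae ?_
            filter_upwards [Lp.coeFn_sub (TL h p.1) p.1, TL_ae h p.1] with x a b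
            rw [a, Pi.sub_apply, b]; simp [hu]
          rw [e1]
          refine ENNReal.ofReal_le_ofReal ?_
          rw [← mul_pow]
          refine pow_le_pow_left₀ (norm_nonneg _) ((VV_transl hp h).trans ?_) 2
          gcongr
      _ = _ := by rw [lintegral_const]; simp [mul_comm]
  have hI2 : I = ENNReal.ofReal (‖p.1‖ ^ 2) := (ofReal_normsq p.1).symm
  have k2 : I ≤ 2 * ENNReal.ofReal (ρ ^ 2 * ‖p.2‖ ^ 2) := by
    have : volume B / 2 * I ≤ volume B / 2 * (2 * ENNReal.ofReal (ρ ^ 2 * ‖p.2‖ ^ 2)) := by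
      refine key.trans (le_of_eq ?_)
      rw [← mul_assoc, ENNReal.div_mul_cancel (by simp) (by simp)]
    refine (ENNReal.mul_le_mul_iff_right ?_ ?_).1 this
    · simp [hB0]
    · exact (ENNReal.div_lt_top hBt (by simp)).ne
  have h2 : ∀ z : ℝ, (2:ℝ≥0∞) * ENNReal.ofReal z = ENNReal.ofReal (2 * z) := fun z => by
    rw [ENNReal.ofReal_mul (by norm_num)]; simp
  rw [hI2, h2, ENNReal.ofReal_le_ofReal_iff (by positivity)] at k2
  linarith

end FK

section solve
variable {n : ℕ}

theorem solveAbs {X Y : Type*} [NormedAddCommGroup X] [InnerProductSpace ℝ X] [CompleteSpace X]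
    [NormedAddCommGroup Y] [InnerProductSpace ℝ Y] [CompleteSpace Y]
    (W : Submodule ℝ (X × Y)) (hW : IsClosed (W : Set (X × Y))) {lam γ : ℝ} (hl : 0 ≤ lam)
    (hγ : 0 < γ) (hc : ∀ p ∈ W, γ * ‖p.1‖ ^ 2 ≤ ‖p.2‖ ^ 2 - lam * ‖p.1‖ ^ 2) (F : X) :
    ∃ p ∈ W, ∀ q ∈ W, inner ℝ p.2 q.2 - lam * inner ℝ p.1 q.1 = inner ℝ F q.1 := by
  obtain ⟨prE, hprE⟩ : ∃ e : WithLp 2 (X × Y) ≃L[ℝ] X × Y, ∀ p, ‖p‖ ^ 2 = ‖(e p).1‖ ^ 2 + ‖(e p).2‖ ^ 2 :=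
    ⟨WithLp.prodContinuousLinearEquiv 2 ℝ X Y, fun p => by rw [WithLp.prod_norm_sq_eq_of_L2]; rfl⟩
  obtain ⟨W', hW'⟩ : ∃ W' : Submodule ℝ (WithLp 2 (X × Y)), ∀ p, p ∈ W' ↔ prE p ∈ W :=
    ⟨W.comap prE.toLinearEquiv.toLinearMap, fun p => Iff.rfl⟩
  have hWc : IsClosed (W' : Set (WithLp 2 (X × Y))) := by
    have : (W' : Set (WithLp 2 (X × Y))) = prE ⁻¹' W := by ext p; exact hW' p
    rw [this]; exact hW.preimage prE.continuous
  have : CompleteSpace W' := hWc.completeSpace_coe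
  obtain ⟨f1, hf1⟩ : ∃ f : W' →L[ℝ] X, ∀ p, f p = (prE p).1 :=
    ⟨(ContinuousLinearMap.fst ℝ X Y).comp (prE.toContinuousLinearMap.comp W'.subtypeL), fun p => rfl⟩
  obtain ⟨f2, hf2⟩ : ∃ f : W' →L[ℝ] Y, ∀ p, f p = (prE p).2 :=
    ⟨(ContinuousLinearMap.snd ℝ X Y).comp (prE.toContinuousLinearMap.comp W'.subtypeL), fun p => rfl⟩
  obtain ⟨B, hB⟩ : ∃ B : W' →L[ℝ] W' →L[ℝ] ℝ,
      ∀ p q, B p q = inner ℝ (f2 p) (f2 q) - lam * inner ℝ (f1 p) (f1 q) :=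
    ⟨(innerSL ℝ (E := Y)).bilinearComp f2 f2 - lam • (innerSL ℝ (E := X)).bilinearComp f1 f1,
      fun p q => by simp⟩
  have hco : IsCoercive B := by
    refine ⟨γ / (γ + 1 + lam), by positivity, fun p => ?_⟩
    rw [hB, real_inner_self_eq_norm_sq, real_inner_self_eq_norm_sq]
    have h1 := hc (prE p) ((hW' _).1 p.2)
    have h2 := hprE p
    rw [← hf1, ← hf2] at h1 h2
    rw [mul_assoc, ← sq, Submodule.coe_norm, h2, div_mul_eq_mul_div, div_le_iff₀ (by positivity)]
    nlinarith [mul_nonneg hl (sq_nonneg ‖f1 p‖)]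
  obtain ⟨z, hz⟩ : ∃ z : W', ∀ q : W', inner ℝ z q = inner ℝ F (f1 q) :=
    ⟨(InnerProductSpace.toDual ℝ W').symm ((innerSL ℝ F).comp f1), fun q => by
      rw [InnerProductSpace.toDual_symm_apply]; simp⟩
  obtain ⟨p, hp⟩ : ∃ p : W', ∀ q, B p q = inner ℝ z q :=
    ⟨hco.continuousLinearEquivOfBilin.symm z, fun q => by
      rw [← hco.continuousLinearEquivOfBilin_apply, ContinuousLinearEquiv.apply_symm_apply]⟩
  refine ⟨prE p, (hW' _).1 p.2, fun q hq => ?_⟩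
  have hq' : prE.symm q ∈ W' := by
    rw [hW', ContinuousLinearEquiv.apply_symm_apply]; exact hq
  have h1 := hp ⟨_, hq'⟩
  rw [hB, hz, hf1, hf2, hf1, hf2] at h1
  simpa only [ContinuousLinearEquiv.apply_symm_apply] using h1

theorem solve (W : Submodule ℝ (HH n)) (hW : IsClosed (W : Set (HH n))) {lam γ : ℝ} (hl : 0 ≤ lam)
    (hγ : 0 < γ) (hc : ∀ p ∈ W, γ * ‖p.1‖ ^ 2 ≤ ‖p.2‖ ^ 2 - lam * ‖p.1‖ ^ 2) (F : LL n) :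
    ∃ p ∈ W, ∀ q ∈ W, inner ℝ p.2 q.2 - lam * inner ℝ p.1 q.1 = inner ℝ F q.1 :=
  solveAbs W hW hl hγ hc F

end solve

section iface
variable {n : ℕ}

theorem real_ball (s : ℝ) (hs : 0 < s) (x : Euc n) :
    volume.real (ball x s) = s ^ n * volume.real (ball (0 : Euc n) 1) := by
  unfold Measure.real
  rw [Measure.addHaar_ball_of_pos _ _ hs]
  simp [ENNReal.toReal_mul, ENNReal.toReal_ofReal (pow_nonneg hs.le n)]

theorem om_pos : 0 < volume.real (ball (0 : Euc n) 1) :=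
  ENNReal.toReal_pos (measure_ball_pos _ _ one_pos).ne' measure_ball_lt_top.ne

theorem FKr {p : HH n} (hp : p ∈ VV (univ : Set (Euc n))) {s : ℝ} (hs : 0 < s) {S : Set (Euc n)}
    (hS : ∀ᵐ x, x ∉ S → p.1 x = 0) (hf : volume S ≠ ∞)
    (h2 : 2 * volume.real S ≤ s ^ n * volume.real (ball (0 : Euc n) 1)) :
    ‖p.1‖ ^ 2 ≤ 2 * s ^ 2 * ‖p.2‖ ^ 2 := by
  refine FKineq hp hs ?_
  have h1 : volume {x | p.1 x ≠ 0} ≤ volume S := by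
    refine measure_mono_ae ?_
    filter_upwards [hS] with x hx hne
    by_contra h; exact hne (hx h)
  have h3 : 2 * volume S ≤ volume (ball (0 : Euc n) s) := by
    rw [← real_ball s hs 0] at h2
    rw [← ENNReal.ofReal_toReal hf, ← ENNReal.ofReal_toReal (measure_ball_lt_top (x := (0 : Euc n)) (r := s) (μ := volume)).ne]
    have : ENNReal.ofReal (2 * volume.real S) ≤ ENNReal.ofReal (volume.real (ball (0 : Euc n) s)) :=
      ENNReal.ofReal_le_ofReal h2
    rw [ENNReal.ofReal_mul (by norm_num)] at this
    simpa [Measure.real] using this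
  exact (mul_le_mul_right h1 2).trans h3

theorem poinc (hn : 1 ≤ n) {R : ℝ} (hR : 0 < R) {Ω : Set (Euc n)} (hΩ : Ω ⊆ ball 0 R) {p : HH n}
    (hp : p ∈ VV Ω) : ‖p.1‖ ^ 2 ≤ 8 * R ^ 2 * ‖p.2‖ ^ 2 := by
  have := FKr (VV_mono (subset_univ _) hp) (s := 2 * R) (by positivity) (S := ball 0 R)
    ((VV_ae_zero hp).mono fun x hx h => hx fun h' => h (hΩ h')) measure_ball_lt_top.ne ?_
  · linarith
  · rw [real_ball R hR, mul_pow, ← mul_assoc]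
    have : (2:ℝ) ^ 1 ≤ 2 ^ n := pow_le_pow_right₀ (by norm_num) hn
    have := om_pos (n := n)
    gcongr; linarith

def EE (n : ℕ) (R : ℝ) : LL n :=
  indicatorConstLp 2 (measurableSet_ball (x := (0 : Euc n)) (ε := R)) measure_ball_lt_top.ne (1:ℝ)

theorem EE_ae (R : ℝ) : EE n R =ᵐ[volume] (ball (0 : Euc n) R).indicator fun _ => (1:ℝ) :=
  indicatorConstLp_coeFn

theorem int_LL {R : ℝ} {f : LL n} (hf : ∀ᵐ x, x ∉ ball (0 : Euc n) R → f x = 0) :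
    Integrable f ∧ ∫ x, f x = inner ℝ (EE n R) f := by
  have e : (fun x => EE n R x * f x) =ᵐ[volume] f := by
    filter_upwards [EE_ae (n := n) R, hf] with x a b
    rw [a]
    by_cases h : x ∈ ball (0 : Euc n) R
    · simp [indicator_of_mem h]
    · simp [b h]
  exact ⟨(integrable_mul_LL (EE n R) f).congr e, by rw [inner_LL]; exact (integral_congr_ae e).symm⟩

def JJ (R : ℝ) (p : HH n) : ℝ := 1 / 2 * ‖p.2‖ ^ 2 - inner ℝ (EE n R) p.1

theorem VV_zero_ball {R : ℝ} {Ω : Set (Euc n)} (hΩ : Ω ⊆ ball 0 R) {p : HH n}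
    (hp : p ∈ VV Ω) : ∀ᵐ x, x ∉ ball (0 : Euc n) R → p.1 x = 0 :=
  (VV_ae_zero hp).mono fun x hx h => hx fun h' => h (hΩ h')

theorem JJ_eq {R : ℝ} {Ω : Set (Euc n)} (hΩ : Ω ⊆ ball 0 R) {p : HH n} (hp : p ∈ VV Ω)
    {w : Euc n → ℝ} {Dw : Euc n → Euc n} (h1 : p.1 =ᵐ[volume] w) (h2 : p.2 =ᵐ[volume] Dw) :
    ∫ x, ((1 / 2) * ‖Dw x‖ ^ 2 - w x) = JJ R p := by
  obtain ⟨i1, i2⟩ := int_LL (VV_zero_ball hΩ hp)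
  rw [JJ, ← i2, normsq_L2, ← integral_const_mul, ← integral_sub ((integrable_sq_L2 p.2).const_mul _) i1]
  refine integral_congr_ae ?_
  filter_upwards [h1, h2] with x a b
  rw [a, b]

def Ct (n : ℕ) (R : ℝ) : ℝ := 4 * R ^ 2 * ‖EE n R‖ ^ 2

theorem JJ_ge (hn : 1 ≤ n) {R : ℝ} (hR : 0 < R) {Ω : Set (Euc n)} (hΩ : Ω ⊆ ball 0 R) {p : HH n}
    (hp : p ∈ VV Ω) : - Ct n R ≤ JJ R p := by
  have h1 := poinc hn hR hΩ hp
  have h2 := real_inner_le_norm (EE n R) p.1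
  unfold JJ Ct
  have h4 : ‖EE n R‖ * ‖p.1‖ ≤ 4 * R ^ 2 * ‖EE n R‖ ^ 2 + ‖p.1‖ ^ 2 / (16 * R ^ 2) := by
    have : 0 ≤ (2 * R * ‖EE n R‖ - ‖p.1‖ / (4 * R)) ^ 2 := sq_nonneg _
    have e : (2 * R * ‖EE n R‖ - ‖p.1‖ / (4 * R)) ^ 2 = 4 * R ^ 2 * ‖EE n R‖ ^ 2 +
      ‖p.1‖ ^ 2 / (16 * R ^ 2) - ‖EE n R‖ * ‖p.1‖ := by field_simp; ring
    linarith
  have h5 : ‖p.1‖ ^ 2 / (16 * R ^ 2) ≤ 1 / 2 * ‖p.2‖ ^ 2 := by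
    rw [div_le_iff₀ (by positivity)]; linarith
  linarith

theorem tor_bdd (hn : 1 ≤ n) {R : ℝ} (hR : 0 < R) {Ω : Set (Euc n)} (hΩ : Ω ⊆ ball 0 R) :
    ∀ r ∈ {r | ∃ w Dw, MemH10 Ω w Dw ∧ r = ∫ x, ((1 / 2) * ‖Dw x‖ ^ 2 - w x)}, - Ct n R ≤ r := by
  rintro r ⟨w, Dw, hw, rfl⟩
  obtain ⟨p, hp, a, b⟩ := of_memH10 hw
  rw [JJ_eq hΩ hp a b]
  exact JJ_ge hn hR hΩ hp

theorem tor_le (hn : 1 ≤ n) {R : ℝ} (hR : 0 < R) {Ω : Set (Euc n)} (hΩ : Ω ⊆ ball 0 R) {p : HH n}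
    (hp : p ∈ VV Ω) : tor Ω ≤ JJ R p :=
  csInf_le ⟨_, tor_bdd hn hR hΩ⟩ ⟨p.1, p.2, memH10_of hp ae_eq_rfl ae_eq_rfl,
    (JJ_eq hΩ hp ae_eq_rfl ae_eq_rfl).symm⟩

theorem le_tor {R : ℝ} {Ω : Set (Euc n)} (hΩ : Ω ⊆ ball 0 R) {c : ℝ}
    (h : ∀ p ∈ VV Ω, c ≤ JJ R p) : c ≤ tor Ω := by
  refine le_csInf ?_ ?_
  · exact ⟨_, (0 : HH n).1, (0 : HH n).2, memH10_of (VV Ω).zero_mem ae_eq_rfl ae_eq_rfl, rfl⟩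
  · rintro r ⟨w, Dw, hw, rfl⟩
    obtain ⟨p, hp, a, b⟩ := of_memH10 hw
    rw [JJ_eq hΩ hp a b]
    exact h p hp

theorem tor_ge (hn : 1 ≤ n) {R : ℝ} (hR : 0 < R) {Ω : Set (Euc n)} (hΩ : Ω ⊆ ball 0 R) :
    - Ct n R ≤ tor Ω := le_tor hΩ fun _ hp => JJ_ge hn hR hΩ hp

theorem tor_nonpos (hn : 1 ≤ n) {R : ℝ} (hR : 0 < R) {Ω : Set (Euc n)} (hΩ : Ω ⊆ ball 0 R) :
    tor Ω ≤ 0 := by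
  have := tor_le hn hR hΩ (VV Ω).zero_mem
  simpa [JJ] using this

/-- weak solution `-Δ p = F` in `Ω` -/
def WS (Ω : Set (Euc n)) (F : LL n) (p : HH n) : Prop :=
  p ∈ VV Ω ∧ ∀ q ∈ VV Ω, inner ℝ p.2 q.2 = inner ℝ F q.1

theorem WS_exists (hn : 1 ≤ n) {R : ℝ} (hR : 0 < R) {Ω : Set (Euc n)} (hΩ : Ω ⊆ ball 0 R)
    (F : LL n) : ∃ p, WS Ω F p := by
  obtain ⟨p, hp, h⟩ := solve (VV Ω) (VV_closed Ω) (lam := 0) (γ := 1 / (8 * R ^ 2)) le_rfl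
    (by positivity) (fun p hp => by
      rw [zero_mul, sub_zero, one_div, inv_mul_le_iff₀ (by positivity)]
      exact poinc hn hR hΩ hp) F
  exact ⟨p, hp, fun q hq => by simpa using h q hq⟩

theorem tor_WS (hn : 1 ≤ n) {R : ℝ} (hR : 0 < R) {Ω : Set (Euc n)} (hΩ : Ω ⊆ ball 0 R) {p : HH n}
    (hp : WS Ω (EE n R) p) : tor Ω = - (1 / 2) * inner ℝ (EE n R) p.1 := by
  have e : JJ R p = - (1 / 2) * inner ℝ (EE n R) p.1 := by
    have := hp.2 p hp.1
    rw [real_inner_self_eq_norm_sq] at this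
    rw [JJ, this]; ring
  rw [← e]
  refine le_antisymm (tor_le hn hR hΩ hp.1) (le_tor hΩ fun q hq => ?_)
  rw [e, JJ]
  have h1 := hp.2 q hq
  have h2 := hp.2 p hp.1
  have h3 : 0 ≤ ‖p.2 - q.2‖ ^ 2 := sq_nonneg _
  rw [norm_sub_sq_real, h1] at h3
  rw [real_inner_self_eq_norm_sq] at h2
  linarith

theorem torsion_WS (hn : 1 ≤ n) {R : ℝ} (hR : 0 < R) {Ω : Set (Euc n)} (hΩ : Ω ⊆ ball 0 R)
    {w : Euc n → ℝ} (hw : IsTorsionFun Ω w) : ∃ p, WS Ω (EE n R) p ∧ p.1 =ᵐ[volume] w := by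
  obtain ⟨-, Dw, hw, he⟩ := hw
  obtain ⟨q, hq, a, b⟩ := of_memH10 hw
  rw [JJ_eq hΩ hq a b] at he
  obtain ⟨p, hp⟩ := WS_exists hn hR hΩ (EE n R)
  have ht := tor_WS hn hR hΩ hp
  have h1 := hp.2 q hq
  have h2 := hp.2 p hp.1
  rw [real_inner_self_eq_norm_sq] at h2
  have h3 : ‖(p - q).2‖ ^ 2 = 0 := by
    rw [Prod.snd_sub, norm_sub_sq_real, h1]
    rw [ht, JJ] at he
    linarith
  have h4 := poinc hn hR hΩ ((VV Ω).sub_mem hp.1 hq)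
  rw [h3, mul_zero] at h4
  have h5 : p.1 - q.1 = 0 := norm_eq_zero.1 (pow_eq_zero_iff two_ne_zero |>.1 (le_antisymm h4 (sq_nonneg _)))
  rw [sub_eq_zero] at h5
  exact ⟨p, hp, h5 ▸ a⟩

theorem lam1_nonneg (Ω : Set (Euc n)) : 0 ≤ lam1 Ω := by
  refine Real.sInf_nonneg ?_
  rintro r ⟨u, Du, -, -, rfl⟩
  exact div_nonneg (integral_nonneg fun x => by positivity) (integral_nonneg fun x => by positivity)

theorem lam1_le {Ω : Set (Euc n)} {p : HH n} (hp : p ∈ VV Ω) :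
    lam1 Ω * ‖p.1‖ ^ 2 ≤ ‖p.2‖ ^ 2 := by
  by_cases h : ‖p.1‖ ^ 2 = 0
  · rw [h, mul_zero]; positivity
  · have hpos : 0 < ‖p.1‖ ^ 2 := lt_of_le_of_ne (sq_nonneg _) (Ne.symm h)
    rw [← le_div_iff₀ hpos]
    refine csInf_le ⟨0, ?_⟩ ⟨p.1, p.2, memH10_of hp ae_eq_rfl ae_eq_rfl, ?_, ?_⟩
    · rintro r ⟨u, Du, -, -, rfl⟩
      exact div_nonneg (integral_nonneg fun x => by positivity) (integral_nonneg fun x => by positivity)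
    · rwa [← normsq_LL]
    · rw [← normsq_LL, ← normsq_L2]

theorem exists_VV {Ω : Set (Euc n)} (ho : IsOpen Ω) (hne : Ω.Nonempty) :
    ∃ p ∈ VV Ω, ‖p.1‖ ^ 2 ≠ 0 := by
  obtain ⟨x, hx⟩ := hne
  obtain ⟨f, h1, h2, h3, h4, h5⟩ := exists_contDiff_tsupport_subset (n := (⊤ : ℕ∞)) (ho.mem_nhds hx)
  have ht : IsTestFun Ω f := ⟨h3, h2, h1⟩
  refine ⟨tp ht, subset_closure (tp_mem ht), fun h => ?_⟩
  have h0 : (tp ht).1 = 0 := norm_eq_zero.1 (pow_eq_zero_iff two_ne_zero |>.1 h)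
  have hz : f =ᵐ[volume] fun _ => (0:ℝ) := by
    have := ht.memLp.coeFn_toLp
    change (tp ht).1 =ᵐ[volume] f at this
    rw [h0] at this
    exact this.symm.trans (Lp.coeFn_zero ..)
  have := (Continuous.ae_eq_iff_eq volume h3.continuous continuous_const).1 hz
  rw [this] at h5
  norm_num at h5

theorem lam1_approx {Ω : Set (Euc n)} (ho : IsOpen Ω) (hne : Ω.Nonempty) {ε : ℝ} (hε : 0 < ε) :
    ∃ p ∈ VV Ω, ‖p.1‖ = 1 ∧ ‖p.2‖ ^ 2 < lam1 Ω + ε := by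
  obtain ⟨p0, hp0, h0⟩ := exists_VV ho hne
  obtain ⟨r, ⟨u, Du, hu, hn0, rfl⟩, hr⟩ := exists_lt_of_csInf_lt (s := {r | ∃ u Du, MemH10 Ω u Du ∧ (∫ x, u x ^ 2) ≠ 0 ∧
    r = (∫ x, ‖Du x‖ ^ 2) / (∫ x, u x ^ 2)}) ⟨_, p0.1, p0.2, memH10_of hp0 ae_eq_rfl ae_eq_rfl, by rwa [← normsq_LL], rfl⟩
    (show lam1 Ω < lam1 Ω + ε by linarith)
  obtain ⟨p, hp, a, b⟩ := of_memH10 hu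
  have e1 : ∫ x, u x ^ 2 = ‖p.1‖ ^ 2 := by
    rw [normsq_LL]; exact integral_congr_ae (a.mono fun x hx => by simp only [hx])
  have e2 : ∫ x, ‖Du x‖ ^ 2 = ‖p.2‖ ^ 2 := by
    rw [normsq_L2]; exact integral_congr_ae (b.mono fun x hx => by simp only [hx])
  rw [e1, e2] at hr; rw [e1] at hn0
  have hpn : ‖p.1‖ ≠ 0 := fun h => hn0 (by rw [h]; simp)
  refine ⟨(‖p.1‖⁻¹) • p, (VV Ω).smul_mem _ hp, ?_, ?_⟩
  · rw [Prod.smul_fst, norm_smul]; simp [hpn]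
  · rw [Prod.smul_snd, norm_smul, mul_pow]
    refine lt_of_eq_of_lt ?_ hr
    simp [div_eq_inv_mul]

theorem lam1_mono {Ω Ω' : Set (Euc n)} (ho : IsOpen Ω') (hne : Ω'.Nonempty) (h : Ω' ⊆ Ω) :
    lam1 Ω ≤ lam1 Ω' := by
  refine le_of_forall_pos_le_add fun ε hε => ?_
  obtain ⟨p, hp, h1, h2⟩ := lam1_approx ho hne hε
  have := lam1_le (VV_mono h hp)
  rw [h1] at this; linarith

theorem fpen_diff {v η s t : ℝ} (hη : 0 < η) (h1 : η ≤ 1) (h : s ≤ t) :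
    η * (t - s) ≤ fpen v η t - fpen v η s := by
  have h2 : η ≤ 1 / η := by rw [le_div_iff₀ hη]; nlinarith
  unfold fpen
  split_ifs with a b b
  · linarith
  · linarith
  · have : η * (t - v) ≤ (t - v) / η := by
      rw [div_eq_mul_one_div, mul_comm]; gcongr; linarith
    linarith
  · rw [← sub_div, show t - v - (s - v) = t - s by ring, div_eq_mul_one_div, mul_comm]; gcongr

theorem fpen_ge {v η t : ℝ} (hη : 0 < η) (h1 : η ≤ 1) (hv : 0 < v) (h : 0 ≤ t) : - v ≤ fpen v η t := by
  have := fpen_diff (v := v) hη h1 h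
  have h0 : fpen v η 0 = η * (0 - v) := by unfold fpen; rw [if_pos hv.le]
  nlinarith

theorem Emin_le (hn : 1 ≤ n) {R v vmax η 𝔗 : ℝ} (hR : 0 < R) (hv : 0 < v) (hη : 0 < η) (h1 : η ≤ 1)
    (hT : 0 < 𝔗) {Ω : Set (Euc n)} (hΩ : Ω ∈ Hclass n R vmax) :
    Emin n R vmax v η 𝔗 ≤ baseE v η 𝔗 Ω := by
  refine csInf_le ⟨𝔗 * (- Ct n R) - v, ?_⟩ ⟨Ω, hΩ, rfl⟩
  rintro _ ⟨A, hA, rfl⟩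
  unfold baseE
  have a := lam1_nonneg A
  have b := mul_le_mul_of_nonneg_left (tor_ge hn hR hA.2.2.1) hT.le
  have c := fpen_ge (v := v) (t := (volume A).toReal) hη h1 hv ENNReal.toReal_nonneg
  linarith

end iface

section lemS
variable {n : ℕ}

theorem cheb (f : LL n) {t : ℝ} (ht : 0 < t) {S : Set (Euc n)} (hS : ∀ᵐ x, x ∈ S → t ≤ |f x|) :
    volume S ≠ ∞ ∧ t ^ 2 * volume.real S ≤ ‖f‖ ^ 2 := by
  have h1 : ENNReal.ofReal (t ^ 2) * volume S ≤ ENNReal.ofReal (‖f‖ ^ 2) := by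
    rw [ofReal_normsq]
    refine le_trans ?_ (mul_meas_ge_le_lintegral₀ ?_ (ENNReal.ofReal (t ^ 2)))
    · refine mul_le_mul_right (measure_mono_ae ?_) _
      filter_upwards [hS] with x hx hxS
      refine ENNReal.ofReal_le_ofReal ?_
      have := hx hxS
      rw [Real.norm_eq_abs]
      gcongr
    · exact ((Lp.aestronglyMeasurable f).norm.pow 2).aemeasurable.ennreal_ofReal
  have h0 : ENNReal.ofReal (t ^ 2) ≠ 0 := by simp [ht.ne']
  have hf : volume S ≠ ∞ := by
    intro h
    rw [h, ENNReal.mul_top h0] at h1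
    exact absurd h1 (by simp)
  refine ⟨hf, ?_⟩
  have := ENNReal.toReal_mono ENNReal.ofReal_ne_top h1
  rwa [ENNReal.toReal_mul, ENNReal.toReal_ofReal (by positivity), ENNReal.toReal_ofReal (by positivity)] at this

theorem lemS {Ω : Set (Euc n)} (hfin : volume Ω ≠ ∞) {g : HH n} (hg : g ∈ VV Ω) {ε : ℝ} (hε : 0 < ε) :
    ∃ A : Set (Euc n), IsOpen A ∧ A ⊆ Ω ∧ volume.real A ≤ volume.real {x | 0 < g.1 x} + ε ∧
      ∃ p ∈ VV A, ‖p - PP 0 g‖ < ε := by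
  obtain ⟨C, hC⟩ := tht_SmB
  obtain ⟨j, hj⟩ := ((tendsto_iff_norm_sub_tendsto_zero.1 (Th_lim le_rfl g)).eventually
    (gt_mem_nhds (half_pos hε))).exists
  set t : ℝ := 1 / ((j : ℝ) + 1) with htd
  have ht : 0 < t := Nat.one_div_pos_of_nat
  have hS := hC 0 t le_rfl ht
  obtain ⟨q, hq, hl⟩ := mem_closure_iff_seq_limit.1 (mem_VV.1 hg)
  have l1 := tendsto_iff_norm_sub_tendsto_zero.1 (((Th_cont hS).tendsto g).comp hl)
  have l2 := (tendsto_iff_norm_sub_tendsto_zero.1 ((continuous_fst.tendsto g).comp hl)).pow 2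
  have e1 := l1.eventually (gt_mem_nhds (half_pos hε))
  have hp2 : 0 < (t / 2) ^ 2 * ε := by positivity
  rw [zero_pow two_ne_zero] at l2
  have e2 := l2.eventually (gt_mem_nhds hp2)
  obtain ⟨k, hk1, hk2⟩ := (e1.and e2).exists
  obtain ⟨φ, hφ, h1, h2⟩ := hq k
  simp only [Function.comp] at hk1 hk2
  have hsub : {x | t / 2 < φ x} ⊆ Ω := by
    intro x hx
    refine hφ.2.2 (subset_tsupport _ ?_)
    have : t / 2 < φ x := hx
    simp only [Function.mem_support]; intro h; linarith
  refine ⟨{x | t / 2 < φ x}, isOpen_lt continuous_const hφ.1.continuous, hsub, ?_,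
    Th (tht 0 t) (q k), ?_, ?_⟩
  · have hc := cheb ((q k).1 - g.1) (t := t / 2) (half_pos ht)
      (S := {x | t / 2 < φ x} \ {x | 0 < g.1 x}) ?_
    · have hm : volume.real {x | t / 2 < φ x} ≤ volume.real {x | 0 < g.1 x} +
          volume.real ({x | t / 2 < φ x} \ {x | 0 < g.1 x}) := by
        refine (measureReal_mono (s₂ := {x | 0 < g.1 x} ∪ ({x | t / 2 < φ x} \ {x | 0 < g.1 x})) ?_ ?_).trans
          (measureReal_union_le _ _)
        · intro x hx
          by_cases h : 0 < g.1 x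
          · exact Or.inl h
          · exact Or.inr ⟨hx, h⟩
        · refine (measure_union_lt_top ?_ ?_).ne
          · refine lt_of_le_of_lt (measure_mono_ae ?_) hfin.lt_top
            filter_upwards [VV_ae_zero hg] with x hx h0
            by_contra h
            have := hx h
            have h0' : 0 < g.1 x := h0
            linarith
          · exact hc.1.lt_top
      have : (t / 2) ^ 2 * volume.real ({x | t / 2 < φ x} \ {x | 0 < g.1 x}) < (t / 2) ^ 2 * ε :=
        lt_of_le_of_lt hc.2 hk2
      have := lt_of_mul_lt_mul_left this (by positivity)
      linarith
    · filter_upwards [Lp.coeFn_sub (q k).1 g.1, h1] with x a b hx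
      rw [a, Pi.sub_apply, b]
      have h3 : t / 2 < φ x := hx.1
      have h4 : ¬ (0 < g.1 x) := hx.2
      exact le_trans (by linarith) (le_abs_self _)
  · refine subset_closure ⟨_, Th_TT hS (hφ.mono (subset_univ _)) h1 h2 ?_⟩
    have : tsupport (fun x => tht 0 t (φ x)) ⊆ {x | t ≤ φ x} := by
      refine closure_minimal ?_ (isClosed_le continuous_const hφ.1.continuous)
      intro x hx
      by_contra h
      have h' : φ x < t := not_le.1 h
      exact hx (tht_zero ht (by linarith))
    refine this.trans fun x hx => ?_
    have : t ≤ φ x := hx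
    show t / 2 < φ x
    linarith
  · calc ‖Th (tht 0 t) (q k) - PP 0 g‖ ≤ ‖Th (tht 0 t) (q k) - Th (tht 0 t) g‖ + ‖Th (tht 0 t) g - PP 0 g‖ :=
          norm_sub_le_norm_sub_add_norm_sub _ _ _
      _ < ε := by linarith

def KK (Ω : Set (Euc n)) (κ : ℝ) : Prop := ∀ g ∈ VV Ω, 2 * volume.real {x | 0 < g.1 x} ≤ volume.real Ω →
  (lam1 Ω + κ) * ‖(PP 0 g).1‖ ^ 2 ≤ ‖(PP 0 g).2‖ ^ 2

theorem lemK (hn : 1 ≤ n) {R v vmax η 𝔗 δ m κ : ℝ} (hR : 0 < R) (hv : 0 < v) (hη : 0 < η) (h1 : η ≤ 1)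
    (hT : 0 < 𝔗) {Ω : Set (Euc n)} (hΩ : Ω ∈ Hclass n R vmax)
    (hE : baseE v η 𝔗 Ω ≤ Emin n R vmax v η 𝔗 + δ) (hm : m ≤ volume.real Ω)
    (hκ : 𝔗 * Ct n R + δ + κ ≤ η * m / 2) : KK Ω κ := by
  intro g hg hvol
  have hfin : volume Ω ≠ ∞ := ((measure_mono hΩ.2.2.1).trans_lt measure_ball_lt_top).ne
  by_cases h0 : ‖(PP 0 g).1‖ = 0
  · rw [h0]; simp
  have hpos : ∀ k : ℕ, (0:ℝ) < 1 / ((k : ℝ) + 1) := fun j => Nat.one_div_pos_of_nat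
  choose A hAo hAs hAv p hp hpn using fun k => lemS hfin hg (hpos k)
  have hlim0 : Tendsto (fun k : ℕ => (1:ℝ) / ((k : ℝ) + 1)) atTop (𝓝 0) := tendsto_one_div_add_atTop_nhds_zero_nat
  have hl : Tendsto p atTop (𝓝 (PP 0 g)) := by
    rw [tendsto_iff_norm_sub_tendsto_zero]
    exact squeeze_zero (fun _ => norm_nonneg _) (fun k => (hpn k).le) hlim0
  have hl1 := ((continuous_fst.tendsto _).comp hl).norm
  have hl2 := ((continuous_snd.tendsto _).comp hl).norm
  have hne : ∀ᶠ k in atTop, ‖(p k).1‖ ≠ 0 := hl1.eventually_ne h0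
  refine le_of_tendsto_of_tendsto (b := atTop) (f := fun k : ℕ => (lam1 Ω + κ - η * (1 / ((k : ℝ) + 1))) * ‖(p k).1‖ ^ 2)
    (g := fun k => ‖(p k).2‖ ^ 2) ?_ (hl2.pow 2) ?_
  · have := (hlim0.const_mul η).const_sub (lam1 Ω + κ)
    simpa using this.mul (hl1.pow 2)
  · filter_upwards [hne] with k hk
    refine le_trans ?_ (lam1_le (hp k))
    gcongr
    have hAne : (A k).Nonempty := by
      by_contra h
      rw [not_nonempty_iff_eq_empty] at h
      apply hk
      have := VV_ae_zero (hp k)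
      rw [h] at this
      rw [norm_eq_zero]
      refine Lp.ext ?_
      filter_upwards [this, Lp.coeFn_zero ℝ 2 (volume : Measure (Euc n))] with x hx h0
      rw [h0, Pi.zero_apply]
      exact hx (notMem_empty x)
    have hAv2 : volume.real (A k) ≤ volume.real Ω := measureReal_mono (hAs k) hfin
    have hAH : A k ∈ Hclass n R vmax := ⟨hAo k, hAne, (hAs k).trans hΩ.2.2.1, hAv2.trans hΩ.2.2.2⟩
    have h3 := hE.trans (add_le_add_left (Emin_le hn hR hv hη h1 hT hAH) δ)
    unfold baseE at h3
    have h4 := fpen_diff (v := v) hη h1 hAv2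
    have h5 := mul_le_mul_of_nonneg_left (tor_ge hn hR hΩ.2.2.1) hT.le
    have h6 := mul_nonpos_of_nonneg_of_nonpos hT.le (tor_nonpos hn hR hAH.2.2.1)
    have h7 := hAv k
    unfold Measure.real at *
    nlinarith [hpos k]

end lemS

section eig
variable {n : ℕ}

theorem inner_nonneg_LL {f g : LL n} (hf : ∀ᵐ x, 0 ≤ f x) (hg : ∀ᵐ x, 0 ≤ g x) :
    0 ≤ (inner ℝ f g : ℝ) := by
  rw [inner_LL]
  refine integral_nonneg_of_ae ?_
  filter_upwards [hf, hg] with x a b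
  exact mul_nonneg a b

theorem inner_mono_LL {f g h : LL n} (hf : ∀ᵐ x, 0 ≤ f x) (hg : ∀ᵐ x, g x ≤ h x) :
    (inner ℝ f g : ℝ) ≤ inner ℝ f h := by
  have : 0 ≤ (inner ℝ f (h - g) : ℝ) := by
    refine inner_nonneg_LL hf ?_
    filter_upwards [hg, Lp.coeFn_sub h g] with x a b
    rw [b, Pi.sub_apply]; linarith
  rw [inner_sub_right] at this; linarith

theorem PP0_fst (p : HH n) : (PP 0 p).1 =ᵐ[volume] fun x => max (p.1 x) 0 := by
  simpa using PP_fst le_rfl p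

theorem PP_nonneg {k : ℝ} (hk : 0 ≤ k) (p : HH n) : ∀ᵐ x, 0 ≤ (PP k p).1 x := by
  filter_upwards [PP_fst hk p] with x a
  rw [a]; exact le_max_right _ _

theorem PPn_fst (p : HH n) : (PP 0 (-p)).1 =ᵐ[volume] fun x => max (- p.1 x) 0 := by
  filter_upwards [PP0_fst (-p), Lp.coeFn_neg p.1] with x a b
  rw [a, Prod.fst_neg, b, Pi.neg_apply]

theorem PPn_snd (p : HH n) :
    (PP 0 (-p)).2 =ᵐ[volume] fun x => -((if p.1 x < 0 then (1:ℝ) else 0) • p.2 x) := by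
  filter_upwards [PP_snd 0 (-p), Lp.coeFn_neg p.1, Lp.coeFn_neg p.2] with x a b c
  rw [a, Prod.fst_neg, Prod.snd_neg, b, c, Pi.neg_apply, Pi.neg_apply]
  by_cases h : p.1 x < 0
  · rw [if_pos h, if_pos (by linarith)]; simp
  · rw [if_neg h, if_neg (by linarith)]; simp

theorem PP_decomp (p : HH n) : p.1 = (PP 0 p).1 - (PP 0 (-p)).1 := by
  refine Lp.ext ?_
  filter_upwards [PP0_fst p, PPn_fst p, Lp.coeFn_sub (PP 0 p).1 (PP 0 (-p)).1] with x a b c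
  rw [c, Pi.sub_apply, a, b]
  rcases le_total (p.1 x) 0 with h | h
  · rw [max_eq_right h, max_eq_left (by linarith)]; ring
  · rw [max_eq_left h, max_eq_right (by linarith)]; ring

theorem PP_orth (p : HH n) : (inner ℝ (PP 0 p).1 (PP 0 (-p)).1 : ℝ) = 0 := by
  rw [inner_LL]
  rw [integral_eq_zero_of_ae]
  filter_upwards [PP0_fst p, PPn_fst p] with x a b
  rw [a, b, Pi.zero_apply]
  rcases le_total (p.1 x) 0 with h | h
  · rw [max_eq_right h]; ring
  · rw [max_eq_right (b := (0:ℝ)) (a := - p.1 x) (by linarith)]; ring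

theorem PP_normsq (p : HH n) : ‖p.1‖ ^ 2 = ‖(PP 0 p).1‖ ^ 2 + ‖(PP 0 (-p)).1‖ ^ 2 := by
  conv_lhs => rw [PP_decomp p]
  rw [norm_sub_sq_real, PP_orth]; ring

theorem PP_normsq_abs (p : HH n) : ‖p.1‖ ^ 2 = ‖(PP 0 p + PP 0 (-p)).1‖ ^ 2 := by
  rw [PP_normsq, Prod.fst_add, norm_add_sq_real, PP_orth]; ring

theorem PP_gradsq (p : HH n) : ‖(PP 0 p).2‖ ^ 2 + ‖(PP 0 (-p)).2‖ ^ 2 ≤ ‖p.2‖ ^ 2 := by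
  rw [normsq_L2, normsq_L2, normsq_L2, ← integral_add (integrable_sq_L2 _) (integrable_sq_L2 _)]
  refine integral_mono_ae ((integrable_sq_L2 _).add (integrable_sq_L2 _)) (integrable_sq_L2 _) ?_
  filter_upwards [PP_snd 0 p, PPn_snd p] with x a b
  rw [a, b]
  rcases lt_trichotomy (p.1 x) 0 with h | h | h
  · rw [if_neg (by linarith), if_pos h]; simp
  · rw [if_neg (by linarith), if_neg (by linarith)]; simp
  · rw [if_pos h, if_neg (by linarith)]; simp

theorem PP_gradsq_abs (p : HH n) : ‖(PP 0 p + PP 0 (-p)).2‖ ^ 2 ≤ ‖p.2‖ ^ 2 := by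
  rw [normsq_L2, normsq_L2]
  refine integral_mono_ae (integrable_sq_L2 _) (integrable_sq_L2 _) ?_
  filter_upwards [PP_snd 0 p, PPn_snd p, Lp.coeFn_add (PP 0 p).2 (PP 0 (-p)).2] with x a b c
  rw [Prod.snd_add, c, Pi.add_apply, a, b]
  rcases lt_trichotomy (p.1 x) 0 with h | h | h
  · rw [if_neg (by linarith), if_pos h]; simp
  · rw [if_neg (by linarith), if_neg (by linarith)]; simp
  · rw [if_pos h, if_neg (by linarith)]; simp

theorem half_alt {Ω : Set (Euc n)} (hfin : volume Ω ≠ ∞) {f : HH n} (hf : f ∈ VV Ω) :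
    2 * volume.real {x | 0 < f.1 x} ≤ volume.real Ω ∨
    2 * volume.real {x | 0 < (-f).1 x} ≤ volume.real Ω := by
  have hm : Measurable (f.1 : Euc n → ℝ) := (Lp.stronglyMeasurable f.1).measurable
  have e : volume.real {x | 0 < (-f).1 x} = volume.real {x | f.1 x < 0} := by
    refine measureReal_congr ?_
    filter_upwards [Lp.coeFn_neg f.1] with x a
    have : (0 < (-f).1 x) = (f.1 x < 0) := by
      rw [Prod.fst_neg, a, Pi.neg_apply]; simp
    exact this
  have hae : ({x | 0 < f.1 x} ∪ {x | f.1 x < 0} : Set (Euc n)) ≤ᵐ[volume] Ω := by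
    filter_upwards [VV_ae_zero hf] with x a h
    by_contra h'
    have h0 := a h'
    rcases h with h | h
    · have : 0 < f.1 x := h
      linarith
    · have : f.1 x < 0 := h
      linarith
  have hU : volume ({x | 0 < f.1 x} ∪ {x | f.1 x < 0} : Set (Euc n)) ≤ volume Ω := measure_mono_ae hae
  have hUr : volume.real ({x | 0 < f.1 x} ∪ {x | f.1 x < 0} : Set (Euc n)) ≤ volume.real Ω :=
    ENNReal.toReal_mono hfin hU
  have f1 : volume {x | 0 < f.1 x} ≠ ∞ := ((measure_mono subset_union_left).trans hU |>.trans_lt hfin.lt_top).ne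
  have f2 : volume {x | f.1 x < 0} ≠ ∞ := ((measure_mono subset_union_right).trans hU |>.trans_lt hfin.lt_top).ne
  rw [measureReal_union (by
    rw [Set.disjoint_left]; intro x (h : 0 < f.1 x) (h' : f.1 x < 0); linarith)
    (measurableSet_lt hm measurable_const) f1 f2] at hUr
  rw [e]
  by_contra h
  rw [not_or] at h
  linarith [h.1, h.2]

def qf (lam : ℝ) (p : HH n) : ℝ := ‖p.2‖ ^ 2 - lam * ‖p.1‖ ^ 2

theorem qf_par (lam : ℝ) (a b : HH n) : qf lam (a - b) + qf lam (a + b) = 2 * qf lam a + 2 * qf lam b := by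
  unfold qf
  rw [Prod.fst_sub, Prod.snd_sub, Prod.fst_add, Prod.snd_add, norm_sub_sq_real, norm_sub_sq_real,
    norm_add_sq_real, norm_add_sq_real]
  ring

theorem qf_nonneg {Ω : Set (Euc n)} {p : HH n} (hp : p ∈ VV Ω) : 0 ≤ qf (lam1 Ω) p := by
  unfold qf; linarith [lam1_le hp]

theorem qf_neg (lam : ℝ) (p : HH n) : qf lam (-p) = qf lam p := by
  unfold qf; simp

theorem qf_pm {lam : ℝ} (p : HH n) : qf lam (PP 0 p) + qf lam (PP 0 (-p)) ≤ qf lam p := by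
  unfold qf; rw [PP_normsq p]; linarith [PP_gradsq p]

theorem KK_small {Ω : Set (Euc n)} {κ : ℝ} (hK : KK Ω κ) {f : HH n} (hf : f ∈ VV Ω)
    (h2 : 2 * volume.real {x | 0 < f.1 x} ≤ volume.real Ω) :
    κ * ‖(PP 0 f).1‖ ^ 2 ≤ qf (lam1 Ω) f := by
  have h1 := hK f hf h2
  have h3 := qf_nonneg (PP_VV le_rfl ((VV Ω).neg_mem hf))
  have h4 := qf_pm (lam := lam1 Ω) f
  unfold qf at *
  linarith

theorem E1aux {Ω : Set (Euc n)} {κ ε : ℝ} (hK : KK Ω κ)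
    {a b : HH n} (ha : a ∈ VV Ω) (hb : b ∈ VV Ω) (ha0 : ∀ᵐ x, 0 ≤ a.1 x) (hb0 : ∀ᵐ x, 0 ≤ b.1 x)
    (ha1 : ‖a.1‖ = 1) (hb1 : ‖b.1‖ = 1) (hqa : qf (lam1 Ω) a ≤ ε) (hqb : qf (lam1 Ω) b ≤ ε)
    (hh : 2 * volume.real {x | 0 < (-(a - b)).1 x} ≤ volume.real Ω) :
    ∃ s, 0 ≤ s ∧ κ * s ^ 2 ≤ 4 * ε ∧ ‖(a - b).1‖ ^ 2 ≤ s ^ 2 + 2 * s := by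
  have hf := (VV Ω).sub_mem ha hb
  have h1 := KK_small hK ((VV Ω).neg_mem hf) hh
  have h2 := qf_par (lam1 Ω) a b
  have h3 := qf_nonneg ((VV Ω).add_mem ha hb)
  rw [qf_neg] at h1
  refine ⟨‖(PP 0 (-(a - b))).1‖, norm_nonneg _, by linarith, ?_⟩
  rw [PP_normsq (a - b)]
  set P := (PP 0 (a - b)).1 with hP
  set N := (PP 0 (-(a - b))).1 with hN
  have hd : a.1 - b.1 = P - N := PP_decomp (a - b)
  have h4 : ‖P‖ ^ 2 ≤ inner ℝ P (a.1 + b.1) := by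
    rw [← real_inner_self_eq_norm_sq]
    refine inner_mono_LL (PP_nonneg le_rfl _) ?_
    filter_upwards [PP0_fst (a - b), Lp.coeFn_sub a.1 b.1, Lp.coeFn_add a.1 b.1, ha0, hb0] with x c d e f g
    rw [e, Pi.add_apply, hP, c, Prod.fst_sub, d, Pi.sub_apply]
    exact max_le (by linarith) (by linarith)
  have h5 : (inner ℝ (a.1 - b.1) (a.1 + b.1) : ℝ) = 0 := by
    rw [inner_add_right, inner_sub_left, inner_sub_left, real_inner_self_eq_norm_sq,
      real_inner_self_eq_norm_sq, ha1, hb1, real_inner_comm a.1 b.1]; ring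
  rw [hd, inner_sub_left] at h5
  have h6 : (inner ℝ N (a.1 + b.1) : ℝ) ≤ ‖N‖ * 2 := by
    refine (real_inner_le_norm _ _).trans ?_
    gcongr
    exact (norm_add_le _ _).trans (by rw [ha1, hb1]; norm_num)
  linarith

theorem E1 {Ω : Set (Euc n)} (hfin : volume Ω ≠ ∞) {κ ε : ℝ} (hK : KK Ω κ)
    {a b : HH n} (ha : a ∈ VV Ω) (hb : b ∈ VV Ω) (ha0 : ∀ᵐ x, 0 ≤ a.1 x) (hb0 : ∀ᵐ x, 0 ≤ b.1 x)
    (ha1 : ‖a.1‖ = 1) (hb1 : ‖b.1‖ = 1) (hqa : qf (lam1 Ω) a ≤ ε) (hqb : qf (lam1 Ω) b ≤ ε) :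
    ∃ s, 0 ≤ s ∧ κ * s ^ 2 ≤ 4 * ε ∧ ‖(a - b).1‖ ^ 2 ≤ s ^ 2 + 2 * s := by
  rcases half_alt hfin ((VV Ω).sub_mem ha hb) with h | h
  · have e : a - b = -(b - a) := by abel
    rw [e] at h
    obtain ⟨s, h0, h1, h2⟩ := E1aux hK hb ha hb0 ha0 hb1 ha1 hqb hqa h
    refine ⟨s, h0, h1, ?_⟩
    rw [e, Prod.fst_neg, norm_neg]; exact h2
  · exact E1aux hK ha hb ha0 hb0 ha1 hb1 hqa hqb h

def EF (Ω : Set (Euc n)) (u : HH n) : Prop :=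
  u ∈ VV Ω ∧ (∀ᵐ x, 0 ≤ u.1 x) ∧ ‖u.1‖ = 1 ∧ ‖u.2‖ ^ 2 = lam1 Ω

theorem EF_unique {Ω : Set (Euc n)} (hfin : volume Ω ≠ ∞) {κ : ℝ} (hκ : 0 < κ) (hK : KK Ω κ)
    {a b : HH n} (ha : EF Ω a) (hb : EF Ω b) : a.1 = b.1 := by
  obtain ⟨s, h0, h1, h2⟩ := E1 hfin (ε := 0) hK ha.1 hb.1 ha.2.1 hb.2.1 ha.2.2.1 hb.2.2.1
    (by unfold qf; rw [ha.2.2.1, ha.2.2.2]; linarith) (by unfold qf; rw [hb.2.2.1, hb.2.2.2]; linarith)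
  have hs : s = 0 := by
    by_contra h
    have : 0 < s ^ 2 := by positivity
    nlinarith
  rw [hs] at h2
  have : ‖(a - b).1‖ ^ 2 = 0 := le_antisymm (by linarith) (sq_nonneg _)
  have := norm_eq_zero.1 (pow_eq_zero_iff two_ne_zero |>.1 this)
  exact sub_eq_zero.1 this

theorem ae_nonneg_lim {F : ℕ → LL n} {f : LL n} (h : Tendsto F atTop (𝓝 f)) (hF : ∀ k, ∀ᵐ x, 0 ≤ F k x) :
    ∀ᵐ x, 0 ≤ f x := by
  obtain ⟨ns, -, hns⟩ := L2_subseq _ _ h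
  filter_upwards [hns, ae_all_iff.2 hF] with x a b
  exact ge_of_tendsto' a fun k => b _

theorem EF_exists {Ω : Set (Euc n)} (ho : IsOpen Ω) (hne : Ω.Nonempty) (hfin : volume Ω ≠ ∞)
    {κ : ℝ} (hκ : 0 < κ) (hK : KK Ω κ) : ∃ u, EF Ω u := by
  have hpos : ∀ k : ℕ, (0:ℝ) < 1 / ((k : ℝ) + 1) := fun j => Nat.one_div_pos_of_nat
  have hlim0 : Tendsto (fun k : ℕ => (1:ℝ) / ((k : ℝ) + 1)) atTop (𝓝 0) := tendsto_one_div_add_atTop_nhds_zero_nat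
  choose p hp hp1 hp2 using fun k => lam1_approx ho hne (hpos k)
  set a : ℕ → HH n := fun k => PP 0 (p k) + PP 0 (-(p k)) with had
  have ha : ∀ k, a k ∈ VV Ω := fun k => (VV Ω).add_mem (PP_VV le_rfl (hp k)) (PP_VV le_rfl ((VV Ω).neg_mem (hp k)))
  have ha0 : ∀ k, ∀ᵐ x, 0 ≤ (a k).1 x := by
    intro k
    filter_upwards [PP_nonneg le_rfl (p k), PP_nonneg le_rfl (-(p k)), Lp.coeFn_add (PP 0 (p k)).1 (PP 0 (-(p k))).1] with x c d e
    rw [had, Prod.fst_add, e, Pi.add_apply]; linarith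
  have ha1 : ∀ k, ‖(a k).1‖ = 1 := by
    intro k
    have := PP_normsq_abs (p k)
    rw [hp1, one_pow] at this
    exact (pow_eq_one_iff_of_nonneg (norm_nonneg _) two_ne_zero).1 this.symm
  have hq : ∀ k, qf (lam1 Ω) (a k) ≤ 1 / ((k : ℝ) + 1) := by
    intro k
    have h1 := PP_gradsq_abs (p k)
    have h2 := hp2 k
    unfold qf; rw [ha1]; linarith
  have hcau : CauchySeq a := by
    rw [Metric.cauchySeq_iff']
    intro ε hε
    set σ := min 1 (ε ^ 2 / (12 * (1 + lam1 Ω))) with hσ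
    have hl0 := lam1_nonneg Ω
    have hσ0 : 0 < σ := by positivity
    have hσ1 : σ ≤ 1 := min_le_left _ _
    have hσ2 : σ * (12 * (1 + lam1 Ω)) ≤ ε ^ 2 := by
      rw [← le_div_iff₀ (by positivity)]; exact min_le_right _ _
    have hm : 0 < min (κ * σ ^ 2 / 4) (ε ^ 2 / 12) := by positivity
    obtain ⟨N, hN⟩ := (hlim0.eventually (gt_mem_nhds hm)).exists
    refine ⟨N, fun m hm' => ?_⟩
    have hNm : (1:ℝ) / ((m : ℝ) + 1) ≤ 1 / ((N : ℝ) + 1) := one_div_le_one_div_of_le (by positivity) (by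
      have : (N:ℝ) ≤ m := by exact_mod_cast hm'
      linarith)
    have hN1 := hN.trans_le (min_le_left _ _)
    have hN2 := hN.trans_le (min_le_right _ _)
    have hqm := (hq m).trans hNm
    have hqN := hq N
    obtain ⟨s, s0, s1, s2⟩ := E1 hfin hK (ha m) (ha N) (ha0 m) (ha0 N) (ha1 m) (ha1 N) hqm hqN
    have hsσ : s ≤ σ := by
      have : κ * s ^ 2 ≤ κ * σ ^ 2 := by linarith
      have := le_of_mul_le_mul_left this hκ
      exact (pow_le_pow_iff_left₀ s0 hσ0.le two_ne_zero).1 this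
    have hf1 : ‖(a m - a N).1‖ ^ 2 ≤ 3 * σ := by nlinarith
    have hpar := qf_par (lam1 Ω) (a m) (a N)
    have hpp := qf_nonneg ((VV Ω).add_mem (ha m) (ha N))
    have hf2 : ‖(a m - a N).2‖ ^ 2 ≤ 4 * (1 / ((N : ℝ) + 1)) + lam1 Ω * (3 * σ) := by
      have := mul_le_mul_of_nonneg_left hf1 hl0
      unfold qf at *; linarith
    have h1 : ‖(a m - a N).1‖ < ε := by
      rw [← pow_lt_pow_iff_left₀ (norm_nonneg _) hε.le two_ne_zero]
      nlinarith
    have h2 : ‖(a m - a N).2‖ < ε := by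
      rw [← pow_lt_pow_iff_left₀ (norm_nonneg _) hε.le two_ne_zero]
      nlinarith
    rw [dist_eq_norm, Prod.norm_def]
    exact max_lt h1 h2
  obtain ⟨u, hu⟩ := cauchySeq_tendsto_of_complete hcau
  have l1 := (continuous_fst.tendsto _).comp hu
  have l2 := (continuous_snd.tendsto _).comp hu
  have hmem : u ∈ VV Ω := (VV_closed Ω).mem_of_tendsto hu (Eventually.of_forall ha)
  have hn1 : ‖u.1‖ = 1 := tendsto_nhds_unique l1.norm (tendsto_const_nhds.congr fun k => (ha1 k).symm)
  refine ⟨u, hmem, ae_nonneg_lim l1 ha0, hn1, ?_⟩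
  refine le_antisymm ?_ (by have := lam1_le hmem; rw [hn1] at this; linarith)
  have := (hlim0.const_add (lam1 Ω))
  rw [add_zero] at this
  refine le_of_tendsto_of_tendsto' (l2.norm.pow 2) this fun k => ?_
  have := hq k
  unfold qf at this; rw [ha1] at this
  simp only [Function.comp]; linarith

theorem EF_weak {Ω : Set (Euc n)} {u : HH n} (hu : EF Ω u) {v : HH n} (hv : v ∈ VV Ω) :
    inner ℝ u.2 v.2 = lam1 Ω * inner ℝ u.1 v.1 := by
  set b : ℝ := inner ℝ u.2 v.2 - lam1 Ω * inner ℝ u.1 v.1 with hb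
  have key : ∀ t : ℝ, 0 ≤ 2 * t * b + t ^ 2 * qf (lam1 Ω) v := by
    intro t
    have h := qf_nonneg ((VV Ω).add_mem hu.1 ((VV Ω).smul_mem t hv))
    unfold qf at *
    rw [Prod.fst_add, Prod.snd_add, Prod.smul_fst, Prod.smul_snd, norm_add_sq_real, norm_add_sq_real,
      inner_smul_right, inner_smul_right, norm_smul, norm_smul, hu.2.2.1, hu.2.2.2, mul_pow, mul_pow,
      Real.norm_eq_abs, sq_abs] at h
    rw [hb]; linarith
  have hq := qf_nonneg hv
  have hb0 : b = 0 := by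
    by_contra hne
    have h1 := key (-b / (qf (lam1 Ω) v + 1))
    have e : 2 * (-b / (qf (lam1 Ω) v + 1)) * b + (-b / (qf (lam1 Ω) v + 1)) ^ 2 * qf (lam1 Ω) v =
      - (b ^ 2 * (qf (lam1 Ω) v + 2) / (qf (lam1 Ω) v + 1) ^ 2) := by field_simp; ring
    rw [e] at h1
    have : 0 < b ^ 2 * (qf (lam1 Ω) v + 2) / (qf (lam1 Ω) v + 1) ^ 2 := by positivity
    linarith
  linarith

theorem gap_aux {Ω : Set (Euc n)} (hfin : volume Ω ≠ ∞) {κ : ℝ} (hκ : 0 < κ) (hK : KK Ω κ)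
    {u : HH n} (hu : EF Ω u) {f : HH n} (hf : f ∈ VV Ω) (hf1 : ‖f.1‖ = 1) (ho : (inner ℝ f.1 u.1 : ℝ) = 0)
    (hq : qf (lam1 Ω) f ≤ κ / 64) (hh : 2 * volume.real {x | 0 < (-f).1 x} ≤ volume.real Ω) : False := by
  have h1 := KK_small hK ((VV Ω).neg_mem hf) hh
  rw [qf_neg] at h1
  set N := (PP 0 (-f)).1 with hN
  have hNs : ‖N‖ ≤ 1 / 8 := by
    rw [← pow_le_pow_iff_left₀ (norm_nonneg _) (by norm_num) two_ne_zero]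
    have : κ * ‖N‖ ^ 2 ≤ κ * (1 / 64) := by linarith
    have := le_of_mul_le_mul_left this hκ
    linarith
  set g := PP 0 f + PP 0 (-f) with hg
  have hgV : g ∈ VV Ω := (VV Ω).add_mem (PP_VV le_rfl hf) (PP_VV le_rfl ((VV Ω).neg_mem hf))
  have hg1 : ‖g.1‖ ^ 2 = 1 := by rw [hg, ← PP_normsq_abs f, hf1]; norm_num
  have hgq : qf (lam1 Ω) g ≤ κ / 64 := by
    have := PP_gradsq_abs f
    unfold qf at *; rw [hg1]; rw [hf1] at hq; linarith
  have hg0 : ∀ᵐ x, 0 ≤ g.1 x := by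
    filter_upwards [PP_nonneg le_rfl f, PP_nonneg le_rfl (-f), Lp.coeFn_add (PP 0 f).1 (PP 0 (-f)).1] with x c d e
    rw [hg, Prod.fst_add, e, Pi.add_apply]; linarith
  obtain ⟨s, s0, s1, s2⟩ := E1 hfin (ε := κ / 64) hK hgV hu.1 hg0 hu.2.1
    ((pow_eq_one_iff_of_nonneg (norm_nonneg _) two_ne_zero).1 hg1) hu.2.2.1 hgq
    (by unfold qf; rw [hu.2.2.1, hu.2.2.2]; linarith)
  have hs : s ≤ 1 / 4 := by
    rw [← pow_le_pow_iff_left₀ s0 (by norm_num) two_ne_zero]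
    have : κ * s ^ 2 ≤ κ * (1 / 16) := by linarith
    have := le_of_mul_le_mul_left this hκ
    linarith
  have hgu : ‖(g - u).1‖ ≤ 3 / 4 := by
    rw [← pow_le_pow_iff_left₀ (norm_nonneg _) (by norm_num) two_ne_zero]
    nlinarith
  have hdec : f.1 - u.1 = (g - u).1 - (2:ℝ) • N := by
    rw [Prod.fst_sub, hg, Prod.fst_add, hN]
    conv_lhs => rw [PP_decomp f]
    rw [two_smul]; abel
  have h2 : ‖f.1 - u.1‖ ^ 2 = 2 := by
    rw [norm_sub_sq_real, ho, hf1, hu.2.2.1]; norm_num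
  have h3 : ‖f.1 - u.1‖ ≤ 1 := by
    rw [hdec]
    refine (norm_sub_le _ _).trans ?_
    rw [norm_smul]
    rw [Real.norm_of_nonneg (by norm_num : (0:ℝ) ≤ 2)]; linarith
  nlinarith [norm_nonneg (f.1 - u.1)]

theorem gap {Ω : Set (Euc n)} (hfin : volume Ω ≠ ∞) {κ : ℝ} (hκ : 0 < κ) (hK : KK Ω κ)
    {u : HH n} (hu : EF Ω u) {f : HH n} (hf : f ∈ VV Ω) (ho : (inner ℝ f.1 u.1 : ℝ) = 0) :
    κ / 64 * ‖f.1‖ ^ 2 ≤ qf (lam1 Ω) f := by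
  by_contra hcon
  rw [not_le] at hcon
  have hf0 : ‖f.1‖ ≠ 0 := by
    intro h
    have := qf_nonneg hf
    rw [h] at hcon
    simp at hcon; linarith
  set g := ‖f.1‖⁻¹ • f with hg
  have hgV : g ∈ VV Ω := (VV Ω).smul_mem _ hf
  have hg1 : ‖g.1‖ = 1 := by rw [hg, Prod.smul_fst, norm_smul]; simp [hf0]
  have hgo : (inner ℝ g.1 u.1 : ℝ) = 0 := by rw [hg, Prod.smul_fst, inner_smul_left, ho]; simp
  have hgq : qf (lam1 Ω) g ≤ κ / 64 := by
    have e : qf (lam1 Ω) g = (‖f.1‖ ^ 2)⁻¹ * qf (lam1 Ω) f := by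
      unfold qf
      rw [hg, Prod.smul_fst, Prod.smul_snd, norm_smul, norm_smul, mul_pow, mul_pow]
      simp; ring
    rw [e, inv_mul_le_iff₀ (by positivity)]
    linarith
  rcases half_alt hfin hgV with h | h
  · refine gap_aux hfin hκ hK hu ((VV Ω).neg_mem hgV) (by rw [Prod.fst_neg, norm_neg, hg1])
      (by rw [Prod.fst_neg, inner_neg_left, hgo, neg_zero]) (by rwa [qf_neg]) (by rwa [neg_neg])
  · exact gap_aux hfin hκ hK hu hgV hg1 hgo hgq h

theorem EF_of_eig {Ω : Set (Euc n)} {u : Euc n → ℝ} (hu : IsEigenfun Ω u) :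
    ∃ p, EF Ω p ∧ p.1 =ᵐ[volume] u := by
  obtain ⟨h0, -, h1, Du, hm, h2⟩ := hu
  obtain ⟨p, hp, a, b⟩ := of_memH10 hm
  have e1 : ∫ x, u x ^ 2 = ‖p.1‖ ^ 2 := by
    rw [normsq_LL]; exact integral_congr_ae (a.mono fun x hx => by simp only [hx])
  have e2 : ∫ x, ‖Du x‖ ^ 2 = ‖p.2‖ ^ 2 := by
    rw [normsq_L2]; exact integral_congr_ae (b.mono fun x hx => by simp only [hx])
  refine ⟨p, ⟨hp, ?_, ?_, by rw [← e2, h2]⟩, a⟩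
  · filter_upwards [h0, a] with x c d
    rwa [d]
  · rw [e1] at h1
    exact (pow_eq_one_iff_of_nonneg (norm_nonneg _) two_ne_zero).1 h1

theorem eig_of_EF {Ω : Set (Euc n)} {p : HH n} (hp : EF Ω p) :
    IsEigenfun Ω (Ω.indicator p.1) ∧ p.1 =ᵐ[volume] Ω.indicator p.1 := by
  have e : p.1 =ᵐ[volume] Ω.indicator p.1 := by
    filter_upwards [VV_ae_zero hp.1] with x hx
    by_cases h : x ∈ Ω
    · rw [indicator_of_mem h]
    · rw [indicator_of_notMem h, hx h]
  refine ⟨⟨?_, fun x hx => indicator_of_notMem hx _, ?_, p.2, memH10_of hp.1 e ae_eq_rfl, ?_⟩, e⟩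
  · filter_upwards [hp.2.1, e] with x a b
    rwa [← b]
  · have : ∫ x, (Ω.indicator p.1 x) ^ 2 = ‖p.1‖ ^ 2 := by
      rw [normsq_LL]; exact integral_congr_ae (e.mono fun x hx => by simp only [← hx])
    rw [this, hp.2.2.1, one_pow]
  · rw [← normsq_L2, hp.2.2.2]

theorem UE_of_EF {Ω : Set (Euc n)} (hfin : volume Ω ≠ ∞) {κ : ℝ} (hκ : 0 < κ) (hK : KK Ω κ)
    {p : HH n} (hp : EF Ω p) : UniqueEigen Ω (Ω.indicator p.1) := by
  obtain ⟨h1, h2⟩ := eig_of_EF hp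
  refine ⟨h1, fun u' hu' => ?_⟩
  obtain ⟨q, hq, e⟩ := EF_of_eig hu'
  rw [EF_unique hfin hκ hK hq hp] at e
  exact e.symm.trans h2

end eig

section a7
variable {n : ℕ}

theorem PP_inner {k : ℝ} (z : HH n) : inner ℝ z.2 (PP k z).2 = ‖(PP k z).2‖ ^ 2 := by
  rw [inner_LV, normsq_L2]
  refine integral_congr_ae ?_
  filter_upwards [PP_snd k z] with x a
  rw [a]
  split_ifs
  · simp
  · simp

theorem dg_step {Ω : Set (Euc n)} {F : LL n} {z : HH n} (hz : WS Ω F z) {L : ℝ} (hL : 0 ≤ L)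
    (hF : ∀ᵐ x, 0 < z.1 x → F x ≤ L * z.1 x + L) {K k h s : ℝ} (hk1 : 1 ≤ k) (hkK : k ≤ K)
    (hh : 0 < h) (hs : 0 < s)
    (hS : 2 * ‖(PP k z).1‖ ^ 2 ≤ h ^ 2 * (s ^ n * volume.real (ball (0 : Euc n) 1))) :
    ‖(PP (k + h) z).1‖ ^ 2 ≤ 2 * s ^ 2 * (2 * L * (1 + K / h) * ‖(PP k z).1‖ ^ 2) := by
  have hk0 : 0 ≤ k := by linarith
  have hkh : 0 ≤ k + h := by linarith
  have hc := cheb (PP k z).1 hh (S := {x | k + h < z.1 x}) (by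
    filter_upwards [PP_fst hk0 z] with x a hx
    rw [a]
    refine le_trans ?_ (le_abs_self _)
    refine le_trans ?_ (le_max_left _ _)
    have : k + h < z.1 x := hx
    linarith)
  have hV : PP (k + h) z ∈ VV Ω := PP_VV hkh hz.1
  have h1 := FKr (VV_mono (subset_univ _) hV) hs (S := {x | k + h < z.1 x}) (by
    filter_upwards [PP_fst hkh z] with x a hx
    rw [a]
    have : ¬ k + h < z.1 x := hx
    exact max_eq_right (by linarith)) hc.1 (by
      have h2 : 0 < h ^ 2 := by positivity
      have := hc.2
      nlinarith)
  refine h1.trans ?_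
  refine mul_le_mul_of_nonneg_left ?_ (by positivity)
  rw [← PP_inner, hz.2 _ hV, inner_LL, normsq_LL, ← integral_const_mul]
  refine integral_mono_ae (integrable_mul_LL _ _) ?_ ?_
  · have := (integrable_sq_L2 (PP k z).1).const_mul (2 * L * (1 + K / h))
    refine this.congr (Eventually.of_forall fun x => ?_)
    simp
  · filter_upwards [PP_fst hk0 z, PP_fst hkh z, hF] with x a b c
    rw [a, b]
    rcases le_or_gt (z.1 x) (k + h) with hx | hx
    · rw [max_eq_right (show z.1 x - (k + h) ≤ 0 by linarith), mul_zero]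
      have : 0 ≤ K / h := div_nonneg (by linarith) hh.le
      positivity
    · rw [max_eq_left (show 0 ≤ z.1 x - (k + h) by linarith), max_eq_left (show 0 ≤ z.1 x - k by linarith)]
      have c' := c (by linarith)
      have e1 : K ≤ K / h * (z.1 x - k) := by
        rw [div_mul_eq_mul_div, le_div_iff₀ hh]
        exact mul_le_mul_of_nonneg_left (by linarith) (by linarith)
      have e2 : F x ≤ 2 * L * (1 + K / h) * (z.1 x - k) := by
        have : z.1 x ≤ (1 + K / h) * (z.1 x - k) := by linarith
        have := mul_le_mul_of_nonneg_left this hL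
        nlinarith
      calc F x * (z.1 x - (k + h)) ≤ (2 * L * (1 + K / h) * (z.1 x - k)) * (z.1 x - (k + h)) :=
            mul_le_mul_of_nonneg_right e2 (by linarith)
        _ ≤ (2 * L * (1 + K / h) * (z.1 x - k)) * (z.1 x - k) := by
            refine mul_le_mul_of_nonneg_left (by linarith) ?_
            have : 0 ≤ K / h := div_nonneg (by linarith) hh.le
            have : 0 ≤ z.1 x - k := by linarith
            positivity
        _ = _ := by ring

theorem PP_norm_mono {k k' : ℝ} (hk : 0 ≤ k) (h : k ≤ k') (z : HH n) :
    ‖(PP k' z).1‖ ^ 2 ≤ ‖(PP k z).1‖ ^ 2 := by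
  rw [normsq_L2, normsq_L2]
  refine integral_mono_ae (integrable_sq_L2 _) (integrable_sq_L2 _) ?_
  filter_upwards [PP_fst hk z, PP_fst (hk.trans h) z] with x a b
  rw [a, b, Real.norm_of_nonneg (le_max_right _ _), Real.norm_of_nonneg (le_max_right _ _)]
  refine pow_le_pow_left₀ (le_max_right _ _) (max_le_max (by linarith) le_rfl) 2

theorem PP0_norm_le (z : HH n) : ‖(PP 0 z).1‖ ^ 2 ≤ ‖z.1‖ ^ 2 := by
  rw [PP_normsq z]; nlinarith [sq_nonneg ‖(PP 0 (-z)).1‖]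

theorem Linf (n : ℕ) {L U0 : ℝ} (hL : 0 ≤ L) (hU : 0 ≤ U0) : ∃ N : ℝ, 1 ≤ N ∧
    ∀ (Ω : Set (Euc n)) (F : LL n) (z : HH n), WS Ω F z →
      (∀ᵐ x, 0 < z.1 x → F x ≤ L * z.1 x + L) → ‖z.1‖ ^ 2 ≤ U0 → ∀ᵐ x, z.1 x ≤ N := by
  set ω := volume.real (ball (0 : Euc n) 1) with hω
  have hω0 : 0 < ω := om_pos
  set q : ℝ := (1 / 2) ^ n with hq
  have hq0 : 0 < q := by positivity
  obtain ⟨ρ, hρ, hρL⟩ : ∃ ρ : ℝ, 0 < ρ ∧ 32 * L * ρ ^ 2 ≤ q / 4 := by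
    refine ⟨min 1 (q / 4 / (32 * L + 1)), by positivity, ?_⟩
    set ρ := min 1 (q / 4 / (32 * L + 1)) with hρ
    have h1 : ρ ≤ 1 := min_le_left _ _
    have h0 : 0 ≤ ρ := by positivity
    have h2 : ρ * (32 * L + 1) ≤ q / 4 := by
      rw [← le_div_iff₀ (by positivity)]; exact min_le_right _ _
    nlinarith [mul_nonneg hL h0]
  obtain ⟨M, hM1, hM⟩ : ∃ M : ℝ, 1 ≤ M ∧ 8 * U0 ≤ M ^ 2 * (ρ ^ n * ω) := by
    refine ⟨1 + 8 * U0 / (ρ ^ n * ω), by have : 0 ≤ 8 * U0 / (ρ ^ n * ω) := by positivity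
                                         linarith, ?_⟩
    have hp : 0 < ρ ^ n * ω := by positivity
    set t := 8 * U0 / (ρ ^ n * ω) with ht
    have h0 : 0 ≤ t := by positivity
    have : 8 * U0 = t * (ρ ^ n * ω) := by rw [ht]; field_simp
    rw [this]
    refine mul_le_mul_of_nonneg_right ?_ hp.le
    nlinarith
  refine ⟨2 * M, by linarith, fun Ω F z hz hF hzU => ?_⟩
  set d := q / 4 with hd
  have hd0 : 0 < d := by positivity
  have hd1 : d < 1 := by
    have : q ≤ 1 := pow_le_one₀ (by norm_num) (by norm_num)
    linarith
  have key : ∀ j : ℕ, ‖(PP (M * (2 - (1/2) ^ j)) z).1‖ ^ 2 ≤ U0 * d ^ j := by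
    intro j
    induction j with
    | zero =>
      simp only [pow_zero, mul_one]
      refine (PP_norm_mono le_rfl ?_ z).trans ((PP0_norm_le z).trans hzU)
      nlinarith
    | succ j ih =>
      have hj1 : ((1:ℝ)/2) ^ j ≤ 1 := pow_le_one₀ (by norm_num) (by norm_num)
      have hj0 : 0 < ((1:ℝ)/2) ^ j := by positivity
      have hst := dg_step hz hL hF (K := 2 * M) (k := M * (2 - (1/2) ^ j)) (h := M * (1/2) ^ (j+1))
        (s := ρ * (1/2) ^ j) (by nlinarith) (by nlinarith) (by positivity) (by positivity) (by
          calc 2 * ‖(PP (M * (2 - (1/2) ^ j)) z).1‖ ^ 2 ≤ 2 * (U0 * d ^ j) := by linarith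
            _ = (8 * U0) * (d ^ j / 4) := by ring
            _ ≤ (M ^ 2 * (ρ ^ n * ω)) * (d ^ j / 4) := mul_le_mul_of_nonneg_right hM (by positivity)
            _ = _ := by
              rw [hd, hq, div_pow, ← pow_mul, mul_pow, mul_pow, ← pow_mul, ← pow_mul, mul_comm n j,
                show (4:ℝ) ^ j = 2 ^ (j * 2) by rw [mul_comm, pow_mul]; norm_num]
              rw [show (j + 1) * 2 = j * 2 + 2 by ring, pow_add, one_div, inv_pow, inv_pow, inv_pow]
              rw [← hω]
              field_simp
              norm_num)
      have he : M * (2 - (1/2) ^ j) + M * (1/2) ^ (j+1) = M * (2 - (1/2:ℝ) ^ (j+1)) := by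
        rw [pow_succ]; ring
      rw [he] at hst
      refine hst.trans ?_
      have e2 : 2 * M / (M * (1/2) ^ (j+1)) = 4 * 2 ^ j := by
        rw [pow_succ, one_div, inv_pow]; field_simp; norm_num
      rw [e2]
      have e3 : (1/2:ℝ) ^ j * 2 ^ j = 1 := by rw [← mul_pow]; norm_num
      have p1 : (1:ℝ) ≤ 2 ^ j := one_le_pow₀ (by norm_num)
      have e4 : 2 * (ρ * (1/2) ^ j) ^ 2 * (2 * L * (1 + 4 * 2 ^ j)) ≤ d := by
        refine le_trans ?_ hρL
        have : ((1/2:ℝ) ^ j) ^ 2 * (1 + 4 * 2 ^ j) ≤ 8 := by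
          have : ((1/2:ℝ) ^ j) ^ 2 * (1 + 4 * 2 ^ j) = ((1/2:ℝ) ^ j) ^ 2 + 4 * (1/2) ^ j * ((1/2) ^ j * 2 ^ j) := by ring
          rw [this, e3]; nlinarith
        have := mul_le_mul_of_nonneg_left this (show 0 ≤ 4 * L * ρ ^ 2 by positivity)
        nlinarith
      calc _ = (2 * (ρ * (1/2) ^ j) ^ 2 * (2 * L * (1 + 4 * 2 ^ j))) * ‖(PP (M * (2 - (1/2) ^ j)) z).1‖ ^ 2 := by ring
        _ ≤ d * (U0 * d ^ j) := by gcongr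
        _ = _ := by ring
  have hM0 : 0 ≤ 2 * M := by linarith
  have hz0 : ‖(PP (2 * M) z).1‖ ^ 2 ≤ 0 := by
    have hlim : Tendsto (fun j : ℕ => U0 * d ^ j) atTop (𝓝 (U0 * 0)) :=
      (tendsto_pow_atTop_nhds_zero_of_lt_one hd0.le hd1).const_mul _
    rw [mul_zero] at hlim
    refine ge_of_tendsto' hlim fun j => (PP_norm_mono ?_ ?_ z).trans (key j)
    · have hj1 : ((1:ℝ)/2) ^ j ≤ 1 := pow_le_one₀ (by norm_num) (by norm_num)
      nlinarith
    · have hj0 : 0 < ((1:ℝ)/2) ^ j := by positivity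
      nlinarith
  have hz1 : (PP (2 * M) z).1 = 0 := by
    rw [← norm_eq_zero]; nlinarith [norm_nonneg (PP (2 * M) z).1]
  have hz2 : (PP (2 * M) z).1 =ᵐ[volume] (0 : Euc n → ℝ) := by rw [hz1]; exact Lp.coeFn_zero _ _ _
  filter_upwards [PP_fst hM0 z, hz2] with x a b
  rw [a] at b
  have := le_max_left (z.1 x - 2 * M) 0
  have : max (z.1 x - 2 * M) 0 = 0 := b
  linarith

/-- comparison: nonnegativity -/
theorem WS_nonneg (hn : 1 ≤ n) {R : ℝ} (hR : 0 < R) {Ω : Set (Euc n)} (hΩ : Ω ⊆ ball 0 R)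
    {G : LL n} (hG : ∀ᵐ x, 0 ≤ G x) {y : HH n} (hy : WS Ω G y) : ∀ᵐ x, 0 ≤ y.1 x := by
  have hm : PP 0 (-y) ∈ VV Ω := PP_VV le_rfl ((VV Ω).neg_mem hy.1)
  have h1 := PP_inner (k := 0) (-y)
  have h2 := hy.2 _ hm
  have h3 := inner_nonneg_LL hG (PP_nonneg le_rfl (-y))
  rw [Prod.snd_neg, inner_neg_left, h2] at h1
  have h4 : ‖(PP 0 (-y)).2‖ ^ 2 ≤ 0 := by linarith
  have h5 := poinc hn hR hΩ hm
  have h6 : (PP 0 (-y)).1 = 0 := by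
    rw [← norm_eq_zero]
    have : 0 ≤ 8 * R ^ 2 := by positivity
    nlinarith [norm_nonneg (PP 0 (-y)).1]
  have h7 : (PP 0 (-y)).1 =ᵐ[volume] (0 : Euc n → ℝ) := by rw [h6]; exact Lp.coeFn_zero _ _ _
  filter_upwards [PPn_fst y, h7] with x a b
  rw [a] at b
  have := le_max_left (- y.1 x) 0
  have : max (- y.1 x) 0 = 0 := b
  linarith

theorem inner_PP_snd_le {a b c : HH n} (hc : c = a - PP 0 b) 
    (hb2 : (PP 0 b).2 = b.2) : inner ℝ (a.2 - b.2) (PP 0 c).2 = ‖(PP 0 c).2‖ ^ 2 := by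
  rw [← PP_inner, hc, Prod.snd_sub, hb2]

theorem WS_comp (hn : 1 ≤ n) {R : ℝ} (hR : 0 < R) {Ω Ω' : Set (Euc n)} (hΩ : Ω ⊆ ball 0 R)
    (hs : Ω' ⊆ Ω) {G : LL n} (hG : ∀ᵐ x, 0 ≤ G x) {y y' : HH n} (hy : WS Ω G y) (hy' : WS Ω' G y') :
    ∀ᵐ x, y'.1 x ≤ y.1 x := by
  have hy0 := WS_nonneg hn hR hΩ hG hy
  have hPV : PP 0 y ∈ VV Ω := PP_VV le_rfl hy.1
  have e1 : (PP 0 y).1 = y.1 := by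
    apply Lp.ext
    filter_upwards [PP0_fst y, hy0] with x a b
    rw [a, max_eq_left b]
  have e2 : (PP 0 y).2 = y.2 := by
    have h1 := hy.2 _ hPV
    have h2 := hy.2 _ hy.1
    rw [e1] at h1
    have h3 := PP_inner (k := 0) y
    have h4 : ‖(PP 0 y).2 - y.2‖ ^ 2 = 0 := by
      rw [norm_sub_sq_real, ← h3, real_inner_comm y.2, h1, ← h2, real_inner_self_eq_norm_sq]; ring
    exact sub_eq_zero.1 (norm_eq_zero.1 (pow_eq_zero_iff (two_ne_zero) |>.1 h4))
  set d := PP 0 (y' - PP 0 y) with hd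
  have hdV : d ∈ VV Ω' := PP_sub_VV hy'.1 hy.1
  have h1 := inner_PP_snd_le (a := y') (b := y) rfl e2
  rw [inner_sub_left] at h1
  have h2 := hy'.2 _ hdV
  have h3 := hy.2 _ (VV_mono hs hdV)
  have h4 : ‖d.2‖ ^ 2 = 0 := by rw [← h1, h2, h3, sub_self]
  have h5 := poinc hn hR (hs.trans hΩ) hdV
  have h6 : d.1 = 0 := by
    rw [← norm_eq_zero]
    rw [h4, mul_zero] at h5
    nlinarith [norm_nonneg d.1]
  have h7 : d.1 =ᵐ[volume] (0 : Euc n → ℝ) := by rw [h6]; exact Lp.coeFn_zero _ _ _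
  have e3 : (y' - PP 0 y).1 = y'.1 - y.1 := by rw [Prod.fst_sub, e1]
  have e4 := PP0_fst (y' - PP 0 y)
  rw [e3] at e4
  filter_upwards [e4, h7, Lp.coeFn_sub y'.1 y.1] with x a b c
  have b' : (PP 0 (y' - PP 0 y)).1 x = 0 := b
  rw [a, c] at b'
  have := le_max_left (y'.1 x - y.1 x) 0
  have h : max (y'.1 x - y.1 x) 0 = 0 := b'
  linarith
end a7

section a8
variable {n : ℕ}

theorem EF_WS {Ω : Set (Euc n)} {u : HH n} (hu : EF Ω u) : WS Ω (lam1 Ω • u.1) u := by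
  refine ⟨hu.1, fun q hq => ?_⟩
  rw [EF_weak hu hq, inner_smul_left]; simp

theorem EF_bdd (n : ℕ) {Λ : ℝ} (hΛ : 0 ≤ Λ) : ∃ N : ℝ, 1 ≤ N ∧ ∀ (Ω : Set (Euc n)) (u : HH n),
    EF Ω u → lam1 Ω ≤ Λ → ∀ᵐ x, u.1 x ≤ N := by
  obtain ⟨N, h1, hN⟩ := Linf n hΛ (zero_le_one)
  refine ⟨N, h1, fun Ω u hu hl => hN Ω _ u (EF_WS hu) ?_ (by rw [hu.2.2.1]; norm_num)⟩
  filter_upwards [Lp.coeFn_smul (lam1 Ω) u.1] with x a h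
  rw [a, Pi.smul_apply, smul_eq_mul]
  nlinarith [mul_le_mul_of_nonneg_right hl h.le]

theorem exists_sign {R : ℝ} (f : LL n) : ∃ ψ : LL n, (∀ᵐ x, |ψ x| ≤ EE n R x) ∧
    ∀ᵐ x, x ∈ ball (0 : Euc n) R → ψ x * f x = |f x| := by
  set g : Euc n → ℝ := (ball (0 : Euc n) R).indicator fun x => if 0 ≤ f x then (1:ℝ) else -1 with hg
  have hm : Measurable (f : Euc n → ℝ) := (Lp.stronglyMeasurable f).measurable
  have hgm : Measurable g := (Measurable.ite (measurableSet_le measurable_const hm) measurable_const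
    measurable_const).indicator measurableSet_ball
  have hb : ∀ x, |g x| ≤ (ball (0 : Euc n) R).indicator (fun _ => (1:ℝ)) x := by
    intro x
    by_cases hx : x ∈ ball (0 : Euc n) R
    · rw [hg, indicator_of_mem hx, indicator_of_mem hx]; split_ifs <;> simp
    · rw [hg, indicator_of_notMem hx, indicator_of_notMem hx]; simp
  have hL : MemLp g 2 volume := by
    refine (Lp.memLp (EE n R)).mono hgm.aestronglyMeasurable ?_
    filter_upwards [EE_ae (n := n) R] with x a
    rw [a, Real.norm_eq_abs, Real.norm_eq_abs]
    exact (hb x).trans (le_abs_self _)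
  refine ⟨mkL g, ?_, ?_⟩
  · filter_upwards [mkL_ae hL, EE_ae (n := n) R] with x a b
    rw [a, b]; exact hb x
  · filter_upwards [mkL_ae hL] with x a hx
    rw [a, hg, indicator_of_mem hx]
    split_ifs with h
    · rw [one_mul, abs_of_nonneg h]
    · rw [abs_of_neg (not_le.1 h)]; ring

theorem norm_le_of_abs {f g : LL n} (h : ∀ᵐ x, |f x| ≤ g x) : ‖f‖ ≤ ‖g‖ := by
  refine Lp.norm_le_norm_of_ae_le ?_
  filter_upwards [h] with x a
  rw [Real.norm_eq_abs, Real.norm_eq_abs]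
  exact a.trans (le_abs_self _)

/-- solving on the orthogonal complement of the eigenfunction -/
theorem solve_perp {Ω : Set (Euc n)} (hfin : volume Ω ≠ ∞) {κ : ℝ} (hκ : 0 < κ) (hK : KK Ω κ)
    {u : HH n} (hu : EF Ω u) (ψ : LL n) : ∃ z : HH n,
      WS Ω (lam1 Ω • z.1 + (ψ - (inner ℝ ψ u.1 : ℝ) • u.1)) z ∧ κ / 64 * ‖z.1‖ ≤ ‖ψ‖ := by
  let ℓ : HH n →L[ℝ] ℝ := (innerSL ℝ u.1).comp (ContinuousLinearMap.fst ℝ (LL n) (LV n))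
  have hℓ : ∀ p : HH n, ℓ p = inner ℝ u.1 p.1 := fun p => rfl
  let W : Submodule ℝ (HH n) := VV Ω ⊓ LinearMap.ker (ℓ : HH n →ₗ[ℝ] ℝ)
  have hWm : ∀ p, p ∈ W ↔ p ∈ VV Ω ∧ (inner ℝ u.1 p.1 : ℝ) = 0 := fun p => Iff.rfl
  have hWc : IsClosed (W : Set (HH n)) := by
    have : (W : Set (HH n)) = (VV Ω : Set (HH n)) ∩ ℓ ⁻¹' {0} := by
      ext p; exact hWm p
    rw [this]
    exact (VV_closed Ω).inter (isClosed_singleton.preimage ℓ.continuous)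
  have hc : ∀ p ∈ W, κ / 64 * ‖p.1‖ ^ 2 ≤ ‖p.2‖ ^ 2 - lam1 Ω * ‖p.1‖ ^ 2 := by
    intro p hp
    exact gap hfin hκ hK hu ((hWm p).1 hp).1 (by rw [real_inner_comm]; exact ((hWm p).1 hp).2)
  obtain ⟨z, hz, hzq⟩ := solve W hWc (lam1_nonneg Ω) (by positivity : 0 < κ / 64) hc
    (ψ - (inner ℝ ψ u.1 : ℝ) • u.1)
  have hz' := (hWm z).1 hz
  have hu1 : (inner ℝ u.1 u.1 : ℝ) = 1 := by rw [real_inner_self_eq_norm_sq, hu.2.2.1]; norm_num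
  refine ⟨z, ⟨hz'.1, fun q hq => ?_⟩, ?_⟩
  · set t : ℝ := inner ℝ u.1 q.1 with ht
    have hq0 : q - t • u ∈ W := by
      rw [hWm]
      refine ⟨(VV Ω).sub_mem hq ((VV Ω).smul_mem _ hu.1), ?_⟩
      rw [Prod.fst_sub, Prod.smul_fst, inner_sub_right, inner_smul_right, hu1, ht]; ring
    have e := hzq _ hq0
    have e2 := EF_weak hu hz'.1
    rw [hz'.2, mul_zero] at e2
    have e3 : (inner ℝ z.2 u.2 : ℝ) = 0 := by rw [real_inner_comm]; exact e2
    have e4 : (inner ℝ z.1 u.1 : ℝ) = 0 := by rw [real_inner_comm]; exact hz'.2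
    rw [Prod.fst_sub, Prod.snd_sub, Prod.smul_fst, Prod.smul_snd] at e
    simp only [inner_sub_right, inner_sub_left, inner_smul_left, inner_smul_right, e3, e4, hu1] at e
    simp only [inner_add_left, inner_sub_left, inner_smul_left]
    simp at e ⊢
    linarith
  · have e := hzq _ hz
    have e1 := hc z hz
    rw [real_inner_self_eq_norm_sq, real_inner_self_eq_norm_sq, inner_sub_left, inner_smul_left, hz'.2,
      mul_zero, sub_zero] at e
    have e2 : (inner ℝ ψ z.1 : ℝ) ≤ ‖ψ‖ * ‖z.1‖ := real_inner_le_norm _ _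
    rcases (norm_nonneg z.1).eq_or_lt with h | h
    · rw [← h, mul_zero]; exact norm_nonneg _
    · refine le_of_mul_le_mul_right ?_ h
      nlinarith

theorem overlap {Ω Ω' : Set (Euc n)} (hs : Ω' ⊆ Ω) (hfin : volume Ω ≠ ∞) {κ : ℝ} (hκ : 0 < κ) (hK : KK Ω κ)
    {u u' : HH n} (hu : EF Ω u) (hu' : EF Ω' u') :
    0 ≤ 1 - (inner ℝ u.1 u'.1 : ℝ) ∧ κ / 64 * (1 - (inner ℝ u.1 u'.1 : ℝ)) ≤ lam1 Ω' - lam1 Ω := by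
  set b : ℝ := inner ℝ u.1 u'.1 with hb
  have hV := VV_mono hs hu'.1
  have hu1 : (inner ℝ u.1 u.1 : ℝ) = 1 := by rw [real_inner_self_eq_norm_sq, hu.2.2.1]; norm_num
  have hf : u' - b • u ∈ VV Ω := (VV Ω).sub_mem hV ((VV Ω).smul_mem _ hu.1)
  have g := gap hfin hκ hK hu hf (by
    rw [Prod.fst_sub, Prod.smul_fst, inner_sub_left, inner_smul_left, hu1, hb, real_inner_comm]; simp)
  have hw := EF_weak hu hV
  rw [← hb] at hw
  have n1 : ‖(u' - b • u).1‖ ^ 2 = 1 - b ^ 2 := by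
    rw [Prod.fst_sub, Prod.smul_fst, norm_sub_sq_real, inner_smul_right, real_inner_comm, ← hb, norm_smul,
      mul_pow, hu.2.2.1, hu'.2.2.1, Real.norm_eq_abs, sq_abs]; ring
  have n2 : ‖(u' - b • u).2‖ ^ 2 = lam1 Ω' - b ^ 2 * lam1 Ω := by
    rw [Prod.snd_sub, Prod.smul_snd, norm_sub_sq_real, inner_smul_right, real_inner_comm, hw, norm_smul,
      mul_pow, hu.2.2.2, hu'.2.2.2, Real.norm_eq_abs, sq_abs]; ring
  rw [qf, n1, n2] at g
  have hb0 : 0 ≤ b := inner_nonneg_LL hu.2.1 hu'.2.1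
  have hb1 : b ≤ 1 := by
    have := real_inner_le_norm u.1 u'.1
    rwa [hu.2.2.1, hu'.2.2.1, mul_one] at this
  refine ⟨by linarith, ?_⟩
  have : κ / 64 * (1 - b) ≤ κ / 64 * (1 - b ^ 2) := by
    refine mul_le_mul_of_nonneg_left ?_ (by positivity)
    nlinarith
  linarith

theorem WS_lin {Ω : Set (Euc n)} {F G : LL n} {p q : HH n} (hp : WS Ω F p) (hq : WS Ω G q) (s t : ℝ) :
    WS Ω (s • F + t • G) (s • p + t • q) := by
  refine ⟨(VV Ω).add_mem ((VV Ω).smul_mem _ hp.1) ((VV Ω).smul_mem _ hq.1), fun r hr => ?_⟩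
  rw [Prod.snd_add, Prod.smul_snd, Prod.smul_snd, inner_add_left, inner_add_left, inner_smul_left,
    inner_smul_left, inner_smul_left, inner_smul_left, hp.2 r hr, hq.2 r hr]

theorem WS_lin_ae (f g : LL n) (s t : ℝ) : ∀ᵐ x, (s • f + t • g : LL n) x = s * f x + t * g x := by
  filter_upwards [Lp.coeFn_add (s • f) (t • g), Lp.coeFn_smul s f, Lp.coeFn_smul t g] with x a b c
  rw [a, Pi.add_apply, b, c]; rfl

set_option maxHeartbeats 1000000 in
theorem L1bound (hn : 1 ≤ n) {R Λ κ : ℝ} (hR : 0 < R) (hΛ : 0 ≤ Λ) (hκ : 0 < κ) :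
    ∃ C : ℝ, 0 < C ∧ ∀ Ω Ω' : Set (Euc n), Ω' ⊆ Ω → Ω ⊆ ball 0 R → KK Ω κ → lam1 Ω ≤ Λ → lam1 Ω' ≤ Λ →
      ∀ u u' : HH n, EF Ω u → EF Ω' u' →
      ∫ x, |u.1 x - u'.1 x| ≤ C * ((lam1 Ω' - lam1 Ω) + (tor Ω' - tor Ω)) := by
  set E := ‖EE n R‖ with hE
  have hE0 : 0 ≤ E := norm_nonneg _
  set γ := κ / 64 with hγ
  have hγ0 : 0 < γ := by positivity
  obtain ⟨N1, hN11, hN1⟩ := EF_bdd n hΛ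
  set L2 := Λ + (1 + E * N1) with hL2
  have hL20 : 0 ≤ L2 := by positivity
  obtain ⟨N2, hN21, hN2⟩ := Linf n hL20 (show 0 ≤ (E / γ) ^ 2 by positivity)
  set N := Λ * N2 + (1 + E * N1) with hN
  have hN0 : 0 ≤ N := by positivity
  refine ⟨2 * E / γ + 2 * Λ * (N * N1) + 1, by positivity, fun Ω Ω' hs hΩ hK hl hl' u u' hu hu' => ?_⟩
  have hfin : volume Ω ≠ ∞ := ((measure_mono hΩ).trans_lt measure_ball_lt_top).ne
  obtain ⟨ψ, hψ1, hψ2⟩ := exists_sign (R := R) (u.1 - u'.1)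
  have hψE : ‖ψ‖ ≤ E := norm_le_of_abs hψ1
  obtain ⟨z, hz, hzn⟩ := solve_perp hfin hκ hK hu ψ
  set a : ℝ := inner ℝ ψ u.1 with ha
  have haE : |a| ≤ E := by
    have := abs_real_inner_le_norm ψ u.1
    rw [hu.2.2.1, mul_one] at this
    exact this.trans hψE
  set ψp : LL n := ψ - a • u.1 with hψp
  set F : LL n := lam1 Ω • z.1 + ψp with hF
  have hzn' : ‖z.1‖ ≤ E / γ := by
    rw [le_div_iff₀ hγ0, mul_comm]; exact hzn.trans hψE
  have hu0 := hu.2.1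
  have huN := hN1 Ω u hu hl
  have hu'N := hN1 Ω' u' hu' hl'
  have hF_ae : ∀ᵐ x, F x = lam1 Ω * z.1 x + (ψ x - a * u.1 x) := by
    filter_upwards [Lp.coeFn_add (lam1 Ω • z.1) ψp, Lp.coeFn_smul (lam1 Ω) z.1, Lp.coeFn_sub ψ (a • u.1),
      Lp.coeFn_smul a u.1] with x b c d e
    rw [hF, b, Pi.add_apply, c, d, Pi.sub_apply, e]; rfl
  have hE01 : ∀ᵐ x, EE n R x = 0 ∨ EE n R x = 1 := by
    filter_upwards [EE_ae (n := n) R] with x b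
    rw [b]; by_cases hx : x ∈ ball (0 : Euc n) R
    · right; rw [indicator_of_mem hx]
    · left; rw [indicator_of_notMem hx]
  have hψu : ∀ᵐ x, |ψ x - a * u.1 x| ≤ 1 + E * N1 := by
    filter_upwards [hψ1, hE01, hu0, huN] with x b c d e
    have h1 : |ψ x| ≤ 1 := by rcases c with c | c <;> linarith
    have h2 : |a * u.1 x| ≤ E * N1 := by
      rw [abs_mul, abs_of_nonneg d]; exact mul_le_mul haE e d hE0
    exact (abs_sub _ _).trans (add_le_add h1 h2)
  have hl0 := lam1_nonneg Ω
  have hzN : ∀ᵐ x, z.1 x ≤ N2 := by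
    refine hN2 Ω F z hz ?_ (by gcongr)
    filter_upwards [hF_ae, hψu] with x b c hx
    rw [b]
    have := (abs_le.1 c).2
    have := mul_le_mul_of_nonneg_right hl hx.le
    have : 0 ≤ (1 + E * N1) * z.1 x := by positivity
    have e : L2 * z.1 x = Λ * z.1 x + (1 + E * N1) * z.1 x := by rw [hL2]; ring
    rw [e]; linarith
  have hnegz : WS Ω (-F) (-z) := by
    have := WS_lin hz hz (-1) 0
    simpa using this
  have hzN' : ∀ᵐ x, - z.1 x ≤ N2 := by
    have := hN2 Ω (-F) (-z) hnegz ?_ (by rw [Prod.fst_neg, norm_neg]; gcongr)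
    · filter_upwards [this, Lp.coeFn_neg z.1] with x b c
      rw [Prod.fst_neg, c, Pi.neg_apply] at b; exact b
    · filter_upwards [hF_ae, hψu, Lp.coeFn_neg z.1, Lp.coeFn_neg F] with x b c d e hx
      rw [Prod.fst_neg, d, Pi.neg_apply] at hx
      rw [Prod.fst_neg, d, e, Pi.neg_apply, Pi.neg_apply, b]
      have := (abs_le.1 c).1
      have := mul_le_mul_of_nonneg_right hl hx.le
      have : 0 ≤ (1 + E * N1) * - z.1 x := by positivity
      have e : L2 * - z.1 x = Λ * - z.1 x + (1 + E * N1) * - z.1 x := by rw [hL2]; ring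
      rw [e]; linarith
  have hFN : ∀ᵐ x, |F x| ≤ N * EE n R x := by
    filter_upwards [hF_ae, hψu, hzN, hzN', EE_ae (n := n) R, VV_zero_ball hΩ hz.1, VV_zero_ball hΩ hu.1,
      hψ1] with x b c d e f g h i
    by_cases hx : x ∈ ball (0 : Euc n) R
    · rw [f, indicator_of_mem hx, b, mul_one]
      refine (abs_add_le _ _).trans (add_le_add ?_ c)
      rw [abs_mul, abs_of_nonneg hl0]
      exact mul_le_mul hl (abs_le.2 ⟨by linarith, d⟩) (abs_nonneg _) hΛ
    · rw [f, indicator_of_notMem hx] at i ⊢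
      rw [b, g hx, h hx, abs_eq_zero.1 (le_antisymm i (abs_nonneg _))]; simp
  obtain ⟨w, hw⟩ := WS_exists hn hR hΩ (EE n R)
  obtain ⟨w', hw'⟩ := WS_exists hn hR (hs.trans hΩ) (EE n R)
  obtain ⟨z', hz'⟩ := WS_exists hn hR (hs.trans hΩ) F
  have c1 := WS_comp hn hR hΩ hs (G := N • EE n R + (1:ℝ) • F) (by
    filter_upwards [WS_lin_ae (EE n R) F N 1, hFN] with x b c
    rw [b]; linarith [(abs_le.1 c).1]) (WS_lin hw hz N 1) (WS_lin hw' hz' N 1)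
  have c2 := WS_comp hn hR hΩ hs (G := N • EE n R + (-1:ℝ) • F) (by
    filter_upwards [WS_lin_ae (EE n R) F N (-1), hFN] with x b c
    rw [b]; linarith [(abs_le.1 c).2]) (WS_lin hw hz N (-1)) (WS_lin hw' hz' N (-1))
  have c3 := WS_comp hn hR hΩ hs (G := EE n R) (by
    filter_upwards [hE01] with x b
    rcases b with b | b <;> rw [b]; norm_num) hw hw'
  have hzz : ∀ᵐ x, |z.1 x - z'.1 x| ≤ N * (w.1 x - w'.1 x) := by
    filter_upwards [c1, c2, WS_lin_ae w.1 z.1 N 1, WS_lin_ae w'.1 z'.1 N 1, WS_lin_ae w.1 z.1 N (-1),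
      WS_lin_ae w'.1 z'.1 N (-1)] with x b c d e f g
    have b' : (N • w'.1 + (1:ℝ) • z'.1) x ≤ (N • w.1 + (1:ℝ) • z.1) x := b
    have c' : (N • w'.1 + (-1:ℝ) • z'.1) x ≤ (N • w.1 + (-1:ℝ) • z.1) x := c
    rw [d, e] at b'
    rw [f, g] at c'
    rw [abs_le]; constructor <;> linarith
  have hDt : (inner ℝ (EE n R) (w.1 - w'.1) : ℝ) = 2 * (tor Ω' - tor Ω) := by
    rw [inner_sub_right, tor_WS hn hR hΩ hw, tor_WS hn hR (hs.trans hΩ) hw']; ring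
  have hV := VV_mono hs hu'.1
  -- identity
  have i1 := hz.2 _ hV
  have i2 := hz'.2 _ hu'.1
  have i3 := EF_weak hu' hz'.1
  have i4 : (inner ℝ F u'.1 : ℝ) = lam1 Ω * inner ℝ z.1 u'.1 + inner ℝ ψp u'.1 := by
    rw [hF, inner_add_left, inner_smul_left]; simp
  have i5 : (inner ℝ ψp u'.1 : ℝ) = (lam1 Ω' - lam1 Ω) * inner ℝ z.1 u'.1
      - lam1 Ω' * inner ℝ (z.1 - z'.1) u'.1 := by
    rw [inner_sub_left z.1, real_inner_comm u'.1 z'.1]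
    rw [real_inner_comm, i2, i4] at i3
    linarith
  have hov := overlap hs hfin hκ hK hu hu'
  set b : ℝ := inner ℝ u.1 u'.1 with hb
  have hDl : 0 ≤ lam1 Ω' - lam1 Ω := le_trans (mul_nonneg hγ0.le hov.1) hov.2
  have j1 : |(inner ℝ z.1 u'.1 : ℝ)| ≤ E / γ := by
    have := abs_real_inner_le_norm z.1 u'.1
    rw [hu'.2.2.1, mul_one] at this
    exact this.trans hzn'
  have j2 : (inner ℝ (z.1 - z'.1) u'.1 : ℝ) ≤ N * N1 * (2 * (tor Ω' - tor Ω)) := by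
    rw [← hDt, inner_LL, inner_LL, ← integral_const_mul]
    refine integral_mono_ae (integrable_mul_LL _ _) ((integrable_mul_LL _ _).const_mul _) ?_
    filter_upwards [hzz, Lp.coeFn_sub z.1 z'.1, Lp.coeFn_sub w.1 w'.1, hu'.2.1, hu'N, c3, EE_ae (n := n) R,
      VV_zero_ball (hs.trans hΩ) hu'.1] with x k1 k2 k3 k4 k5 k6 k7 k8
    rw [k2, k3, Pi.sub_apply, Pi.sub_apply, k7]
    by_cases hx : x ∈ ball (0 : Euc n) R
    · rw [indicator_of_mem hx, one_mul]
      calc (z.1 x - z'.1 x) * u'.1 x ≤ (N * (w.1 x - w'.1 x)) * u'.1 x :=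
            mul_le_mul_of_nonneg_right ((le_abs_self _).trans k1) k4
        _ ≤ (N * (w.1 x - w'.1 x)) * N1 :=
            mul_le_mul_of_nonneg_left k5 (mul_nonneg hN0 (by linarith))
        _ = _ := by ring
    · rw [indicator_of_notMem hx, k8 hx]; simp
  have hDt0 : 0 ≤ tor Ω' - tor Ω := by
    have : 0 ≤ (inner ℝ (EE n R) (w.1 - w'.1) : ℝ) := by
      refine inner_nonneg_LL ?_ ?_
      · filter_upwards [hE01] with x b
        rcases b with b | b <;> rw [b]; norm_num
      · filter_upwards [c3, Lp.coeFn_sub w.1 w'.1] with x b c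
        rw [c, Pi.sub_apply]; linarith
    linarith
  have k0 : ∫ x, |u.1 x - u'.1 x| = inner ℝ ψ (u.1 - u'.1) := by
    rw [inner_LL]
    refine integral_congr_ae ?_
    filter_upwards [hψ2, Lp.coeFn_sub u.1 u'.1, VV_zero_ball hΩ hu.1, VV_zero_ball (hs.trans hΩ) hu'.1]
      with x c d e f
    by_cases hx : x ∈ ball (0 : Euc n) R
    · rw [c hx, d, Pi.sub_apply]
    · rw [d, Pi.sub_apply, e hx, f hx]; simp
  have k1 : (inner ℝ ψp u'.1 : ℝ) = inner ℝ ψ u'.1 - a * b := by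
    rw [hψp, inner_sub_left, inner_smul_left, hb]; simp
  have k2 : ∫ x, |u.1 x - u'.1 x| = - inner ℝ ψp u'.1 + a * (1 - b) := by
    rw [k0, inner_sub_right, k1, ← ha]; ring
  have l1 : a * (1 - b) ≤ E / γ * (lam1 Ω' - lam1 Ω) := by
    have : 1 - b ≤ (lam1 Ω' - lam1 Ω) / γ := by
      rw [le_div_iff₀ hγ0, mul_comm]; exact hov.2
    calc a * (1 - b) ≤ E * (1 - b) := mul_le_mul_of_nonneg_right ((le_abs_self _).trans haE) hov.1
      _ ≤ E * ((lam1 Ω' - lam1 Ω) / γ) := mul_le_mul_of_nonneg_left this hE0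
      _ = _ := by ring
  have l2 : - ((lam1 Ω' - lam1 Ω) * (inner ℝ z.1 u'.1 : ℝ)) ≤ E / γ * (lam1 Ω' - lam1 Ω) := by
    have := mul_le_mul_of_nonneg_left (abs_le.1 j1).1 hDl
    linarith
  have l3 : lam1 Ω' * (inner ℝ (z.1 - z'.1) u'.1 : ℝ) ≤ 2 * Λ * (N * N1) * (tor Ω' - tor Ω) := by
    have h0 : 0 ≤ N * N1 * (2 * (tor Ω' - tor Ω)) := by positivity
    calc _ ≤ lam1 Ω' * (N * N1 * (2 * (tor Ω' - tor Ω))) := mul_le_mul_of_nonneg_left j2 (lam1_nonneg _)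
      _ ≤ Λ * (N * N1 * (2 * (tor Ω' - tor Ω))) := mul_le_mul_of_nonneg_right hl' h0
      _ = _ := by ring
  rw [k2, i5]
  have m1 : 0 ≤ E / γ := by positivity
  have m2 : 0 ≤ Λ * (N * N1) := by positivity
  have m3 := mul_nonneg m1 hDt0
  have m4 := mul_nonneg m2 hDl
  have : 2 * E / γ = 2 * (E / γ) := by ring
  rw [this]
  have e : (2 * (E / γ) + 2 * Λ * (N * N1) + 1) * ((lam1 Ω' - lam1 Ω) + (tor Ω' - tor Ω)) =
    2 * (E / γ * (lam1 Ω' - lam1 Ω)) + 2 * (E / γ * (tor Ω' - tor Ω)) +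
    2 * (Λ * (N * N1) * (lam1 Ω' - lam1 Ω)) + 2 * Λ * (N * N1) * (tor Ω' - tor Ω) +
    (lam1 Ω' - lam1 Ω) + (tor Ω' - tor Ω) := by ring
  rw [e]
  linarith
end a8

section a9
variable {n : ℕ}

theorem dST_zero {s : ℝ} (h : s ≤ 0) : deriv Real.smoothTransition s = 0 := by
  apply IsLocalMin.deriv_eq_zero
  refine Eventually.of_forall fun t => ?_
  rw [Real.smoothTransition.zero_of_nonpos h]; exact Real.smoothTransition.nonneg t

theorem dST_one {s : ℝ} (h : 1 ≤ s) : deriv Real.smoothTransition s = 0 := by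
  apply IsLocalMax.deriv_eq_zero
  refine Eventually.of_forall fun t => ?_
  rw [Real.smoothTransition.one_of_one_le h]; exact Real.smoothTransition.le_one t

theorem dST_bound : ∃ C, 0 < C ∧ ∀ s, |deriv Real.smoothTransition s| ≤ C := by
  have hc : Continuous (deriv Real.smoothTransition) :=
    (Real.smoothTransition.contDiff (n := 1)).continuous_deriv (by simp)
  obtain ⟨C, hC⟩ := isCompact_Icc.exists_bound_of_continuousOn (s := Icc (0:ℝ) 1) hc.continuousOn
  refine ⟨max C 1, by positivity, fun s => ?_⟩
  rcases le_or_gt s 0 with h | h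
  · rw [dST_zero h]; simp
  rcases le_or_gt s 1 with h' | h'
  · exact (hC s ⟨h.le, h'⟩).trans (le_max_left _ _)
  · rw [dST_one h'.le]; simp

def Cf (φ : Euc n → ℝ) (A : ℝ) : Prop :=
  ContDiff ℝ (⊤ : ℕ∞) φ ∧ (∀ x, 0 ≤ φ x ∧ φ x ≤ 1) ∧ ∀ x, ‖gradient φ x‖ ≤ A

theorem Cf.diff {φ : Euc n → ℝ} {A : ℝ} (h : Cf φ A) (x : Euc n) : DifferentiableAt ℝ φ x :=
  (h.1.differentiable (by simp)).differentiableAt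

theorem cutoff : ∃ K : ℝ, 0 < K ∧ ∀ (n : ℕ) (y : Euc n) (ρ ρ' : ℝ), 0 < ρ → ρ < ρ' →
    ∃ χ : Euc n → ℝ, Cf χ (K / (ρ' - ρ)) ∧ (∀ x ∈ ball y ((ρ + ρ') / 2), χ x = 1) ∧
      (∀ x ∉ ball y ρ', χ x = 0) ∧ (∀ x ∉ ball y ρ', gradient χ x = 0) := by
  obtain ⟨C, hC, hCb⟩ := dST_bound
  refine ⟨4 * C, by positivity, fun n y ρ ρ' hρ h => ?_⟩
  set μ := (ρ + ρ') / 2 with hμ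
  set D := ρ' ^ 2 - μ ^ 2 with hD
  have hD' : D = (ρ' - ρ) / 2 * (ρ' + μ) := by rw [hD, hμ]; ring
  have hD0 : 0 < D := by
    rw [hD']; have : 0 < ρ' - ρ := by linarith
    have : 0 < ρ' + μ := by rw [hμ]; linarith
    positivity
  set g : Euc n → ℝ := fun x => D⁻¹ * (ρ' ^ 2 - ‖x - y‖ ^ 2) with hg
  have hgs : ContDiff ℝ (⊤ : ℕ∞) g :=
    contDiff_const.mul (contDiff_const.sub ((contDiff_id.sub contDiff_const).norm_sq ℝ))
  have hgd : ∀ x, DifferentiableAt ℝ g x := fun x => (hgs.differentiable (by simp)).differentiableAt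
  have hgg : ∀ x, ‖gradient g x‖ ≤ D⁻¹ * (2 * ‖x - y‖) := by
    intro x
    have h1 : HasFDerivAt (fun x : Euc n => x - y) (ContinuousLinearMap.id ℝ (Euc n)) x :=
      (hasFDerivAt_id x).sub_const y
    have h2 := ((h1.norm_sq).const_sub (ρ' ^ 2)).const_mul D⁻¹
    have h3 : fderiv ℝ g x = _ := h2.fderiv
    unfold gradient
    rw [LinearIsometryEquiv.norm_map, h3, norm_smul, norm_neg, Real.norm_of_nonneg (by positivity)]
    refine mul_le_mul_of_nonneg_left ?_ (by positivity)
    rw [ContinuousLinearMap.comp_id]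
    refine (norm_nsmul_le).trans ?_
    rw [innerSL_apply_norm]; simp
  have hgout : ∀ x ∉ ball y ρ', g x ≤ 0 := by
    intro x hx
    rw [mem_ball, dist_eq_norm, not_lt] at hx
    have : ρ' ^ 2 ≤ ‖x - y‖ ^ 2 := pow_le_pow_left₀ (by linarith) hx 2
    exact mul_nonpos_of_nonneg_of_nonpos (by positivity) (by linarith)
  have hgrad : ∀ x, gradient (fun x => Real.smoothTransition (g x)) x
      = deriv Real.smoothTransition (g x) • gradient g x := fun x =>
    gradient_comp' (hgd x) ((Real.smoothTransition.contDiff (n := 1)).differentiable (by simp)).differentiableAt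
  have hout : ∀ x ∉ ball y ρ', gradient (fun x => Real.smoothTransition (g x)) x = 0 := by
    intro x hx
    rw [hgrad, dST_zero (hgout x hx), zero_smul]
  refine ⟨fun x => Real.smoothTransition (g x), ⟨?_, fun x => ⟨Real.smoothTransition.nonneg _,
    Real.smoothTransition.le_one _⟩, fun x => ?_⟩, fun x hx => ?_, fun x hx => ?_, hout⟩
  · exact Real.smoothTransition.contDiff.comp hgs
  · by_cases hx : x ∈ ball y ρ'
    · rw [hgrad, norm_smul]
      rw [mem_ball, dist_eq_norm] at hx
      calc _ ≤ C * (D⁻¹ * (2 * ‖x - y‖)) := mul_le_mul (hCb _) (hgg x) (norm_nonneg _) hC.le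
        _ ≤ C * (D⁻¹ * (2 * (ρ' + μ))) := by
          have : 0 ≤ μ := by rw [hμ]; linarith
          gcongr; linarith
        _ = _ := by
          have h1 : 0 < ρ' - ρ := by linarith
          have h2 : 0 < ρ' + μ := by rw [hμ]; linarith
          rw [hD']; field_simp; ring
    · rw [hout x hx, norm_zero]
      have : 0 < ρ' - ρ := by linarith
      positivity
  · apply Real.smoothTransition.one_of_one_le
    rw [mem_ball, dist_eq_norm] at hx
    have : ‖x - y‖ ^ 2 ≤ μ ^ 2 := by gcongr
    have h1 : D ≤ ρ' ^ 2 - ‖x - y‖ ^ 2 := by rw [hD]; linarith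
    calc (1:ℝ) = D⁻¹ * D := by field_simp
      _ ≤ _ := mul_le_mul_of_nonneg_left h1 (by positivity)
  · exact Real.smoothTransition.zero_of_nonpos (hgout x hx)

theorem Cf.compl {φ : Euc n → ℝ} {A : ℝ} (h : Cf φ A) : Cf (fun x => 1 - φ x) A ∧
    ∀ x, gradient (fun x => 1 - φ x) x = - gradient φ x := by
  have hg : ∀ x, gradient (fun x => 1 - φ x) x = - gradient φ x := by
    intro x
    unfold gradient
    rw [fderiv_const_sub, map_neg]
  refine ⟨⟨contDiff_const.sub h.1, fun x => ?_, fun x => ?_⟩, hg⟩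
  · have := h.2.1 x; constructor <;> linarith
  · rw [hg, norm_neg]; exact h.2.2 x

theorem Cf.sq {φ : Euc n → ℝ} {A : ℝ} (h : Cf φ A) : Cf (fun x => φ x * φ x) (2 * A) ∧
    ∀ x, gradient (fun x => φ x * φ x) x = (2 * φ x) • gradient φ x := by
  have hg : ∀ x, gradient (fun x => φ x * φ x) x = (2 * φ x) • gradient φ x := by
    intro x
    rw [gradient_mul' (h.diff x) (h.diff x), ← add_smul, two_mul]
  refine ⟨⟨h.1.mul h.1, fun x => ?_, fun x => ?_⟩, hg⟩
  · have := h.2.1 x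
    exact ⟨mul_nonneg this.1 this.1, by nlinarith⟩
  · rw [hg, norm_smul, Real.norm_of_nonneg (by linarith [(h.2.1 x).1])]
    refine mul_le_mul ?_ (h.2.2 x) (norm_nonneg _) (by norm_num)
    linarith [(h.2.1 x).2]

def mp (φ : Euc n → ℝ) (p : HH n) : HH n :=
  (mkL fun x => φ x * p.1 x, mkL fun x => φ x • p.2 x + p.1 x • gradient φ x)

theorem mp_fst {φ : Euc n → ℝ} {A : ℝ} (h : Cf φ A) (p : HH n) :
    (mp φ p).1 =ᵐ[volume] fun x => φ x * p.1 x := by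
  apply mkL_ae
  refine (Lp.memLp p.1).mono (h.1.continuous.aestronglyMeasurable.mul (Lp.aestronglyMeasurable p.1)) ?_
  refine Eventually.of_forall fun x => ?_
  rw [norm_mul, Real.norm_of_nonneg (h.2.1 x).1]
  exact mul_le_of_le_one_left (norm_nonneg _) (h.2.1 x).2

theorem mp_snd {φ : Euc n → ℝ} {A : ℝ} (h : Cf φ A) (p : HH n) :
    (mp φ p).2 =ᵐ[volume] fun x => φ x • p.2 x + p.1 x • gradient φ x := by
  apply mkL_ae
  refine (memLp_bmul h.1.continuous.aestronglyMeasurable (C := 1) (fun x => ?_) _).add ?_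
  · rw [abs_of_nonneg (h.2.1 x).1]; exact (h.2.1 x).2
  · refine (Lp.memLp p.1).of_le_mul (c := A)
      ((Lp.aestronglyMeasurable p.1).smul (continuous_gradient h.1).aestronglyMeasurable) ?_
    refine Eventually.of_forall fun x => ?_
    rw [norm_smul, mul_comm]
    exact mul_le_mul_of_nonneg_right (h.2.2 x) (norm_nonneg _)

theorem mp_lip {φ : Euc n → ℝ} {A : ℝ} (h : Cf φ A) (p q : HH n) :
    ‖mp φ p - mp φ q‖ ≤ (1 + A) * ‖p - q‖ := by
  have hA : 0 ≤ A := (norm_nonneg _).trans (h.2.2 0)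
  have hp1 : ‖(p - q).1‖ ≤ ‖p - q‖ := norm_fst_le _
  have hp2 : ‖(p - q).2‖ ≤ ‖p - q‖ := norm_snd_le _
  rw [Prod.norm_def]
  refine max_le ?_ ?_
  · have : ‖(mp φ p - mp φ q).1‖ ≤ ‖(p - q).1‖ := by
      refine Lp.norm_le_norm_of_ae_le ?_
      filter_upwards [mp_fst h p, mp_fst h q, Lp.coeFn_sub (mp φ p).1 (mp φ q).1, Lp.coeFn_sub p.1 q.1]
        with x a b c d
      rw [Prod.fst_sub, Prod.fst_sub, c, d, Pi.sub_apply, Pi.sub_apply, a, b, ← mul_sub, norm_mul,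
        Real.norm_of_nonneg (h.2.1 x).1]
      exact mul_le_of_le_one_left (norm_nonneg _) (h.2.1 x).2
    nlinarith [norm_nonneg (p - q)]
  · have key : (mp φ p - mp φ q).2 =ᵐ[volume] fun x => φ x • (p - q).2 x + (p - q).1 x • gradient φ x := by
      filter_upwards [mp_snd h p, mp_snd h q, Lp.coeFn_sub (mp φ p).2 (mp φ q).2, Lp.coeFn_sub p.1 q.1,
        Lp.coeFn_sub p.2 q.2] with x a b c d e
      rw [Prod.fst_sub, Prod.snd_sub, Prod.snd_sub, c, d, e, Pi.sub_apply, Pi.sub_apply, Pi.sub_apply, a, b,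
        smul_sub, sub_smul]
      abel
    have hs := mp_snd h (p - q)
    have h1 : MemLp (fun x => φ x • (p - q).2 x) 2 volume :=
      memLp_bmul h.1.continuous.aestronglyMeasurable (C := 1) (fun x => by
        rw [abs_of_nonneg (h.2.1 x).1]; exact (h.2.1 x).2) _
    have h2 : MemLp (fun x => (p - q).1 x • gradient φ x) 2 volume := by
      refine (Lp.memLp (p - q).1).of_le_mul (c := A)
        ((Lp.aestronglyMeasurable (p - q).1).smul (continuous_gradient h.1).aestronglyMeasurable) ?_
      refine Eventually.of_forall fun x => ?_
      rw [norm_smul, mul_comm]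
      exact mul_le_mul_of_nonneg_right (h.2.2 x) (norm_nonneg _)
    have e : (mp φ p - mp φ q).2 = mkL (fun x => φ x • (p - q).2 x) + mkL (fun x => (p - q).1 x • gradient φ x) := by
      apply Lp.ext
      filter_upwards [key, mkL_ae h1, mkL_ae h2, Lp.coeFn_add (mkL (fun x => φ x • (p - q).2 x))
        (mkL (fun x => (p - q).1 x • gradient φ x))] with x a b c d
      rw [a, d, Pi.add_apply, b, c]
    have n1 : ‖mkL (fun x => φ x • (p - q).2 x)‖ ≤ ‖(p - q).2‖ := by
      refine Lp.norm_le_norm_of_ae_le ?_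
      filter_upwards [mkL_ae h1] with x a
      rw [a, norm_smul, Real.norm_of_nonneg (h.2.1 x).1]
      exact mul_le_of_le_one_left (norm_nonneg _) (h.2.1 x).2
    have n2 : ‖mkL (fun x => (p - q).1 x • gradient φ x)‖ ≤ A * ‖(p - q).1‖ := by
      refine Lp.norm_le_mul_norm_of_ae_le_mul ?_
      filter_upwards [mkL_ae h2] with x a
      rw [a, norm_smul, mul_comm]
      exact mul_le_mul_of_nonneg_right (h.2.2 x) (norm_nonneg _)
    rw [e]
    refine (norm_add_le _ _).trans ?_
    have := mul_le_mul_of_nonneg_left hp1 hA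
    linarith

theorem mp_VV {φ : Euc n → ℝ} {A : ℝ} (h : Cf φ A) {Ω Ω' : Set (Euc n)} (hs : tsupport φ ∩ Ω ⊆ Ω')
    {p : HH n} (hp : p ∈ VV Ω) : mp φ p ∈ VV Ω' := by
  have hA : 0 ≤ A := (norm_nonneg _).trans (h.2.2 0)
  rw [mem_VV, Metric.mem_closure_iff] at hp ⊢
  intro ε hε
  obtain ⟨q, ⟨f, hf, hf1, hf2⟩, hd⟩ := hp (ε / (1 + A)) (by positivity)
  refine ⟨mp φ q, ⟨fun x => φ x * f x, ⟨h.1.mul hf.1, hf.2.1.mul_left, ?_⟩, ?_, ?_⟩, ?_⟩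
  · refine subset_trans ?_ hs
    refine subset_inter (tsupport_mul_subset_left) ?_
    exact (tsupport_mul_subset_right).trans hf.2.2
  · filter_upwards [mp_fst h q, hf1] with x a b
    rw [a, b]
  · filter_upwards [mp_snd h q, hf1, hf2] with x a b c
    rw [a, b, c, gradient_mul' (h.diff x) (hf.diff x)]
  · rw [dist_eq_norm] at hd ⊢
    refine (mp_lip h p q).trans_lt ?_
    rw [lt_div_iff₀ (by positivity)] at hd
    linarith

theorem integrable_bdd_mul {f : Euc n → ℝ} (hf : Integrable f) {a : Euc n → ℝ} (ha : Continuous a) {C : ℝ}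
    (hC : ∀ x, |a x| ≤ C) : Integrable (fun x => a x * f x) :=
  hf.bdd_mul ha.aestronglyMeasurable (Eventually.of_forall hC)

theorem int_sq_LL (f : LL n) : Integrable (fun x => f x ^ 2) := by
  refine (integrable_sq_L2 f).congr (Eventually.of_forall fun x => ?_)
  simp

theorem caccio {φ : Euc n → ℝ} {A : ℝ} (h : Cf φ A) {Ω : Set (Euc n)} {F : LL n} {p : HH n} (hp : WS Ω F p) :
    ‖(mp φ p).2‖ ^ 2 = (∫ x, φ x ^ 2 * (F x * p.1 x)) + ∫ x, ‖gradient φ x‖ ^ 2 * p.1 x ^ 2 := by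
  have hV : mp (fun x => φ x * φ x) p ∈ VV Ω := mp_VV h.sq.1 inter_subset_right hp.1
  have e := hp.2 _ hV
  have e1 : (inner ℝ F (mp (fun x => φ x * φ x) p).1 : ℝ) = ∫ x, φ x ^ 2 * (F x * p.1 x) := by
    rw [inner_LL]
    refine integral_congr_ae ?_
    filter_upwards [mp_fst h.sq.1 p] with x a
    rw [a]; ring
  rw [← e1, ← e, inner_LV, normsq_L2, ← integral_add (L2.integrable_inner _ _)]
  · refine integral_congr_ae ?_
    filter_upwards [mp_snd h p, mp_snd h.sq.1 p] with x a b
    rw [a, b, h.sq.2, norm_add_sq_real, norm_smul, norm_smul, inner_add_right, inner_smul_right,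
      inner_smul_right, inner_smul_right, inner_smul_left, inner_smul_right, real_inner_self_eq_norm_sq,
      mul_pow, mul_pow, Real.norm_eq_abs, Real.norm_eq_abs, sq_abs, sq_abs]
    simp only [conj_trivial]
    ring
  · refine integrable_bdd_mul (int_sq_LL _) ((continuous_gradient h.1).norm.pow 2) (C := A ^ 2) fun x => ?_
    rw [abs_of_nonneg (by positivity)]
    exact pow_le_pow_left₀ (norm_nonneg _) (h.2.2 x) 2
end a9

section a10

theorem iter_step {K1 Λ K β s0 a q r t P Q M U H M' U' : ℝ} (hK1 : 0 < K1) (hΛ : 0 ≤ Λ) (hK : 0 ≤ K)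
    (hβ : 0 < β) (hβ1 : β ≤ 1) (ha : 0 < a) (hr : 0 < r) (hr1 : r < 1) (ht : 0 < t) (ht1 : t ≤ 1)
    (hP : 0 < P) (hQ : 0 < Q)
    (hq : K1 * (65 * β) ≤ q) (hs0 : 2 * s0 ^ 2 * (Λ + 64 * K + 1) ≤ β ^ 2 * q / 16)
    (hM : M ≤ a * P * Q) (hU : U ≤ a * β ^ 2 * (P * r ^ 2) * (Q * t ^ 4))
    (hH : ∀ θ, 0 < θ → H ≤ (θ * M + U / θ) / 2)
    (h1 : M' ≤ K1 * (U / (r * t / 8) ^ 2 + H))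
    (h2 : U' ≤ 2 * (s0 * r * t) ^ 2 * ((Λ + K / (r * t / 8) ^ 2) * U + H)) :
    M' ≤ a * P * (Q * q) ∧ U' ≤ a * β ^ 2 * (P * r ^ 2) * (Q * q * (t / 2) ^ 4) := by
  have hH' : H ≤ a * β * P * r * Q * t ^ 2 := by
    refine (hH (β * r * t ^ 2) (by positivity)).trans ?_
    have e1 : β * r * t ^ 2 * M ≤ β * r * t ^ 2 * (a * P * Q) := by gcongr
    have e2 : U / (β * r * t ^ 2) ≤ a * β * P * r * Q * t ^ 2 := by
      rw [div_le_iff₀ (by positivity)]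
      refine hU.trans (le_of_eq (by ring))
    have e3 : β * r * t ^ 2 * (a * P * Q) = a * β * P * r * Q * t ^ 2 := by ring
    linarith
  have t2 : t ^ 2 ≤ 1 := pow_le_one₀ ht.le ht1
  have b2 : β ^ 2 ≤ β := pow_le_of_le_one hβ.le hβ1 two_ne_zero
  have r2 : r ^ 2 ≤ 1 := pow_le_one₀ hr.le hr1.le
  have hUd : U / (r * t / 8) ^ 2 ≤ 64 * a * β ^ 2 * P * Q * t ^ 2 := by
    rw [div_le_iff₀ (by positivity)]
    refine hU.trans (le_of_eq (by ring))
  constructor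
  · calc M' ≤ K1 * (64 * a * β ^ 2 * P * Q * t ^ 2 + a * β * P * r * Q * t ^ 2) := by
          refine h1.trans ?_; gcongr
      _ ≤ K1 * (64 * a * β * P * Q * 1 + a * β * P * 1 * Q * 1) := by gcongr
      _ = (a * P * Q) * (K1 * (65 * β)) := by ring
      _ ≤ (a * P * Q) * q := by gcongr
      _ = _ := by ring
  · have e1 : (Λ + K / (r * t / 8) ^ 2) * U + H ≤
        a * P * Q * t ^ 2 * (Λ + 64 * K + 1) := by
      have k1 : Λ * U ≤ Λ * (a * P * Q * t ^ 2) := by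
        refine mul_le_mul_of_nonneg_left ?_ hΛ
        calc U ≤ a * β ^ 2 * (P * r ^ 2) * (Q * t ^ 4) := hU
          _ = a * P * Q * t ^ 2 * (β ^ 2 * r ^ 2 * t ^ 2) := by ring
          _ ≤ a * P * Q * t ^ 2 * (1 * 1 * 1) := by gcongr; linarith
          _ = _ := by ring
      have k2 : K / (r * t / 8) ^ 2 * U ≤ 64 * K * (a * P * Q * t ^ 2) := by
        calc K / (r * t / 8) ^ 2 * U = K * (U / (r * t / 8) ^ 2) := by ring
          _ ≤ K * (64 * a * β ^ 2 * P * Q * t ^ 2) := by gcongr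
          _ ≤ K * (64 * a * 1 * P * Q * t ^ 2) := by gcongr; linarith
          _ = _ := by ring
      have k3 : H ≤ a * P * Q * t ^ 2 := by
        calc H ≤ a * β * P * r * Q * t ^ 2 := hH'
          _ ≤ a * 1 * P * 1 * Q * t ^ 2 := by gcongr
          _ = _ := by ring
      have e0 : a * P * Q * t ^ 2 * (Λ + 64 * K + 1) =
        Λ * (a * P * Q * t ^ 2) + 64 * K * (a * P * Q * t ^ 2) + a * P * Q * t ^ 2 := by ring
      rw [e0, add_mul]
      linarith
    calc U' ≤ 2 * (s0 * r * t) ^ 2 * (a * P * Q * t ^ 2 * (Λ + 64 * K + 1)) := by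
          refine h2.trans ?_; gcongr
      _ = (a * P * Q * t ^ 4 * r ^ 2) * (2 * s0 ^ 2 * (Λ + 64 * K + 1)) := by ring
      _ ≤ (a * P * Q * t ^ 4 * r ^ 2) * (β ^ 2 * q / 16) := by gcongr
      _ = _ := by ring

theorem iter {n : ℕ} (hn : 1 ≤ n) {K1 Λ K ω : ℝ} (hK1 : 0 < K1) (hΛ : 0 ≤ Λ) (hK : 0 ≤ K) (hω : 0 < ω) :
    ∃ c0 : ℝ, 0 < c0 ∧ ∀ c, 0 < c → c ≤ c0 → ∀ r, 0 < r → r < 1 → ∀ M U H : ℝ → ℝ, Monotone M → Monotone U →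
      (∀ ρ ρ', 0 < ρ → ρ < ρ' → ρ' ≤ r → M ρ ≤ K1 * (U ρ' / (ρ' - ρ) ^ 2 + H ρ')) →
      (∀ ρ ρ' s, 0 < ρ → ρ < ρ' → ρ' ≤ r → 0 < s → 2 * M ρ' ≤ s ^ n * ω →
        U ρ ≤ 2 * s ^ 2 * ((Λ + K / (ρ' - ρ) ^ 2) * U ρ' + H ρ')) →
      (∀ ρ θ, 0 < θ → H ρ ≤ (θ * M ρ + U ρ / θ) / 2) →
      U r ≤ (c * r) ^ 2 * (r ^ n * ω) → H r ≤ c * r * (r ^ n * ω) → M (r / 4) ≤ 0 := by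
  set q : ℝ := (1 / 2) ^ n with hq
  have hq0 : 0 < q := by positivity
  have hq1 : q < 1 := pow_lt_one₀ (by norm_num) (by norm_num) (by omega)
  set β := min 1 (q / (65 * K1)) with hβ
  have hβ0 : 0 < β := by positivity
  have hβ1 : β ≤ 1 := min_le_left _ _
  have hβq : K1 * (65 * β) ≤ q := by
    have : β ≤ q / (65 * K1) := min_le_right _ _
    rw [le_div_iff₀ (by positivity)] at this
    linarith
  set s0 := min 1 (β ^ 2 * q / (32 * (Λ + 64 * K + 1))) with hs0
  have hs00 : 0 < s0 := by positivity
  have hs01 : s0 ≤ 1 := min_le_left _ _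
  have hs0q : 2 * s0 ^ 2 * (Λ + 64 * K + 1) ≤ β ^ 2 * q / 16 := by
    have : s0 ≤ β ^ 2 * q / (32 * (Λ + 64 * K + 1)) := min_le_right _ _
    rw [le_div_iff₀ (by positivity)] at this
    have h2 : s0 ^ 2 ≤ s0 := pow_le_of_le_one hs00.le hs01 two_ne_zero
    have : s0 ^ 2 * (Λ + 64 * K + 1) ≤ s0 * (Λ + 64 * K + 1) := by gcongr
    linarith
  set a := ω / 2 * s0 ^ n with ha
  have ha0 : 0 < a := by positivity
  refine ⟨min 1 (min (a / (5 * (K1 * ω))) (a * β ^ 2 / ω)), by positivity,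
    fun c hc hcc r hr hr1 M U H hMm hUm h1 h2 h3 hUr hHr => ?_⟩
  have hc1 : c ≤ 1 := hcc.trans (min_le_left _ _)
  have hc2 : c * (5 * (K1 * ω)) ≤ a := by
    rw [← le_div_iff₀ (by positivity)]
    exact hcc.trans ((min_le_right _ _).trans (min_le_left _ _))
  have hc3 : c * ω ≤ a * β ^ 2 := by
    rw [← le_div_iff₀ (by positivity)]
    exact hcc.trans ((min_le_right _ _).trans (min_le_right _ _))
  have hcs : c ^ 2 ≤ c := pow_le_of_le_one hc.le hc1 two_ne_zero
  have key : ∀ j : ℕ, M (r / 4 * (1 + (1/2) ^ j)) ≤ a * r ^ n * q ^ j ∧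
      U (r / 4 * (1 + (1/2) ^ j)) ≤ a * β ^ 2 * (r ^ n * r ^ 2) * (q ^ j * ((1/2) ^ j) ^ 4) := by
    intro j
    induction j with
    | zero =>
      have e : r / 4 * (1 + (1/2) ^ 0) = r / 2 := by ring
      rw [e]
      constructor
      · refine (h1 (r / 2) r (by linarith) (by linarith) le_rfl).trans ?_
        have k1 : U r / (r - r / 2) ^ 2 ≤ 4 * c * (r ^ n * ω) := by
          rw [div_le_iff₀ (pow_pos (by linarith) 2)]
          refine hUr.trans ?_
          have : c ^ 2 * (r ^ 2 * (r ^ n * ω)) ≤ c * (r ^ 2 * (r ^ n * ω)) := by gcongr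
          refine le_trans (le_of_eq ?_) (this.trans (le_of_eq ?_)) <;> ring
        have k2 : H r ≤ c * (r ^ n * ω) := by
          refine hHr.trans ?_
          have : c * r ≤ c * 1 := by gcongr
          rw [mul_one] at this
          gcongr
        calc K1 * (U r / (r - r / 2) ^ 2 + H r) ≤ K1 * (4 * c * (r ^ n * ω) + c * (r ^ n * ω)) := by gcongr
          _ = (c * (5 * (K1 * ω))) * r ^ n := by ring
          _ ≤ a * r ^ n := by gcongr
          _ = _ := by ring
      · refine (hUm (by linarith : r / 2 ≤ r)).trans (hUr.trans ?_)
        calc (c * r) ^ 2 * (r ^ n * ω) = (c ^ 2 * ω) * (r ^ n * r ^ 2) := by ring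
          _ ≤ (a * β ^ 2) * (r ^ n * r ^ 2) := by
            refine mul_le_mul_of_nonneg_right (le_trans ?_ hc3) (by positivity)
            gcongr
          _ = _ := by ring
    | succ j ih =>
      have ht1 : ((1:ℝ)/2) ^ j ≤ 1 := pow_le_one₀ (by norm_num) (by norm_num)
      have ht0 : 0 < ((1:ℝ)/2) ^ j := by positivity
      have tn : (((1:ℝ)/2) ^ j) ^ n = q ^ j := by rw [hq, ← pow_mul, ← pow_mul, mul_comm]
      have et : ((1:ℝ)/2) ^ (j+1) = (1/2) ^ j / 2 := by rw [pow_succ]; ring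
      rw [et, pow_succ q]
      set t := ((1:ℝ)/2) ^ j with ht
      have d1 : r / 4 * (1 + t) - r / 4 * (1 + t / 2) = r * t / 8 := by ring
      have o1 : 0 < r / 4 * (1 + t / 2) := by positivity
      have o2 : r / 4 * (1 + t / 2) < r / 4 * (1 + t) := by
        have : 0 < r * t / 8 := by positivity
        linarith
      have o3 : r / 4 * (1 + t) ≤ r := by
        have := mul_le_mul_of_nonneg_left ht1 hr.le
        linarith
      have g1 := h1 _ _ o1 o2 o3
      have g2 := h2 _ _ (s0 * r * t) o1 o2 o3 (by positivity) (by
        rw [mul_pow, mul_pow, tn]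
        refine (mul_le_mul_of_nonneg_left ih.1 (by norm_num)).trans (le_of_eq ?_)
        rw [ha]; ring)
      rw [d1] at g1 g2
      exact iter_step hK1 hΛ hK hβ0 hβ1 ha0 hr hr1 ht0 ht1 (by positivity) (by positivity) hβq hs0q ih.1 ih.2
        (fun θ hθ => h3 _ θ hθ) g1 g2
  have hlim : Tendsto (fun j : ℕ => a * r ^ n * q ^ j) atTop (𝓝 (a * r ^ n * 0)) :=
    (tendsto_pow_atTop_nhds_zero_of_lt_one hq0.le hq1).const_mul _
  rw [mul_zero] at hlim
  refine ge_of_tendsto' hlim fun j => (hMm ?_).trans (key j).1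
  have : 0 < ((1:ℝ)/2) ^ j := by positivity
  have := mul_pos hr this
  linarith
end a10

section a11
variable {n : ℕ}

theorem ind_mono {f g : Euc n → ℝ} {B : Set (Euc n)} (hB : MeasurableSet B) (hf : Integrable f)
    (hg : Integrable g) (h1 : ∀ᵐ x, x ∈ B → f x ≤ g x) (h2 : ∀ᵐ x, x ∉ B → f x ≤ 0) :
    ∫ x, f x ≤ ∫ x in B, g x := by
  rw [← integral_indicator hB]
  refine integral_mono_ae hf (hg.indicator hB) ?_
  filter_upwards [h1, h2] with x a b
  by_cases h : x ∈ B
  · rw [indicator_of_mem h]; exact a h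
  · rw [indicator_of_notMem h]; exact b h

theorem ind_mono' {f g : Euc n → ℝ} {B : Set (Euc n)} (hB : MeasurableSet B) (hf : Integrable f)
    (hg : Integrable g) (h1 : ∀ᵐ x, x ∈ B → g x ≤ f x) (h2 : ∀ᵐ x, x ∉ B → 0 ≤ f x) :
    ∫ x in B, g x ≤ ∫ x, f x := by
  rw [← integral_indicator hB]
  refine integral_mono_ae (hg.indicator hB) hf ?_
  filter_upwards [h1, h2] with x a b
  by_cases h : x ∈ B
  · rw [indicator_of_mem h]; exact a h
  · rw [indicator_of_notMem h]; exact b h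

theorem grad_le {φ : Euc n → ℝ} {A ρ : ℝ} {y : Euc n} (h : Cf φ A) (hg : ∀ x ∉ ball y ρ, gradient φ x = 0)
    (f : LL n) : ∫ x, ‖gradient φ x‖ ^ 2 * f x ^ 2 ≤ A ^ 2 * ∫ x in ball y ρ, f x ^ 2 := by
  rw [← integral_const_mul]
  have hb : ∀ x, ‖gradient φ x‖ ^ 2 ≤ A ^ 2 := fun x => pow_le_pow_left₀ (norm_nonneg _) (h.2.2 x) 2
  refine ind_mono measurableSet_ball (integrable_bdd_mul (int_sq_LL f)
    ((continuous_gradient h.1).norm.pow 2) (C := A ^ 2) fun x => ?_) ((int_sq_LL f).const_mul _) ?_ ?_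
  · rw [abs_of_nonneg (by positivity)]; exact hb x
  · exact Eventually.of_forall fun x _ => mul_le_mul_of_nonneg_right (hb x) (sq_nonneg _)
  · exact Eventually.of_forall fun x hx => by rw [hg x hx]; simp

theorem Cf.sq_bd {φ : Euc n → ℝ} {A : ℝ} (h : Cf φ A) (x : Euc n) : |φ x ^ 2| ≤ 1 := by
  rw [abs_of_nonneg (sq_nonneg _)]
  exact pow_le_one₀ (h.2.1 x).1 (h.2.1 x).2

theorem mp_normsq {φ : Euc n → ℝ} {A : ℝ} (h : Cf φ A) (p : HH n) :
    ‖(mp φ p).1‖ ^ 2 = ∫ x, φ x ^ 2 * p.1 x ^ 2 := by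
  rw [normsq_LL]
  refine integral_congr_ae ?_
  filter_upwards [mp_fst h p] with x a
  rw [a]; ring

theorem int_cut {φ : Euc n → ℝ} {A : ℝ} (h : Cf φ A) {f : Euc n → ℝ} (hf : Integrable f) :
    Integrable fun x => φ x ^ 2 * f x :=
  integrable_bdd_mul hf (h.1.continuous.pow 2) (C := 1) h.sq_bd

theorem loc_est {χ : Euc n → ℝ} {A ρ ρ' : ℝ} {y : Euc n} (h : Cf χ A) (h1 : ∀ x ∈ ball y ρ, χ x = 1)
    (h0 : ∀ x ∉ ball y ρ', χ x = 0) (hg : ∀ x ∉ ball y ρ', gradient χ x = 0) {Ω : Set (Euc n)} {F : LL n}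
    {p : HH n} (hp : WS Ω F p) {g : Euc n → ℝ} (gi : Integrable g) (g0 : ∀ᵐ x, 0 ≤ g x)
    (hFg : ∀ᵐ x, F x * p.1 x ≤ g x) {s : ℝ} (hs : 0 < s)
    (hv : 2 * volume.real (Ω ∩ ball y ρ') ≤ s ^ n * volume.real (ball (0 : Euc n) 1)) :
    ∫ x in ball y ρ, p.1 x ^ 2 ≤ 2 * s ^ 2 * ((∫ x in ball y ρ', g x) + A ^ 2 * ∫ x in ball y ρ', p.1 x ^ 2) := by
  have hV : mp χ p ∈ VV Ω := mp_VV h inter_subset_right hp.1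
  have e1 := FKr (VV_mono (subset_univ _) hV) hs (S := Ω ∩ ball y ρ') (by
    filter_upwards [VV_ae_zero hp.1, mp_fst h p] with x a b hx
    rw [b]
    by_cases hb : x ∈ ball y ρ'
    · rw [a fun h' => hx ⟨h', hb⟩, mul_zero]
    · rw [h0 x hb, zero_mul]) (ne_top_of_le_ne_top measure_ball_lt_top.ne (measure_mono inter_subset_right)) hv
  rw [caccio h hp, mp_normsq h] at e1
  have e2 : ∫ x in ball y ρ, p.1 x ^ 2 ≤ ∫ x, χ x ^ 2 * p.1 x ^ 2 :=
    ind_mono' measurableSet_ball (int_cut h (int_sq_LL _)) (int_sq_LL _)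
      (Eventually.of_forall fun x hx => by rw [h1 x hx]; simp)
      (Eventually.of_forall fun x _ => by positivity)
  have e3 : ∫ x, χ x ^ 2 * (F x * p.1 x) ≤ ∫ x in ball y ρ', g x := by
    refine ind_mono measurableSet_ball (int_cut h (integrable_mul_LL F p.1)) gi ?_ ?_
    · filter_upwards [g0, hFg] with x a b _
      calc χ x ^ 2 * (F x * p.1 x) ≤ χ x ^ 2 * g x := by gcongr
        _ ≤ 1 * g x := by gcongr; exact (abs_le.1 (h.sq_bd x)).2
        _ = g x := one_mul _
    · exact Eventually.of_forall fun x hx => by rw [h0 x hx]; simp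
  have e4 := grad_le h hg p.1
  refine e2.trans (e1.trans ?_)
  gcongr

theorem lam_est {χ : Euc n → ℝ} {A ρ' : ℝ} {y : Euc n} (h : Cf χ A)
    (h0 : ∀ x ∉ ball y ρ', χ x = 0) (hg : ∀ x ∉ ball y ρ', gradient χ x = 0) {Ω Ω' : Set (Euc n)}
    (hs : tsupport (fun x => 1 - χ x) ∩ Ω ⊆ Ω') {u : HH n} (hu : EF Ω u)
    (hU : ∫ x in ball y ρ', u.1 x ^ 2 ≤ 1 / 2) :
    mp (fun x => 1 - χ x) u ∈ VV Ω' ∧ 1 / 2 ≤ ‖(mp (fun x => 1 - χ x) u).1‖ ^ 2 ∧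
    (lam1 Ω ≤ lam1 Ω' → lam1 Ω' - lam1 Ω ≤ 2 * A ^ 2 * ∫ x in ball y ρ', u.1 x ^ 2) := by
  obtain ⟨hc, hcg⟩ := h.compl
  have hV := mp_VV hc hs hu.1
  have hh : 1 / 2 ≤ ‖(mp (fun x => 1 - χ x) u).1‖ ^ 2 := by
    rw [mp_normsq hc]
    have e1 : ∫ x, (u.1 x ^ 2 - (1 - χ x) ^ 2 * u.1 x ^ 2) ≤ ∫ x in ball y ρ', u.1 x ^ 2 := by
      refine ind_mono measurableSet_ball ((int_sq_LL _).sub (int_cut hc (int_sq_LL _))) (int_sq_LL _) ?_ ?_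
      · exact Eventually.of_forall fun x _ => by
          have : 0 ≤ (1 - χ x) ^ 2 * u.1 x ^ 2 := by positivity
          linarith
      · exact Eventually.of_forall fun x hx => by rw [h0 x hx]; simp
    rw [integral_sub (int_sq_LL _) (int_cut hc (int_sq_LL _)), ← normsq_LL, hu.2.2.1] at e1
    linarith
  refine ⟨hV, hh, fun hle => ?_⟩
  have e2 := lam1_le hV
  rw [caccio hc (EF_WS hu)] at e2
  have e3 : ∫ x, (1 - χ x) ^ 2 * ((lam1 Ω • u.1 : LL n) x * u.1 x) = lam1 Ω * ‖(mp (fun x => 1 - χ x) u).1‖ ^ 2 := by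
    rw [mp_normsq hc, ← integral_const_mul]
    refine integral_congr_ae ?_
    filter_upwards [Lp.coeFn_smul (lam1 Ω) u.1] with x a
    rw [a]; simp only [Pi.smul_apply, smul_eq_mul]; ring
  have e4 := grad_le hc (y := y) (ρ := ρ') (fun x hx => by rw [hcg, hg x hx, neg_zero]) u.1
  rw [e3] at e2
  have e5 : (lam1 Ω' - lam1 Ω) * (1 / 2) ≤ (lam1 Ω' - lam1 Ω) * ‖(mp (fun x => 1 - χ x) u).1‖ ^ 2 :=
    mul_le_mul_of_nonneg_left hh (by linarith)
  have e6 : (lam1 Ω' - lam1 Ω) * ‖(mp (fun x => 1 - χ x) u).1‖ ^ 2 =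
    lam1 Ω' * ‖(mp (fun x => 1 - χ x) u).1‖ ^ 2 - lam1 Ω * ‖(mp (fun x => 1 - χ x) u).1‖ ^ 2 := by ring
  linarith

theorem tor_est (hn : 1 ≤ n) {R : ℝ} (hR : 0 < R) {χ : Euc n → ℝ} {A ρ' : ℝ} {y : Euc n} (h : Cf χ A)
    (h0 : ∀ x ∉ ball y ρ', χ x = 0) (hg : ∀ x ∉ ball y ρ', gradient χ x = 0) {Ω Ω' : Set (Euc n)}
    (hΩ : Ω ⊆ ball 0 R) (hΩ' : Ω' ⊆ ball 0 R)
    (hs : tsupport (fun x => 1 - χ x) ∩ Ω ⊆ Ω') {w : HH n} (hw : WS Ω (EE n R) w) (w0 : ∀ᵐ x, 0 ≤ w.1 x) :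
    tor Ω' - tor Ω ≤ 1 / 2 * (A ^ 2 * ∫ x in ball y ρ', w.1 x ^ 2) + 1 / 2 * ∫ x in ball y ρ', w.1 x := by
  obtain ⟨hc, hcg⟩ := h.compl
  have hV := mp_VV hc hs hw.1
  have e1 := tor_le hn hR hΩ' hV
  rw [JJ, caccio hc hw] at e1
  rw [tor_WS hn hR hΩ hw]
  have e4 := grad_le hc (y := y) (ρ := ρ') (fun x hx => by rw [hcg, hg x hx, neg_zero]) w.1
  have i0 := integrable_mul_LL (EE n R) w.1
  have e5 : (inner ℝ (EE n R) (mp (fun x => 1 - χ x) w).1 : ℝ) = ∫ x, (1 - χ x) * (EE n R x * w.1 x) := by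
    rw [inner_LL]
    refine integral_congr_ae ?_
    filter_upwards [mp_fst hc w] with x a
    rw [a]; ring
  have i1 : Integrable fun x => (1 - χ x) * (EE n R x * w.1 x) :=
    integrable_bdd_mul i0 hc.1.continuous (C := 1) fun x => by
      rw [abs_of_nonneg (hc.2.1 x).1]; exact (hc.2.1 x).2
  have e6 : (∫ x, χ x ^ 2 * (EE n R x * w.1 x)) = (∫ x, (1 - χ x) ^ 2 * (EE n R x * w.1 x))
      - 2 * (∫ x, (1 - χ x) * (EE n R x * w.1 x)) + ∫ x, EE n R x * w.1 x := by
    have i2 : Integrable fun x => (1 - χ x) ^ 2 * (EE n R x * w.1 x) - 2 * ((1 - χ x) * (EE n R x * w.1 x)) :=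
      (int_cut hc i0).sub (i1.const_mul 2)
    rw [← integral_const_mul, ← integral_sub (int_cut hc i0) (i1.const_mul 2), ← integral_add i2 i0]
    exact integral_congr_ae (Eventually.of_forall fun x => by simp only; ring)
  have hE : ∀ᵐ x, EE n R x * w.1 x = w.1 x := by
    filter_upwards [EE_ae (n := n) R, VV_zero_ball hΩ hw.1] with x a b
    rw [a]
    by_cases hx : x ∈ ball (0 : Euc n) R
    · simp [indicator_of_mem hx]
    · simp [b hx]
  have e7 : ∫ x, χ x ^ 2 * (EE n R x * w.1 x) ≤ ∫ x in ball y ρ', w.1 x := by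
    refine ind_mono measurableSet_ball (int_cut h i0) (int_LL (VV_zero_ball hΩ hw.1)).1 ?_ ?_
    · filter_upwards [hE, w0] with x a b _
      rw [a]
      calc χ x ^ 2 * w.1 x ≤ 1 * w.1 x := by gcongr; exact (abs_le.1 (h.sq_bd x)).2
        _ = w.1 x := one_mul _
    · exact Eventually.of_forall fun x hx => by rw [h0 x hx]; simp
  rw [e5] at e1
  rw [inner_LL]
  linarith
end a11

section a12
variable {n : ℕ}

theorem consts (hn : 1 ≤ n) {R v vmax : ℝ} (hR : 0 < R) (hv : 0 < v) (hvv : v < vmax) :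
    ∃ Λ m : ℝ, 0 ≤ Λ ∧ 0 < m ∧ ∀ η 𝔗 δ : ℝ, 0 < η → η ≤ 1 → 0 < 𝔗 → 𝔗 ≤ 1 → δ ≤ 1 →
      ∀ Ω ∈ Hclass n R vmax, baseE v η 𝔗 Ω ≤ Emin n R vmax v η 𝔗 + δ → lam1 Ω ≤ Λ ∧ m ≤ volume.real Ω := by
  have ω0 := om_pos (n := n)
  set ω := volume.real (ball (0 : Euc n) 1) with hω
  set r0 := min R (min 1 (v / ω)) with hr0
  have r0p : 0 < r0 := by rw [hr0]; positivity
  have r01 : r0 ≤ 1 := (min_le_right _ _).trans (min_le_left _ _)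
  have r0v : r0 ≤ v / ω := (min_le_right _ _).trans (min_le_right _ _)
  have hvol : (volume (ball (0 : Euc n) r0)).toReal ≤ v := by
    change volume.real _ ≤ v
    rw [real_ball r0 r0p, ← hω]
    have : r0 ^ n ≤ r0 ^ 1 := pow_le_pow_of_le_one r0p.le r01 hn
    rw [pow_one] at this
    calc r0 ^ n * ω ≤ v / ω * ω := by gcongr; linarith
      _ = v := by field_simp
  have hb : ball (0 : Euc n) r0 ∈ Hclass n R vmax :=
    ⟨isOpen_ball, ⟨0, mem_ball_self r0p⟩, ball_subset_ball (min_le_left _ _), hvol.trans hvv.le⟩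
  have hC : 0 ≤ Ct n R := by unfold Ct; positivity
  have hl0 := lam1_nonneg (ball (0 : Euc n) r0)
  set Λ := lam1 (ball (0 : Euc n) r0) + 1 + Ct n R + v with hΛ
  have hΛ0 : 0 < Λ := by rw [hΛ]; linarith
  set s := Real.sqrt (1 / (4 * (Λ + 1))) with hs
  have hs2 : s ^ 2 = 1 / (4 * (Λ + 1)) := Real.sq_sqrt (by positivity)
  have hsp : 0 < s := Real.sqrt_pos.2 (by positivity)
  refine ⟨Λ, s ^ n * ω / 2, hΛ0.le, by positivity, ?_⟩
  intro η 𝔗 δ hη h1 hT hT1 hδ Ω hΩ hE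
  have a1 := Emin_le hn hR hv hη h1 hT hb
  have a2 := tor_nonpos hn hR hb.2.2.1
  have a3 : fpen v η (volume (ball (0 : Euc n) r0)).toReal ≤ 0 := by
    unfold fpen; rw [if_pos hvol]
    exact mul_nonpos_of_nonneg_of_nonpos hη.le (by linarith)
  have a4 : baseE v η 𝔗 (ball (0 : Euc n) r0) ≤ lam1 (ball (0 : Euc n) r0) := by
    unfold baseE
    have := mul_nonpos_of_nonneg_of_nonpos hT.le a2
    linarith
  have b1 := tor_ge hn hR hΩ.2.2.1
  have b2 := fpen_ge (v := v) (t := (volume Ω).toReal) hη h1 hv ENNReal.toReal_nonneg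
  have b3 : - Ct n R ≤ 𝔗 * tor Ω := by
    have := mul_le_mul_of_nonneg_left b1 hT.le
    have : 𝔗 * Ct n R ≤ 1 * Ct n R := by gcongr
    linarith
  have hl : lam1 Ω ≤ Λ := by
    unfold baseE at hE a4 a1
    rw [hΛ]; linarith
  refine ⟨hl, ?_⟩
  by_contra! hcon
  obtain ⟨p, hp, p1, p2⟩ := lam1_approx hΩ.1 hΩ.2.1 one_pos
  have := FKr (VV_mono (subset_univ _) hp) hsp (VV_ae_zero hp)
    (ne_top_of_le_ne_top measure_ball_lt_top.ne (measure_mono hΩ.2.2.1)) (by rw [← hω]; linarith)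
  rw [p1, hs2] at this
  have h3 : 2 * (1 / (4 * (Λ + 1))) * ‖p.2‖ ^ 2 ≤ 2 * (1 / (4 * (Λ + 1))) * (Λ + 1) := by gcongr; linarith
  have h4 : 2 * (1 / (4 * (Λ + 1))) * (Λ + 1) = 1 / 2 := by field_simp; norm_num
  linarith

theorem tsupp_compl {χ : Euc n → ℝ} {y : Euc n} {ρ ρ' : ℝ} (h : ρ < ρ')
    (h1 : ∀ x ∈ ball y ((ρ + ρ') / 2), χ x = 1) :
    tsupport (fun x => 1 - χ x) ⊆ (closedBall y ρ)ᶜ := by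
  have : tsupport (fun x => 1 - χ x) ⊆ (ball y ((ρ + ρ') / 2))ᶜ := by
    refine closure_minimal (fun x hx hb => hx ?_) isOpen_ball.isClosed_compl
    simp only [h1 x hb, sub_self]
  exact this.trans (compl_subset_compl.2 (closedBall_subset_ball (by linarith)))

theorem meas_arith {η m Dl Dt 𝔗 τ C h h' f : ℝ} (hτ : 0 < τ) (h1 : τ ≤ η / 2) (h2 : τ * C ≤ 1)
    (h3 : τ * C ≤ 𝔗) (hm : 0 ≤ m) (hl : 0 ≤ Dl) (ht : 0 ≤ Dt) (hf : η * m ≤ f)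
    (hmin : f ≤ Dl + 𝔗 * Dt + τ * (h' - h)) (hh : |h - h'| ≤ m + C * (Dl + Dt)) :
    η / 2 * m ≤ 2 * Dl + 2 * (𝔗 * Dt) := by
  have a : h' - h ≤ m + C * (Dl + Dt) := by have := (abs_le.1 hh).1; linarith
  have b := mul_le_mul_of_nonneg_left a hτ.le
  have e : τ * (m + C * (Dl + Dt)) = τ * m + τ * C * Dl + τ * C * Dt := by ring
  have c1 := mul_le_mul_of_nonneg_right h1 hm
  have c2 := mul_le_mul_of_nonneg_right h2 hl
  have c3 := mul_le_mul_of_nonneg_right h3 ht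
  linarith

/-- energy comparison with a subset -/
theorem compare (hn : 1 ≤ n) {R v vmax η 𝔗 δ κ Λ m0 C τ : ℝ} (hR : 0 < R) (hv : 0 < v) (hη : 0 < η) (h1 : η ≤ 1)
    (hT : 0 < 𝔗) (hκ0 : 0 < κ)
    (hΛ : ∀ Ω ∈ Hclass n R vmax, baseE v η 𝔗 Ω ≤ Emin n R vmax v η 𝔗 + δ → lam1 Ω ≤ Λ ∧ m0 ≤ volume.real Ω)
    (hκ : 𝔗 * Ct n R + δ + κ ≤ η * m0 / 2)
    (hC : ∀ Ω Ω' : Set (Euc n), Ω' ⊆ Ω → Ω ⊆ ball 0 R → KK Ω κ → lam1 Ω ≤ Λ → lam1 Ω' ≤ Λ →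
      ∀ u u', EF Ω u → EF Ω' u' → ∫ x, |u.1 x - u'.1 x| ≤ C * ((lam1 Ω' - lam1 Ω) + (tor Ω' - tor Ω)))
    {hfun : Set (Euc n) → ℝ} (ha : Admissible n R vmax v η 𝔗 δ hfun) (hτ : 0 < τ) (t1 : τ ≤ η / 2)
    (t2 : τ * C ≤ 1) (t3 : τ * C ≤ 𝔗) {Ω Ω' : Set (Euc n)} (hΩ : Ω ∈ Hclass n R vmax)
    (hΩ' : Ω' ∈ Hclass n R vmax) (hsub : Ω' ⊆ Ω)
    (hmin : mainE v η 𝔗 τ hfun Ω ≤ mainE v η 𝔗 τ hfun Ω') (hE : baseE v η 𝔗 Ω ≤ Emin n R vmax v η 𝔗 + δ)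
    (hDt : 0 ≤ tor Ω' - tor Ω) :
    η / 2 * volume.real (Ω \ Ω') ≤ 2 * (lam1 Ω' - lam1 Ω) + 2 * (𝔗 * (tor Ω' - tor Ω)) := by
  have hl : 0 ≤ lam1 Ω' - lam1 Ω := sub_nonneg.2 (lam1_mono hΩ'.1 hΩ'.2.1 hsub)
  have fin : ∀ A ∈ Hclass n R vmax, volume A ≠ ∞ := fun A hA =>
    ne_top_of_le_ne_top measure_ball_lt_top.ne (measure_mono hA.2.2.1)
  have hm : volume.real (Ω \ Ω') = volume.real Ω - volume.real Ω' := by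
    rw [measureReal_sdiff hsub hΩ'.1.measurableSet (fin _ hΩ)]
  have hf : η * volume.real (Ω \ Ω') ≤ fpen v η (volume Ω).toReal - fpen v η (volume Ω').toReal := by
    rw [hm]; exact fpen_diff hη h1 (ENNReal.toReal_mono (fin _ hΩ) (measure_mono hsub))
  have hm0 : 0 ≤ volume.real (Ω \ Ω') := measureReal_nonneg
  rcases le_or_gt (baseE v η 𝔗 Ω) (baseE v η 𝔗 Ω') with hc | hc
  · unfold baseE at hc
    have p1 := mul_nonneg hη.le hm0
    have p2 := mul_nonneg hT.le hDt
    have e : 𝔗 * (tor Ω' - tor Ω) = 𝔗 * tor Ω' - 𝔗 * tor Ω := by ring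
    linarith
  · have hE' : baseE v η 𝔗 Ω' ≤ Emin n R vmax v η 𝔗 + δ := by linarith
    obtain ⟨l1, m1⟩ := hΛ Ω hΩ hE
    obtain ⟨l2, m2⟩ := hΛ Ω' hΩ' hE'
    have k1 := lemK hn hR hv hη h1 hT hΩ hE m1 hκ
    have k2 := lemK hn hR hv hη h1 hT hΩ' hE' m2 hκ
    obtain ⟨u, hu⟩ := EF_exists hΩ.1 hΩ.2.1 (fin _ hΩ) hκ0 k1
    obtain ⟨u', hu'⟩ := EF_exists hΩ'.1 hΩ'.2.1 (fin _ hΩ') hκ0 k2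
    have hh := ha.2 Ω hΩ Ω' hΩ' hE hE' _ _ (UE_of_EF (fin _ hΩ) hκ0 k1 hu) (UE_of_EF (fin _ hΩ') hκ0 k2 hu')
    have hL := hC Ω Ω' hsub hΩ.2.2.1 k1 l1 l2 u u' hu hu'
    have hI : ∫ x, |Ω.indicator u.1 x - Ω'.indicator u'.1 x| = ∫ x, |u.1 x - u'.1 x| := by
      refine integral_congr_ae ?_
      filter_upwards [(eig_of_EF hu).2, (eig_of_EF hu').2] with x a b
      rw [← a, ← b]
    have hsd : (volume (symmDiff Ω Ω')).toReal = volume.real (Ω \ Ω') := by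
      rw [Set.symmDiff_def, sdiff_eq_empty.2 hsub, union_empty]; rfl
    rw [hI, hsd] at hh
    refine meas_arith (h := hfun Ω) (h' := hfun Ω') hτ t1 t2 t3 hm0 hl hDt hf ?_ (by linarith)
    unfold mainE baseE at hmin
    have e : 𝔗 * (tor Ω' - tor Ω) = 𝔗 * tor Ω' - 𝔗 * tor Ω := by ring
    have e' : τ * (hfun Ω' - hfun Ω) = τ * hfun Ω' - τ * hfun Ω := by ring
    linarith
end a12

section a13
variable {n : ℕ}

theorem est1 (hn : 1 ≤ n) {R vmax η 𝔗 Kc ρ ρ' : ℝ} (hR : 0 < R) (hη : 0 < η) (hT : 0 < 𝔗) (hT1 : 𝔗 ≤ 1)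
    {y : Euc n} (hρ : ρ < ρ') {χ : Euc n → ℝ} (hχ : Cf χ (Kc / (ρ' - ρ)))
    (χ1 : ∀ x ∈ ball y ((ρ + ρ') / 2), χ x = 1) (χ0 : ∀ x ∉ ball y ρ', χ x = 0)
    (χg : ∀ x ∉ ball y ρ', gradient χ x = 0) {Ω : Set (Euc n)} (hΩ : Ω ∈ Hclass n R vmax)
    (hc : ∀ Ω' ∈ Hclass n R vmax, Ω' ⊆ Ω → 0 ≤ tor Ω' - tor Ω →
      η / 2 * volume.real (Ω \ Ω') ≤ 2 * (lam1 Ω' - lam1 Ω) + 2 * (𝔗 * (tor Ω' - tor Ω)))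
    {u w : HH n} (hu : EF Ω u) (hw : WS Ω (EE n R) w) (w0 : ∀ᵐ x, 0 ≤ w.1 x)
    (hU : ∫ x in ball y ρ', u.1 x ^ 2 ≤ 1 / 2) :
    volume.real (Ω ∩ ball y ρ) ≤ 2 / η * (4 * Kc ^ 2 + 1) *
      (((∫ x in ball y ρ', u.1 x ^ 2) + 𝔗 * ∫ x in ball y ρ', w.1 x ^ 2) / (ρ' - ρ) ^ 2 +
        √𝔗 * ∫ x in ball y ρ', w.1 x) := by
  set Ω' := Ω \ closedBall y ρ with hΩ'
  have hsub : Ω' ⊆ Ω := sdiff_subset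
  have hs : tsupport (fun x => 1 - χ x) ∩ Ω ⊆ Ω' := fun x hx => ⟨hx.2, tsupp_compl hρ χ1 hx.1⟩
  obtain ⟨V1, V2, V3⟩ := lam_est hχ χ0 χg hs hu hU
  have hne : Ω'.Nonempty := by
    by_contra h
    rw [not_nonempty_iff_eq_empty] at h
    have hz := VV_ae_zero V1
    rw [h] at hz
    rw [normsq_LL, integral_congr_ae (g := fun _ => (0:ℝ)) (hz.mono fun x hx => by simp [hx])] at V2
    simp at V2; norm_num at V2
  have fin : volume Ω ≠ ∞ := ne_top_of_le_ne_top measure_ball_lt_top.ne (measure_mono hΩ.2.2.1)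
  have hH : Ω' ∈ Hclass n R vmax := ⟨hΩ.1.sdiff isClosed_closedBall, hne, hsub.trans hΩ.2.2.1,
    (ENNReal.toReal_mono fin (measure_mono hsub)).trans hΩ.2.2.2⟩
  have ht0 : 0 ≤ tor Ω' - tor Ω := sub_nonneg.2 (le_tor (R := R) hH.2.2.1 fun p hp =>
    tor_le hn hR hΩ.2.2.1 (VV_mono hsub hp))
  have a1 := hc Ω' hH hsub ht0
  have a2 := V3 (lam1_mono hH.1 hne hsub)
  have a3 := tor_est hn hR hχ χ0 χg hΩ.2.2.1 hH.2.2.1 hs hw w0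
  have a4 : volume.real (Ω ∩ ball y ρ) ≤ volume.real (Ω \ Ω') :=
    ENNReal.toReal_mono (ne_top_of_le_ne_top fin (measure_mono sdiff_subset))
      (measure_mono fun x hx => ⟨hx.1, fun h => h.2 (ball_subset_closedBall hx.2)⟩)
  have q1 : 0 ≤ ∫ x in ball y ρ', u.1 x ^ 2 := integral_nonneg fun x => sq_nonneg _
  have q2 : 0 ≤ ∫ x in ball y ρ', w.1 x ^ 2 := integral_nonneg fun x => sq_nonneg _
  have q3 : 0 ≤ ∫ x in ball y ρ', w.1 x := integral_nonneg_of_ae (ae_restrict_of_ae w0)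
  generalize (∫ x in ball y ρ', u.1 x ^ 2) = a at *
  generalize (∫ x in ball y ρ', w.1 x ^ 2) = b at *
  generalize (∫ x in ball y ρ', w.1 x) = l at *
  have d0 : 0 < ρ' - ρ := by linarith
  generalize ρ' - ρ = d at *
  have sT : 𝔗 ≤ √𝔗 := by
    rw [Real.le_sqrt hT.le hT.le]; nlinarith
  have c1 : η / 2 * volume.real (Ω ∩ ball y ρ) ≤ η / 2 * volume.real (Ω \ Ω') := by gcongr
  have c2 := mul_le_mul_of_nonneg_left a3 hT.le
  have c3 : 𝔗 * l ≤ √𝔗 * l := by gcongr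
  have X0 : 0 ≤ a / d ^ 2 := by positivity
  have Y0 : 0 ≤ 𝔗 * b / d ^ 2 := by positivity
  have Z0 : 0 ≤ √𝔗 * l := by positivity
  have e1 : 2 * (2 * (Kc / d) ^ 2 * a) = 4 * Kc ^ 2 * (a / d ^ 2) := by ring
  have e2 : 𝔗 * (1 / 2 * ((Kc / d) ^ 2 * b) + 1 / 2 * l) =
    1 / 2 * (Kc ^ 2 * (𝔗 * b / d ^ 2)) + 1 / 2 * (𝔗 * l) := by ring
  rw [e2] at c2
  have f1 : 0 ≤ Kc ^ 2 * (𝔗 * b / d ^ 2) := by positivity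
  have f2 : 0 ≤ Kc ^ 2 * (√𝔗 * l) := by positivity
  have e3 : 2 / η * (4 * Kc ^ 2 + 1) * ((a + 𝔗 * b) / d ^ 2 + √𝔗 * l) =
    2 / η * (4 * Kc ^ 2 * (a / d ^ 2) + 4 * (Kc ^ 2 * (𝔗 * b / d ^ 2)) + 4 * (Kc ^ 2 * (√𝔗 * l))
      + (a / d ^ 2 + 𝔗 * b / d ^ 2 + √𝔗 * l)) := by ring
  have e4 : volume.real (Ω ∩ ball y ρ) = 2 / η * (η / 2 * volume.real (Ω ∩ ball y ρ)) := by field_simp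
  rw [e3, e4]
  gcongr
  linarith

theorem est2 {R 𝔗 Kc Λ ρ ρ' s : ℝ} (hT : 0 < 𝔗) (hT1 : 𝔗 ≤ 1)
    {y : Euc n} (hρ : ρ < ρ') {χ : Euc n → ℝ} (hχ : Cf χ (Kc / (ρ' - ρ)))
    (χ1 : ∀ x ∈ ball y ((ρ + ρ') / 2), χ x = 1) (χ0 : ∀ x ∉ ball y ρ', χ x = 0)
    (χg : ∀ x ∉ ball y ρ', gradient χ x = 0) {Ω : Set (Euc n)} (hΩ : Ω ⊆ ball 0 R) (hΛ : lam1 Ω ≤ Λ)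
    {u w : HH n} (hu : EF Ω u) (hw : WS Ω (EE n R) w) (w0 : ∀ᵐ x, 0 ≤ w.1 x) (hs : 0 < s)
    (hv : 2 * volume.real (Ω ∩ ball y ρ') ≤ s ^ n * volume.real (ball (0 : Euc n) 1)) :
    (∫ x in ball y ρ, u.1 x ^ 2) + 𝔗 * (∫ x in ball y ρ, w.1 x ^ 2) ≤
      2 * s ^ 2 * ((Λ + Kc ^ 2 / (ρ' - ρ) ^ 2) * ((∫ x in ball y ρ', u.1 x ^ 2) + 𝔗 * ∫ x in ball y ρ', w.1 x ^ 2)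
        + √𝔗 * ∫ x in ball y ρ', w.1 x) := by
  have χ1' : ∀ x ∈ ball y ρ, χ x = 1 := fun x hx => χ1 x (ball_subset_ball (by linarith) hx)
  have l0 := lam1_nonneg Ω
  have a1 := loc_est hχ χ1' χ0 χg (EF_WS hu) (g := fun x => Λ * u.1 x ^ 2) ((int_sq_LL _).const_mul _)
    (Eventually.of_forall fun x => mul_nonneg (l0.trans hΛ) (sq_nonneg _)) (by
      filter_upwards [Lp.coeFn_smul (lam1 Ω) u.1] with x a
      rw [a]; simp only [Pi.smul_apply, smul_eq_mul]
      calc lam1 Ω * u.1 x * u.1 x = lam1 Ω * u.1 x ^ 2 := by ring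
        _ ≤ Λ * u.1 x ^ 2 := by gcongr) hs hv
  have a2 := loc_est hχ χ1' χ0 χg hw (g := w.1) (int_LL (VV_zero_ball hΩ hw.1)).1 w0 (by
      filter_upwards [EE_ae (n := n) R, VV_zero_ball hΩ hw.1] with x a b
      rw [a]
      by_cases hx : x ∈ ball (0 : Euc n) R
      · simp [indicator_of_mem hx]
      · simp [b hx]) hs hv
  rw [integral_const_mul] at a1
  have q1 : 0 ≤ ∫ x in ball y ρ', u.1 x ^ 2 := integral_nonneg fun x => sq_nonneg _
  have q2 : 0 ≤ ∫ x in ball y ρ', w.1 x ^ 2 := integral_nonneg fun x => sq_nonneg _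
  have q3 : 0 ≤ ∫ x in ball y ρ', w.1 x := integral_nonneg_of_ae (ae_restrict_of_ae w0)
  generalize (∫ x in ball y ρ', u.1 x ^ 2) = a at *
  generalize (∫ x in ball y ρ', w.1 x ^ 2) = b at *
  generalize (∫ x in ball y ρ', w.1 x) = l at *
  generalize ρ' - ρ = d at *
  have sT : 𝔗 ≤ √𝔗 := by
    rw [Real.le_sqrt hT.le hT.le]; nlinarith
  have c3 : 𝔗 * l ≤ √𝔗 * l := by gcongr
  have c2 := mul_le_mul_of_nonneg_left a2 hT.le
  have c4 : 0 ≤ Λ * (𝔗 * b) := mul_nonneg (l0.trans hΛ) (by positivity)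
  have c5 := mul_le_mul_of_nonneg_left (add_le_add c3 c4) (show 0 ≤ 2 * s ^ 2 by positivity)
  have e1 : 2 * s ^ 2 * ((Λ + Kc ^ 2 / d ^ 2) * (a + 𝔗 * b) + √𝔗 * l) =
    2 * s ^ 2 * (Λ * a + (Kc / d) ^ 2 * a) + 𝔗 * (2 * s ^ 2 * (l + (Kc / d) ^ 2 * b))
     + (2 * s ^ 2 * (√𝔗 * l + Λ * (𝔗 * b)) - 2 * s ^ 2 * (𝔗 * l + 0)) := by ring
  rw [e1]
  linarith

theorem est3 {R 𝔗 ρ θ : ℝ} (hT : 0 < 𝔗) {y : Euc n} {Ω : Set (Euc n)} (ho : IsOpen Ω) (hΩ : Ω ⊆ ball 0 R)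
    {u w : HH n} (hw : w ∈ VV Ω) (hθ : 0 < θ) :
    √𝔗 * (∫ x in ball y ρ, w.1 x) ≤ (θ * volume.real (Ω ∩ ball y ρ) +
      ((∫ x in ball y ρ, u.1 x ^ 2) + 𝔗 * ∫ x in ball y ρ, w.1 x ^ 2) / θ) / 2 := by
  have q1 : 0 ≤ ∫ x in ball y ρ, u.1 x ^ 2 := integral_nonneg fun x => sq_nonneg _
  have hm : MeasurableSet (Ω ∩ ball y ρ) := ho.measurableSet.inter measurableSet_ball
  have hi : IntegrableOn (fun _ : Euc n => (1:ℝ)) (Ω ∩ ball y ρ) :=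
    integrableOn_const (ne_top_of_le_ne_top measure_ball_lt_top.ne (measure_mono inter_subset_right))
  have i2 : Integrable ((Ω ∩ ball y ρ).indicator fun _ : Euc n => (1:ℝ)) := (integrable_indicator_iff hm).2 hi
  have key : √𝔗 * (∫ x in ball y ρ, w.1 x) ≤ ∫ x in ball y ρ,
      (θ / 2 * (Ω ∩ ball y ρ).indicator (fun _ => (1:ℝ)) x + 𝔗 / (2 * θ) * w.1 x ^ 2) := by
    rw [← integral_const_mul]
    refine setIntegral_mono_on_ae ((int_LL (VV_zero_ball hΩ hw)).1.const_mul _).integrableOn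
      ((i2.const_mul _).add ((int_sq_LL _).const_mul _)).integrableOn measurableSet_ball ?_
    filter_upwards [VV_ae_zero hw] with x a hx
    by_cases h : x ∈ Ω
    · have hm' : x ∈ Ω ∩ ball y ρ := ⟨h, hx⟩
      rw [indicator_of_mem hm']
      have e : θ / 2 * 1 + 𝔗 / (2 * θ) * w.1 x ^ 2 - √𝔗 * w.1 x = (θ - √𝔗 * w.1 x) ^ 2 / (2 * θ) := by
        rw [sub_sq, mul_pow, Real.sq_sqrt hT.le]; field_simp; ring
      have : 0 ≤ (θ - √𝔗 * w.1 x) ^ 2 / (2 * θ) := by positivity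
      linarith
    · rw [a h, indicator_of_notMem (fun h' => h h'.1)]; simp
  rw [integral_add (i2.const_mul _).integrableOn ((int_sq_LL _).const_mul _).integrableOn, integral_const_mul,
    integral_const_mul, setIntegral_indicator hm, setIntegral_const, inter_eq_right.2 inter_subset_right] at key
  have e : (θ * volume.real (Ω ∩ ball y ρ) + ((∫ x in ball y ρ, u.1 x ^ 2) + 𝔗 * ∫ x in ball y ρ, w.1 x ^ 2) / θ) / 2
    = θ / 2 * volume.real (Ω ∩ ball y ρ) + 𝔗 / (2 * θ) * (∫ x in ball y ρ, w.1 x ^ 2)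
      + (∫ x in ball y ρ, u.1 x ^ 2) / (2 * θ) := by field_simp; ring
  rw [e]
  have : 0 ≤ (∫ x in ball y ρ, u.1 x ^ 2) / (2 * θ) := by positivity
  simp only [smul_eq_mul, mul_one] at key
  linarith

theorem est0 {R 𝔗 c r : ℝ} (hT : 0 < 𝔗) (hr : 0 < r) {y : Euc n} {Ω : Set (Euc n)} (hΩ : Ω ⊆ ball 0 R)
    {u w : HH n} (u0 : ∀ᵐ x, 0 ≤ u.1 x) (hw : w ∈ VV Ω) (w0 : ∀ᵐ x, 0 ≤ w.1 x)
    (h : ∀ᵐ x, x ∈ ball y r → u.1 x + √𝔗 * w.1 x ≤ c * r) :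
    (∫ x in ball y r, u.1 x ^ 2) + 𝔗 * (∫ x in ball y r, w.1 x ^ 2) ≤
      (c * r) ^ 2 * (r ^ n * volume.real (ball (0 : Euc n) 1)) ∧
    √𝔗 * (∫ x in ball y r, w.1 x) ≤ c * r * (r ^ n * volume.real (ball (0 : Euc n) 1)) := by
  have hi : ∀ a : ℝ, IntegrableOn (fun _ : Euc n => a) (ball y r) := fun a =>
    integrableOn_const measure_ball_lt_top.ne
  constructor
  · rw [← integral_const_mul, ← integral_add (int_sq_LL _).integrableOn ((int_sq_LL _).const_mul _).integrableOn]
    refine (setIntegral_mono_on_ae ((int_sq_LL _).add ((int_sq_LL _).const_mul _)).integrableOn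
      (hi ((c * r) ^ 2)) measurableSet_ball ?_).trans_eq ?_
    · filter_upwards [u0, w0, h] with x a b d hx
      have h1 : 0 ≤ √𝔗 * w.1 x := by positivity
      calc u.1 x ^ 2 + 𝔗 * w.1 x ^ 2 = u.1 x ^ 2 + (√𝔗 * w.1 x) ^ 2 := by rw [mul_pow, Real.sq_sqrt hT.le]
        _ ≤ (u.1 x + √𝔗 * w.1 x) ^ 2 := by
          have := mul_nonneg a h1
          rw [add_sq]; linarith
        _ ≤ (c * r) ^ 2 := pow_le_pow_left₀ (by linarith) (d hx) 2
    · rw [setIntegral_const, smul_eq_mul, real_ball r hr]; ring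
  · rw [← integral_const_mul]
    refine (setIntegral_mono_on_ae ((int_LL (VV_zero_ball hΩ hw)).1.const_mul _).integrableOn
      (hi (c * r)) measurableSet_ball ?_).trans_eq ?_
    · filter_upwards [u0, w0, h] with x a b d hx
      have := d hx
      linarith
    · rw [setIntegral_const, smul_eq_mul, real_ball r hr]; ring
end a13

/-- **Nondegeneracy (linear growth from the boundary) for inward minimizers.** For an
inward minimizer `Ω` of `ℱ_τ` with nearly minimal base energy, the eigenfunction is
unique and `sup_{B_r(y)} (u_Ω + √𝔗·w_Ω) ≥ c_m·r` for all `y ∈ closure Ω`, `r ∈ (0,1)`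
(the sup bound is stated in ε-form). -/
theorem inward_minimizer_nondegeneracy (n : ℕ) (hn : 2 ≤ n) (R v vmax : ℝ)
    (hR : 0 < R) (hv : 0 < v) (hvv : v < vmax)
    (hvmax : vmax < (volume (ball (0 : Euc n) R)).toReal) :
    ∃ η₀ : ℝ, 0 < η₀ ∧ ∀ η : ℝ, 0 < η → η ≤ η₀ →
      ∃ δm 𝔗m cm : ℝ, 0 < δm ∧ 0 < 𝔗m ∧ 0 < cm ∧
        ∀ 𝔗 : ℝ, 0 < 𝔗 → 𝔗 < 𝔗m →
          ∃ τm : ℝ, 0 < τm ∧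
            ∀ hfun : Set (Euc n) → ℝ, Admissible n R vmax v η 𝔗 δm hfun →
            ∀ τ : ℝ, 0 < τ → τ < τm →
            ∀ Ω ∈ Hclass n R vmax,
              (∀ Ω' ∈ Hclass n R vmax, Ω' ⊆ Ω →
                mainE v η 𝔗 τ hfun Ω ≤ mainE v η 𝔗 τ hfun Ω') →
              baseE v η 𝔗 Ω ≤ Emin n R vmax v η 𝔗 + δm →
              ∃ u : Euc n → ℝ, UniqueEigen Ω u ∧
                ∀ w : Euc n → ℝ, IsTorsionFun Ω w →
                  ∀ y ∈ closure Ω, ∀ r : ℝ, 0 < r → r < 1 →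
                    ∀ ε : ℝ, 0 < ε →
                      ∃ x ∈ ball y r, cm * r - ε < u x + Real.sqrt 𝔗 * w x := by
  have hn1 : 1 ≤ n := by omega
  obtain ⟨Λ, m0, hΛ0, hm0, hΛ⟩ := consts hn1 hR hv hvv
  obtain ⟨Kc, hKc, hcut⟩ := cutoff
  have ω0 := om_pos (n := n)
  have hCt : 0 ≤ Ct n R := by unfold Ct; positivity
  refine ⟨1, one_pos, fun η hη h1 => ?_⟩
  have K1p : 0 < 2 / η * (4 * Kc ^ 2 + 1) := by positivity
  obtain ⟨c0, hc0, hit⟩ := iter hn1 K1p hΛ0 (sq_nonneg Kc) ω0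
  have hx : 0 < η * m0 := mul_pos hη hm0
  refine ⟨min 1 (η * m0 / 8), min 1 (η * m0 / (8 * (Ct n R + 1))),
    min c0 (min 1 (1 / (2 * volume.real (ball (0 : Euc n) 1)))), by positivity, by positivity, by positivity, ?_⟩
  generalize hδ : min 1 (η * m0 / 8) = δ
  generalize hc : min c0 (min 1 (1 / (2 * volume.real (ball (0 : Euc n) 1)))) = c
  have hδ1 : δ ≤ 1 := hδ ▸ min_le_left _ _
  have hδ2 : δ ≤ η * m0 / 8 := hδ ▸ min_le_right _ _
  have hcp : 0 < c := by rw [← hc]; positivity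
  have hcc0 : c ≤ c0 := hc ▸ min_le_left _ _
  have hc1 : c ≤ 1 := hc ▸ (min_le_right _ _).trans (min_le_left _ _)
  have hc2 : c ≤ 1 / (2 * volume.real (ball (0 : Euc n) 1)) := hc ▸ (min_le_right _ _).trans (min_le_right _ _)
  have hcω : c ^ 2 * volume.real (ball (0 : Euc n) 1) ≤ 1 / 2 := by
    calc c ^ 2 * volume.real (ball (0 : Euc n) 1) = c * c * volume.real (ball (0 : Euc n) 1) := by ring
      _ ≤ 1 * (1 / (2 * volume.real (ball (0 : Euc n) 1))) * volume.real (ball (0 : Euc n) 1) := by gcongr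
      _ = 1 / 2 := by field_simp
  intro 𝔗 hT hTm
  have hT1 : 𝔗 ≤ 1 := hTm.le.trans (min_le_left _ _)
  have hT2 : 𝔗 * Ct n R ≤ η * m0 / 8 := by
    have h2 : 𝔗 ≤ η * m0 / (8 * (Ct n R + 1)) := hTm.le.trans (min_le_right _ _)
    calc 𝔗 * Ct n R ≤ η * m0 / (8 * (Ct n R + 1)) * (Ct n R + 1) := by gcongr; linarith
      _ = η * m0 / 8 := by field_simp
  have hκ0 : 0 < η * m0 / 4 := by positivity
  have hκ : 𝔗 * Ct n R + δ + η * m0 / 4 ≤ η * m0 / 2 := by linarith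
  obtain ⟨C, hC0, hC⟩ := L1bound hn1 hR hΛ0 hκ0
  refine ⟨min (η / 2) (min (1 / C) (𝔗 / C)), by positivity, fun hfun ha τ hτ hτm Ω hΩ hmin hE => ?_⟩
  have t1 : τ ≤ η / 2 := hτm.le.trans (min_le_left _ _)
  have t2 : τ * C ≤ 1 := (le_div_iff₀ hC0).1 (hτm.le.trans ((min_le_right _ _).trans (min_le_left _ _)))
  have t3 : τ * C ≤ 𝔗 := (le_div_iff₀ hC0).1 (hτm.le.trans ((min_le_right _ _).trans (min_le_right _ _)))
  have fin : volume Ω ≠ ∞ := ne_top_of_le_ne_top measure_ball_lt_top.ne (measure_mono hΩ.2.2.1)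
  obtain ⟨l1, m1⟩ := hΛ η 𝔗 δ hη h1 hT hT1 hδ1 Ω hΩ hE
  have hK := lemK hn1 hR hv hη h1 hT hΩ hE m1 hκ
  obtain ⟨p, hp⟩ := EF_exists hΩ.1 hΩ.2.1 fin hκ0 hK
  refine ⟨Ω.indicator p.1, UE_of_EF fin hκ0 hK hp, fun w hw y hy r hr hr1 ε hε => ?_⟩
  by_contra! hcon
  obtain ⟨q, hq, hqw⟩ := torsion_WS hn1 hR hΩ.2.2.1 hw
  have q0 : ∀ᵐ x, 0 ≤ q.1 x := WS_nonneg hn1 hR hΩ.2.2.1 (by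
    filter_upwards [EE_ae (n := n) R] with x a
    rw [a]; exact indicator_nonneg (fun _ _ => zero_le_one) x) hq
  obtain ⟨b1, b2⟩ := est0 (c := c) hT hr hΩ.2.2.1 hp.2.1 hq.1 q0 (y := y) (by
    filter_upwards [(eig_of_EF hp).2, hqw] with x a b hx
    rw [a, b]
    have := hcon x hx
    linarith)
  have fI : ∀ ρ, volume (Ω ∩ ball y ρ) ≠ ∞ := fun ρ => ne_top_of_le_ne_top fin (measure_mono inter_subset_left)
  have mono1 : ∀ f : LL n, Monotone fun ρ : ℝ => ∫ x in ball y ρ, f x ^ 2 := fun f ρ ρ' h =>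
    setIntegral_mono_set (int_sq_LL f).integrableOn (Eventually.of_forall fun x => sq_nonneg _)
      (Eventually.of_forall (ball_subset_ball h))
  have hcmp : ∀ Ω' ∈ Hclass n R vmax, Ω' ⊆ Ω → 0 ≤ tor Ω' - tor Ω →
      η / 2 * volume.real (Ω \ Ω') ≤ 2 * (lam1 Ω' - lam1 Ω) + 2 * (𝔗 * (tor Ω' - tor Ω)) :=
    fun Ω' h' hs ht => compare hn1 hR hv hη h1 hT hκ0 (hΛ η 𝔗 δ hη h1 hT hT1 hδ1) hκ hC ha hτ t1 t2 t3 hΩ h' hs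
      (hmin Ω' h' hs) hE ht
  have hUh : ∫ x in ball y r, p.1 x ^ 2 ≤ 1 / 2 := by
    have h2 : 0 ≤ 𝔗 * ∫ x in ball y r, q.1 x ^ 2 := mul_nonneg hT.le (integral_nonneg fun x => sq_nonneg _)
    have h3 : (c * r) ^ 2 * (r ^ n * volume.real (ball (0 : Euc n) 1)) ≤
        (c * 1) ^ 2 * (1 * volume.real (ball (0 : Euc n) 1)) := by
      gcongr
      exact pow_le_one₀ hr.le hr1.le
    rw [mul_one, one_mul] at h3
    linarith
  have fl := hit c hcp hcc0 r hr hr1 (fun ρ => volume.real (Ω ∩ ball y ρ))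
    (fun ρ => (∫ x in ball y ρ, p.1 x ^ 2) + 𝔗 * ∫ x in ball y ρ, q.1 x ^ 2)
    (fun ρ => √𝔗 * ∫ x in ball y ρ, q.1 x)
    (fun ρ ρ' h => ENNReal.toReal_mono (fI ρ') (measure_mono (inter_subset_inter_right _ (ball_subset_ball h))))
    (fun ρ ρ' h => add_le_add (mono1 _ h) (mul_le_mul_of_nonneg_left (mono1 _ h) hT.le))
    (fun ρ ρ' h0 h h' => by
      obtain ⟨χ, x1, x2, x3, x4⟩ := hcut n y ρ ρ' h0 h
      exact est1 hn1 hR hη hT hT1 h x1 x2 x3 x4 hΩ hcmp hp hq q0 ((mono1 _ h').trans hUh))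
    (fun ρ ρ' s h0 h h' hs hv' => by
      obtain ⟨χ, x1, x2, x3, x4⟩ := hcut n y ρ ρ' h0 h
      exact est2 hT hT1 h x1 x2 x3 x4 hΩ.2.2.1 l1 hp hq q0 hs hv')
    (fun ρ θ hθ => est3 hT hΩ.1 hΩ.2.2.1 hq.1 hθ) b1 b2
  obtain ⟨z, hz1, hz2⟩ := mem_closure_iff.1 hy (ball y (r / 4)) isOpen_ball (mem_ball_self (by positivity))
  have hpos : 0 < volume.real (Ω ∩ ball y (r / 4)) := ENNReal.toReal_pos
    ((hΩ.1.inter isOpen_ball).measure_pos _ ⟨z, hz2, hz1⟩).ne' (fI _)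
  exact absurd fl (not_le.2 hpos)
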